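/- arXiv:2502.09807 — 2 statements merged into one kernel-verified Lean document; each statement's English description precedes it below -/
import Mathlib

section
/- Let ψ: ℕ → (0,∞) be monotonically decreasing with ψ(q) → 0 as q → ∞, let γ: ℤ^n × ℕ → [-1/2,1/2]^n satisfy max_{p} ‖γ(p,q)‖ → 0 as q → ∞, and let f be a dimension function such that r ↦ r^{-n} f(r) is monotonic. Suppose limsup_{q→∞} ( max_{1 ≤ ‖p‖ ≤ q} ‖γ(p,q)‖ ) / ( q · f(ψ(q)/q)^{1/n} ) < ∞. Then ℋ^f(W_n^γ(ψ)) = 0 if Σ_{q=1}^∞ q^n f(ψ(q)/q) < ∞, and ℋ^f(W_n^γ(ψ)) = ℋ^f([0,1]^n) if Σ_{q=1}^∞ q^n f(ψ(q)/q) = ∞. -/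
open MeasureTheory Filter Set

/-- The unit cube `[0,1]^n` in `ℝ^n` (with the maximum norm). -/
def unitCube (n : ℕ) : Set (Fin n → ℝ) := Set.univ.pi fun _ => Set.Icc (0 : ℝ) 1

/-- The Hausdorff measure `ℋ^f` associated with a dimension function `f`. -/
noncomputable def hausdorffWith {X : Type*} [EMetricSpace X] [MeasurableSpace X]
    [BorelSpace X] (f : ℝ → ℝ) : Measure X :=
  Measure.mkMetric fun r => ENNReal.ofReal (f r.toReal)

/-- `W_n^γ(ψ)`: the set of `x ∈ [0,1]^n` such that `‖qx - p + γ(p,q)‖ < ψ(q)` for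
infinitely many `(p,q) ∈ ℤ^n × ℕ`. -/
def Wgamma (n : ℕ) (ψ : ℕ → ℝ) (γ : (Fin n → ℤ) × ℕ → Fin n → ℝ) : Set (Fin n → ℝ) :=
  {x ∈ unitCube n |
    {pq : (Fin n → ℤ) × ℕ | 0 < pq.2 ∧
      ‖(pq.2 : ℝ) • x - (fun i => (pq.1 i : ℝ)) + γ pq‖ < ψ pq.2}.Infinite}

open Metric

/-- The total volume of finitely many disjoint balls inside `S` is at most the volume of `S`. -/
lemma ofReal_sum_pow_le_volume {n : ℕ} {ι : Type*} {S : Set (Fin n → ℝ)} {u : Finset ι}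
    {x : ι → Fin n → ℝ} {r : ι → ℝ} (hr : ∀ i ∈ u, 0 ≤ r i)
    (hdisj : (u : Set ι).PairwiseDisjoint fun i => closedBall (x i) (r i))
    (hsub : ∀ i ∈ u, closedBall (x i) (r i) ⊆ S) :
    ENNReal.ofReal (∑ i ∈ u, (2 * r i) ^ n) ≤ volume S := by
  rw [ENNReal.ofReal_sum_of_nonneg fun i hi => by have := hr i hi; positivity]
  calc ∑ i ∈ u, ENNReal.ofReal ((2 * r i) ^ n)
      = ∑ i ∈ u, volume (closedBall (x i) (r i)) := by
        refine Finset.sum_congr rfl fun i hi => ?_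
        rw [Real.volume_pi_closedBall _ (hr i hi), Fintype.card_fin]
    _ = volume (⋃ i ∈ u, closedBall (x i) (r i)) :=
        (measure_biUnion_finset hdisj fun i _ => isClosed_closedBall.measurableSet).symm
    _ ≤ volume S := measure_mono (iUnion₂_subset hsub)

lemma sum_pow_le_of_subset_closedBall {n : ℕ} {ι : Type*} {z : Fin n → ℝ} {R : ℝ}
    (hR : 0 ≤ R) {u : Finset ι}
    {x : ι → Fin n → ℝ} {r : ι → ℝ} (hr : ∀ i ∈ u, 0 ≤ r i)
    (hdisj : (u : Set ι).PairwiseDisjoint fun i => closedBall (x i) (r i))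
    (hsub : ∀ i ∈ u, closedBall (x i) (r i) ⊆ closedBall z R) :
    ∑ i ∈ u, r i ^ n ≤ R ^ n := by
  have h := ofReal_sum_pow_le_volume hr hdisj hsub
  rw [Real.volume_pi_closedBall _ hR, Fintype.card_fin,
    ENNReal.ofReal_le_ofReal_iff (by positivity)] at h
  simp only [mul_pow, ← Finset.mul_sum] at h
  exact le_of_mul_le_mul_left h (by positivity)

/-- A finite version of the Vitali covering lemma. -/
lemma exists_finset_disjoint_closedBall {n : ℕ} {ι : Type*} [Countable ι] {A : Set (Fin n → ℝ)}
    {V : ℝ} (hV : ENNReal.ofReal V ≤ volume A)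
    (t : Set ι) (x : ι → Fin n → ℝ) (r : ι → ℝ) (R : ℝ) (hr : ∀ i ∈ t, 0 ≤ r i)
    (hR : ∀ i ∈ t, r i ≤ R)
    (hcov : ∀ᵐ a ∂(volume : Measure (Fin n → ℝ)), a ∈ A → ∃ i ∈ t, a ∈ closedBall (x i) (r i)) :
    ∃ u : Finset ι, ↑u ⊆ t ∧ ((u : Set ι).PairwiseDisjoint fun i => closedBall (x i) (r i)) ∧
      V / 2 ≤ ∑ i ∈ u, (10 * r i) ^ n := by
  rcases le_or_gt V 0 with hV0 | hV0
  · exact ⟨∅, by simp, by simp, by simp; linarith⟩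
  obtain ⟨u, hut, hdisj, hu⟩ :=
    Vitali.exists_disjoint_subfamily_covering_enlargement_closedBall t x r R hR 5 (by norm_num)
  have h1 : volume A ≤ ∑' i : u, ENNReal.ofReal ((10 * r i) ^ n) := by
    calc volume A ≤ volume (⋃ i : u, closedBall (x i) (5 * r i)) := by
          refine measure_mono_ae ?_
          filter_upwards [hcov] with a ha haA
          obtain ⟨i, hi, hai⟩ := ha haA
          obtain ⟨b, hb, hb'⟩ := hu i hi
          exact mem_iUnion.2 ⟨⟨b, hb⟩, hb' hai⟩
      _ ≤ ∑' i : u, volume (closedBall (x i) (5 * r i)) := measure_iUnion_le _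
      _ = ∑' i : u, ENNReal.ofReal ((10 * r i) ^ n) := by
          refine tsum_congr fun i => ?_
          have := hr i (hut i.2)
          rw [Real.volume_pi_closedBall _ (by positivity), Fintype.card_fin]
          congr 2; ring
  have h2 : ENNReal.ofReal (V / 2) < ∑' i : u, ENNReal.ofReal ((10 * r i) ^ n) :=
    lt_of_lt_of_le ((ENNReal.ofReal_lt_ofReal_iff hV0).2 (by linarith)) (hV.trans h1)
  rw [ENNReal.tsum_eq_iSup_sum] at h2
  obtain ⟨w, hw⟩ := lt_iSup_iff.1 h2
  refine ⟨w.map (Function.Embedding.subtype _), ?_, ?_, ?_⟩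
  · intro i hi
    simp only [Finset.coe_map, Function.Embedding.subtype_apply, Set.mem_image] at hi
    obtain ⟨j, -, rfl⟩ := hi
    exact hut j.2
  · refine hdisj.subset fun i hi => ?_
    simp only [Finset.coe_map, Function.Embedding.subtype_apply, Set.mem_image] at hi
    obtain ⟨j, -, rfl⟩ := hi
    exact j.2
  · rw [← ENNReal.ofReal_sum_of_nonneg
      fun i _ => by have := hr i (hut i.2); positivity] at hw
    rw [Finset.sum_map]
    exact ((ENNReal.ofReal_lt_ofReal_iff_of_nonneg (by positivity)).1 hw).le

/-- Dirichlet's theorem on simultaneous approximation. -/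
lemma exists_int_norm_smul_sub_lt {n : ℕ} (x : Fin n → ℝ) {T : ℕ} (hT : 0 < T) :
    ∃ q : ℕ, 0 < q ∧ q ≤ T ^ n ∧ ∃ p : Fin n → ℤ,
      ‖(q : ℝ) • x - (fun i => (p i : ℝ))‖ < 1 / T := by
  have hT' : (0 : ℝ) < T := by exact_mod_cast hT
  let g : ℕ → Fin n → ℕ := fun q i => ⌊Int.fract ((q : ℝ) * x i) * T⌋₊
  have hg : Set.MapsTo g (Finset.range (T ^ n + 1))
      (Fintype.piFinset fun _ : Fin n => Finset.range T) := by
    intro q _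
    simp only [Finset.mem_coe, Fintype.mem_piFinset, Finset.mem_range, g]
    intro i
    rw [Nat.floor_lt (mul_nonneg (Int.fract_nonneg _) hT'.le)]
    nlinarith [Int.fract_lt_one ((q : ℝ) * x i)]
  obtain ⟨a, ha, b, hb, hab, hgab⟩ := Finset.exists_ne_map_eq_of_card_lt_of_maps_to
    (by simp) hg
  have key : ∀ a b : ℕ, a < b → b ≤ T ^ n → g a = g b → ∃ q : ℕ, 0 < q ∧ q ≤ T ^ n ∧
      ∃ p : Fin n → ℤ, ‖(q : ℝ) • x - (fun i => (p i : ℝ))‖ < 1 / T := by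
    intro a b hab hb hgab
    refine ⟨b - a, by omega, by omega, fun i => ⌊(b : ℝ) * x i⌋ - ⌊(a : ℝ) * x i⌋, ?_⟩
    rw [pi_norm_lt_iff (by positivity)]
    intro i
    have hi := congrFun hgab i
    simp only [g] at hi
    have h1 := Nat.floor_le (mul_nonneg (Int.fract_nonneg ((a : ℝ) * x i)) hT'.le)
    have h2 := Nat.lt_floor_add_one (Int.fract ((a : ℝ) * x i) * T)
    have h3 := Nat.floor_le (mul_nonneg (Int.fract_nonneg ((b : ℝ) * x i)) hT'.le)
    have h4 := Nat.lt_floor_add_one (Int.fract ((b : ℝ) * x i) * T)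
    rw [hi] at h1 h2
    have h5 : ((b - a : ℕ) : ℝ) = b - a := by push_cast [hab.le]; ring
    have h6 : (((b - a : ℕ) : ℝ) • x - fun i => ((⌊(b : ℝ) * x i⌋ - ⌊(a : ℝ) * x i⌋ : ℤ) : ℝ)) i
        = Int.fract ((b : ℝ) * x i) - Int.fract ((a : ℝ) * x i) := by
      simp only [Pi.sub_apply, Pi.smul_apply, smul_eq_mul, h5, Int.fract]
      push_cast; ring
    rw [h6, Real.norm_eq_abs, lt_div_iff₀ hT', ← abs_of_pos hT', ← abs_mul, abs_lt]
    constructor <;> nlinarith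
  rw [Finset.mem_range] at ha hb
  rcases lt_or_gt_of_ne hab with h | h
  · exact key a b h (by omega) hgab
  · exact key b a h (by omega) hgab.symm

/-- The points of a ball lying close to a rational point of denominator `q`. -/
lemma volume_near_rational_le {n : ℕ} (z : Fin n → ℝ) {s ε : ℝ} (hs : 0 < s) (hε : 0 < ε)
    (hε1 : ε ≤ 1) {q : ℕ} (hq : 0 < q) :
    volume {x ∈ closedBall z s | ∃ p : Fin n → ℤ, ‖(q : ℝ) • x - (fun i => (p i : ℝ))‖ < ε} ≤
      ENNReal.ofReal (((2 * q * s + 3) * (2 * (ε / q))) ^ n) := by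
  have hq' : (0 : ℝ) < q := by exact_mod_cast hq
  let P : Finset (Fin n → ℤ) :=
    Fintype.piFinset fun i => Finset.Icc ⌈q * z i - q * s - ε⌉ ⌊q * z i + q * s + ε⌋
  have hP : (P.card : ℝ) ≤ (2 * q * s + 3) ^ n := by
    simp only [P, Fintype.card_piFinset, Int.card_Icc, Nat.cast_prod]
    calc _ ≤ ∏ i : Fin n, (2 * q * s + 3) := by
          refine Finset.prod_le_prod (fun _ _ => Nat.cast_nonneg _) fun i _ => ?_
          have h1 := Int.floor_le (q * z i + q * s + ε)
          have h2 := Int.le_ceil (q * z i - q * s - ε)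
          have h4 : 0 ≤ q * s := by positivity
          rcases le_total (⌊q * z i + q * s + ε⌋ + 1 - ⌈q * z i - q * s - ε⌉) 0 with h | h
          · rw [Int.toNat_of_nonpos h]; push_cast; linarith
          · have h3 : (((⌊q * z i + q * s + ε⌋ + 1 - ⌈q * z i - q * s - ε⌉).toNat : ℤ) : ℝ)
              = ⌊q * z i + q * s + ε⌋ + 1 - ⌈q * z i - q * s - ε⌉ := by
              rw [Int.toNat_of_nonneg h]; push_cast; ring
            rw [Int.cast_natCast] at h3
            rw [h3]; linarith
      _ = _ := by simp
  calc _ ≤ volume (⋃ p ∈ P, closedBall (fun i => (p i : ℝ) / q) (ε / q)) := by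
        refine measure_mono ?_
        rintro x ⟨hx, p, hp⟩
        rw [mem_closedBall, dist_pi_le_iff hs.le] at hx
        rw [pi_norm_lt_iff hε] at hp
        simp only [Pi.sub_apply, Pi.smul_apply, smul_eq_mul, Real.norm_eq_abs, abs_lt] at hp
        refine mem_iUnion₂.2 ⟨p, ?_, ?_⟩
        · simp only [P, Fintype.mem_piFinset, Finset.mem_Icc, Int.ceil_le, Int.le_floor]
          intro i
          have h1 := hx i
          rw [Real.dist_eq, abs_le] at h1
          have h2 := hp i
          have h3 := mul_le_mul_of_nonneg_left h1.1 hq'.le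
          have h4 := mul_le_mul_of_nonneg_left h1.2 hq'.le
          constructor <;> linarith
        · rw [mem_closedBall, dist_pi_le_iff (by positivity)]
          intro i
          rw [Real.dist_eq, le_div_iff₀ hq', ← abs_of_pos hq', ← abs_mul, abs_of_pos hq', abs_le]
          have h2 := hp i
          have h3 : (x i - p i / q) * q = q * x i - p i := by field_simp
          rw [h3]
          constructor <;> linarith
    _ ≤ ∑ p ∈ P, volume (closedBall (fun i => (p i : ℝ) / q) (ε / q)) :=
        measure_biUnion_finset_le _ _
    _ = ENNReal.ofReal (P.card * (2 * (ε / q)) ^ n) := by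
        rw [Finset.sum_congr rfl fun p _ => Real.volume_pi_closedBall _ (by positivity)]
        rw [Finset.sum_const, nsmul_eq_mul, ENNReal.ofReal_mul (by positivity), Fintype.card_fin,
          ENNReal.ofReal_natCast]
    _ ≤ _ := by
        rw [mul_pow (2 * q * s + 3)]
        gcongr

/-- Many well-separated rational points with denominators of size about `T ^ n` in a ball. -/
lemma eventually_exists_separated_rationals {n : ℕ} (hn : 0 < n) (z : Fin n → ℝ) {s : ℝ}
    (hs : 0 < s) {η : ℝ} (hη : 0 < η) (hη1 : η * (4 * 5 ^ n) ≤ 1) :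
    ∀ᶠ T : ℕ in atTop, ∃ u : Finset ((Fin n → ℤ) × ℕ),
      (∀ pq ∈ u, η * T ^ n < pq.2 ∧ pq.2 ≤ T ^ n ∧
        closedBall (fun i => (pq.1 i : ℝ) / pq.2) (1 / (η * T ^ (n + 1))) ⊆ closedBall z s) ∧
      ((u : Set ((Fin n → ℤ) × ℕ)).PairwiseDisjoint fun pq =>
        closedBall (fun i => (pq.1 i : ℝ) / pq.2) (1 / (η * T ^ (n + 1)))) ∧
      s ^ n / (4 * 10 ^ n) ≤ u.card * (1 / (η * (T : ℝ) ^ (n + 1))) ^ n := by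
  obtain ⟨σ, hσ⟩ : ∃ σ, σ = s / 2 := ⟨_, rfl⟩
  have hσ0 : 0 < σ := by rw [hσ]; positivity
  have hlim1 : Tendsto (fun T : ℕ => ⌈1 / σ⌉₊ * (10 / (T : ℝ)) ^ n) atTop (nhds 0) := by
    have := ((tendsto_const_div_atTop_nhds_zero_nat (10 : ℝ)).pow n).const_mul (⌈1 / σ⌉₊ : ℝ)
    rwa [zero_pow hn.ne', mul_zero] at this
  have hlim2 : Tendsto (fun T : ℕ => 1 / (η * (T : ℝ) ^ (n + 1))) atTop (nhds 0) := by
    refine tendsto_const_nhds.div_atTop ?_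
    exact ((tendsto_pow_atTop (by omega)).comp tendsto_natCast_atTop_atTop).const_mul_atTop hη
  filter_upwards [hlim1.eventually (gt_mem_nhds (show 0 < (2 * σ) ^ n / 4 by positivity)),
    hlim2.eventually (gt_mem_nhds (show 0 < s / 4 by positivity)), eventually_gt_atTop 0]
    with T hT1 hT2 hT0
  have hT' : (0 : ℝ) < T := by exact_mod_cast hT0
  have hT1' : (1 : ℝ) ≤ T := by exact_mod_cast hT0
  obtain ⟨δ, hδ⟩ : ∃ δ, δ = 1 / (η * (T : ℝ) ^ (n + 1)) := ⟨_, rfl⟩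
  have hδ0 : 0 < δ := by rw [hδ]; positivity
  rw [← hδ] at hT2 ⊢
  let bad : ℕ → Set (Fin n → ℝ) := fun q =>
    {x ∈ closedBall z σ | ∃ p : Fin n → ℤ, ‖(q : ℝ) • x - (fun i => (p i : ℝ))‖ < 1 / T}
  let F : Finset ℕ := Finset.Icc 1 ⌊η * (T : ℝ) ^ n⌋₊
  have hF : (F.card : ℝ) ≤ η * T ^ n := by
    simp only [F, Nat.card_Icc, Nat.add_sub_cancel]
    exact Nat.floor_le (by positivity)
  have hbad : volume (⋃ q ∈ F, bad q) ≤ ENNReal.ofReal ((2 * σ) ^ n / 2) := by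
    calc volume (⋃ q ∈ F, bad q) ≤ ∑ q ∈ F, volume (bad q) := measure_biUnion_finset_le _ _
      _ ≤ ∑ q ∈ F, ENNReal.ofReal ((10 * σ / T) ^ n +
            if q ∈ Finset.range ⌈1 / σ⌉₊ then (10 / (T : ℝ)) ^ n else 0) := by
          refine Finset.sum_le_sum fun q hq => ?_
          have hq1 : 1 ≤ q := (Finset.mem_Icc.1 hq).1
          have hq' : (1 : ℝ) ≤ q := by exact_mod_cast hq1
          refine (volume_near_rational_le z hσ0 (by positivity)
            (by rw [div_le_one hT']; exact hT1') hq1).trans (ENNReal.ofReal_le_ofReal ?_)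
          split_ifs with h
          · rw [Finset.mem_range, Nat.lt_ceil, lt_div_iff₀ hσ0] at h
            refine le_add_of_nonneg_of_le (by positivity) ?_
            gcongr
            rw [div_div, ← mul_div_assoc, ← mul_div_assoc,
              div_le_div_iff₀ (by positivity) (by positivity)]
            nlinarith [mul_le_mul_of_nonneg_left hq' hT'.le, mul_pos hT' hT',
              mul_lt_mul_of_pos_right h hT']
          · rw [Finset.mem_range, Nat.lt_ceil, not_lt, div_le_iff₀ hσ0] at h
            rw [add_zero]
            gcongr
            rw [div_div, ← mul_div_assoc, ← mul_div_assoc,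
              div_le_div_iff₀ (by positivity) (by positivity)]
            nlinarith [mul_le_mul_of_nonneg_right h hT'.le]
      _ = ENNReal.ofReal (F.card * (10 * σ / T) ^ n + ∑ q ∈ F,
            if q ∈ Finset.range ⌈1 / σ⌉₊ then (10 / (T : ℝ)) ^ n else 0) := by
          rw [← ENNReal.ofReal_sum_of_nonneg fun q _ => by positivity, Finset.sum_add_distrib,
            Finset.sum_const, nsmul_eq_mul]
      _ ≤ ENNReal.ofReal ((2 * σ) ^ n / 2) := by
          refine ENNReal.ofReal_le_ofReal ?_
          have h1 : F.card * (10 * σ / T) ^ n ≤ (2 * σ) ^ n / 4 := by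
            calc F.card * (10 * σ / T) ^ n ≤ (η * T ^ n) * (10 * σ / T) ^ n := by gcongr
              _ = (η * (4 * 5 ^ n)) * ((2 * σ) ^ n / 4) := by
                rw [div_pow, show 10 * σ = 5 * (2 * σ) by ring, mul_pow 5]
                field_simp
              _ ≤ 1 * ((2 * σ) ^ n / 4) := by gcongr
              _ = _ := one_mul _
          have h2 : (∑ q ∈ F, if q ∈ Finset.range ⌈1 / σ⌉₊ then (10 / (T : ℝ)) ^ n else 0) ≤
              ⌈1 / σ⌉₊ * (10 / (T : ℝ)) ^ n := by
            rw [← Finset.sum_filter, Finset.sum_const, nsmul_eq_mul]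
            gcongr
            refine (Finset.card_le_card (t := Finset.range ⌈1 / σ⌉₊) ?_).trans
              (Finset.card_range _).le
            intro q hq
            exact (Finset.mem_filter.1 hq).2
          linarith
  have hA : ENNReal.ofReal ((2 * σ) ^ n / 2) ≤ volume (closedBall z σ \ ⋃ q ∈ F, bad q) := by
    refine le_trans ?_ le_measure_sdiff
    rw [Real.volume_pi_closedBall _ hσ0.le, Fintype.card_fin]
    refine le_trans ?_ (tsub_le_tsub_left hbad _)
    rw [← ENNReal.ofReal_sub _ (by positivity)]
    exact ENNReal.ofReal_le_ofReal (by linarith)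
  obtain ⟨u, hut, hdisj, hu⟩ := exists_finset_disjoint_closedBall hA
    {pq : (Fin n → ℤ) × ℕ | η * (T : ℝ) ^ n < pq.2 ∧ pq.2 ≤ T ^ n ∧
        closedBall (fun i => (pq.1 i : ℝ) / pq.2) δ ⊆ closedBall z s}
    (fun pq i => (pq.1 i : ℝ) / pq.2) (fun _ => δ) δ (fun _ _ => hδ0.le) (fun _ _ => le_rfl) (by
      refine Eventually.of_forall ?_
      rintro a ⟨haz, ha⟩
      obtain ⟨q, hq0, hqT, p, hp⟩ := exists_int_norm_smul_sub_lt a hT0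
      have hq' : (0 : ℝ) < q := by exact_mod_cast hq0
      have hηq : η * (T : ℝ) ^ n < q := by
        by_contra! h
        refine ha (mem_iUnion₂.2 ⟨q, ?_, haz, p, hp⟩)
        exact Finset.mem_Icc.2 ⟨hq0, Nat.le_floor h⟩
      have hap : a ∈ closedBall (fun i => (p i : ℝ) / q) δ := by
        rw [mem_closedBall, dist_pi_le_iff hδ0.le]
        intro i
        rw [pi_norm_lt_iff (by positivity)] at hp
        have h2 := hp i
        simp only [Pi.sub_apply, Pi.smul_apply, smul_eq_mul, Real.norm_eq_abs] at h2
        have h3 : a i - p i / q = (q * a i - p i) / q := by field_simp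
        rw [Real.dist_eq, h3, abs_div, abs_of_pos hq', hδ]
        calc |q * a i - p i| / q ≤ (1 / T) / (η * T ^ n) := by gcongr
          _ = _ := by rw [pow_succ]; field_simp
      refine ⟨(p, q), ⟨hηq, hqT, ?_⟩, hap⟩
      refine closedBall_subset_closedBall' ?_
      rw [mem_closedBall, dist_comm] at hap
      rw [mem_closedBall] at haz
      have := dist_triangle (fun i => (p i : ℝ) / q) a z
      simp only at this ⊢
      linarith)
  refine ⟨u, fun pq h => hut h, hdisj, ?_⟩
  rw [Finset.sum_const, nsmul_eq_mul, show 2 * σ = s by rw [hσ]; ring, mul_pow] at hu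
  rw [div_le_iff₀ (by positivity)]
  nlinarith

/-- A weighted form of Cauchy condensation along the powers of `R`. -/
lemma summable_of_summable_pow {n R : ℕ} (hn : 0 < n) (hR : 2 ≤ R) {ρ : ℕ → ℝ}
    (hρ0 : ∀ q, 0 < ρ q) (hρ : ∀ a b, 0 < a → a ≤ b → ρ b ≤ ρ a)
    (h : Summable fun k : ℕ => ((R : ℝ) ^ k) ^ (n + 1) * ρ (R ^ k) ^ n) :
    Summable fun q : ℕ => (q : ℝ) ^ n * ρ q ^ n := by
  have hR0 : (0 : ℝ) < R := by exact_mod_cast (show 0 < R by omega)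
  have hnn : ∀ q : ℕ, 0 ≤ (q : ℝ) ^ n * ρ q ^ n := fun q => by have := hρ0 q; positivity
  have key : ∀ K : ℕ, ∑ q ∈ Finset.range (R ^ K), (q : ℝ) ^ n * ρ q ^ n ≤
      ∑ k ∈ Finset.range K, (R : ℝ) ^ (n + 1) * (((R : ℝ) ^ k) ^ (n + 1) * ρ (R ^ k) ^ n) := by
    intro K
    induction K with
    | zero => simp [hn.ne']
    | succ K ih =>
      rw [Finset.sum_range_succ, ← Finset.sum_range_add_sum_Ico _
        (Nat.pow_le_pow_right (by omega) K.le_succ)]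
      refine add_le_add ih ?_
      calc ∑ q ∈ Finset.Ico (R ^ K) (R ^ (K + 1)), (q : ℝ) ^ n * ρ q ^ n
          ≤ ∑ q ∈ Finset.Ico (R ^ K) (R ^ (K + 1)), ((R : ℝ) ^ (K + 1)) ^ n * ρ (R ^ K) ^ n := by
            refine Finset.sum_le_sum fun q hq => ?_
            rw [Finset.mem_Ico] at hq
            have := hρ _ _ (by positivity) hq.1
            have h1 : (q : ℝ) ≤ (R : ℝ) ^ (K + 1) := by exact_mod_cast hq.2.le
            have := hρ0 q
            have := hρ0 (R ^ K)
            gcongr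
        _ ≤ (R : ℝ) ^ (K + 1) * (((R : ℝ) ^ (K + 1)) ^ n * ρ (R ^ K) ^ n) := by
            rw [Finset.sum_const, nsmul_eq_mul]
            have := hρ0 (R ^ K)
            gcongr
            rw [Nat.card_Ico]
            exact_mod_cast Nat.sub_le _ _
        _ = _ := by rw [pow_succ (R : ℝ) K, mul_pow]; ring
  refine summable_of_sum_range_le (c := ∑' k : ℕ,
    (R : ℝ) ^ (n + 1) * (((R : ℝ) ^ k) ^ (n + 1) * ρ (R ^ k) ^ n)) hnn fun N => ?_
  calc _ ≤ ∑ q ∈ Finset.range (R ^ N), (q : ℝ) ^ n * ρ q ^ n :=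
        Finset.sum_le_sum_of_subset_of_nonneg
          (Finset.range_mono (Nat.lt_pow_self (by omega)).le) fun q _ _ => hnn q
    _ ≤ _ := key N
    _ ≤ _ :=
        (h.mul_left _).sum_le_tsum _ fun k _ => by have := hρ0 (R ^ k); positivity

lemma summable_of_summable_min {n L : ℕ} (hn : 0 < n) (hL : 2 ≤ L) {ρ : ℕ → ℝ} {η : ℝ}
    (hη : 0 < η) (hρ0 : ∀ q, 0 < ρ q) (hρ : ∀ a b, 0 < a → a ≤ b → ρ b ≤ ρ a)
    (h : Summable fun k : ℕ => (min (ρ ((L ^ k) ^ n)) (1 / (η * ((L : ℝ) ^ k) ^ (n + 1))) /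
      (1 / (η * ((L : ℝ) ^ k) ^ (n + 1)))) ^ n) :
    Summable fun q : ℕ => (q : ℝ) ^ n * ρ q ^ n := by
  have hL0 : (0 : ℝ) < L := by exact_mod_cast (show 0 < L by omega)
  refine summable_of_summable_pow (R := L ^ n) hn
    (hL.trans (Nat.le_self_pow hn.ne' L)) hρ0 hρ ?_
  have h2 := h.mul_left (1 / η ^ n)
  refine (summable_congr_atTop ?_).1 h2
  filter_upwards [h.tendsto_atTop_zero.eventually (gt_mem_nhds one_pos)] with k hk
  have hδ : 0 < 1 / (η * ((L : ℝ) ^ k) ^ (n + 1)) := by positivity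
  have hlt : ρ ((L ^ k) ^ n) < 1 / (η * ((L : ℝ) ^ k) ^ (n + 1)) := by
    by_contra! hle
    rw [min_eq_right hle, div_self hδ.ne', one_pow] at hk
    exact lt_irrefl _ hk
  have h3 : (L ^ n) ^ k = (L ^ k) ^ n := pow_right_comm L n k
  have h4 : ((L ^ n : ℕ) : ℝ) ^ k = ((L : ℝ) ^ k) ^ n := by exact_mod_cast h3
  have hX : (0 : ℝ) < (L : ℝ) ^ k := by positivity
  rw [min_eq_left hlt.le, h3, h4, div_div_eq_mul_div, div_one]
  generalize (L : ℝ) ^ k = X at hX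
  generalize ρ ((L ^ k) ^ n) = v
  rw [mul_pow, mul_pow, ← pow_mul, ← pow_mul, mul_comm n (n + 1)]
  field_simp

/-- Khintchine's theorem, local form: in every ball, the rational points with denominators beyond
`N` fill a proportion bounded below, as soon as `∑ q ^ n * ρ q ^ n` diverges. -/
lemma exists_le_volume_near_rationals {n : ℕ} (hn : 0 < n) {ρ : ℕ → ℝ} (hρ0 : ∀ q, 0 < ρ q)
    (hρ : ∀ a b, 0 < a → a ≤ b → ρ b ≤ ρ a)
    (hdiv : ¬ Summable fun q : ℕ => (q : ℝ) ^ n * ρ q ^ n) :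
    ∃ c : ℝ, 0 < c ∧ ∀ (z : Fin n → ℝ) (s : ℝ), 0 < s → ∀ N : ℕ,
      ENNReal.ofReal (c * (2 * s) ^ n) ≤ volume (closedBall z s ∩ {x | ∃ q : ℕ, N ≤ q ∧ 0 < q ∧
        ∃ p : Fin n → ℤ, (fun i => (p i : ℝ) / q) ∈ closedBall z s ∧
          x ∈ closedBall (fun i => (p i : ℝ) / q) (ρ q)}) := by
  obtain ⟨η, hη⟩ : ∃ η : ℝ, η = 1 / (4 * 5 ^ n) := ⟨_, rfl⟩
  have hη0 : 0 < η := by rw [hη]; positivity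
  have hη1 : η * (4 * 5 ^ n) ≤ 1 := by rw [hη, one_div, inv_mul_cancel₀ (by positivity)]
  obtain ⟨c₁, hc₁⟩ : ∃ c₁ : ℝ, c₁ = 1 / (4 * 10 ^ n) := ⟨_, rfl⟩
  have hc₁0 : 0 < c₁ := by rw [hc₁]; positivity
  have hc₁1 : c₁ ≤ 1 := by
    rw [hc₁, div_le_one (by positivity)]
    have : (1 : ℝ) ≤ 10 ^ n := one_le_pow₀ (by norm_num)
    linarith
  obtain ⟨θ, hθ⟩ : ∃ θ : ℝ, θ = c₁ / (4 * 4 ^ n) := ⟨_, rfl⟩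
  have hθ0 : 0 < θ := by rw [hθ]; positivity
  have hθ1 : θ ≤ 1 := by
    rw [hθ, div_le_one (by positivity)]
    have : (1 : ℝ) ≤ 4 ^ n := one_le_pow₀ (by norm_num)
    linarith
  obtain ⟨c, hc⟩ : ∃ c : ℝ, c = c₁ / (4 * 2 ^ n) := ⟨_, rfl⟩
  have hc0 : 0 < c := by rw [hc]; positivity
  obtain ⟨L, hL⟩ := exists_nat_ge (max 2 (2 / θ))
  have hL2 : 2 ≤ L := by exact_mod_cast (le_max_left _ _).trans hL
  have hLθ : 2 / θ ≤ L := (le_max_right _ _).trans hL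
  have hL0 : (0 : ℝ) < L := by exact_mod_cast (show 0 < L by omega)
  refine ⟨c, hc0, fun z s hs N => ?_⟩
  by_contra! hlt
  set S := closedBall z s ∩ {x | ∃ q : ℕ, N ≤ q ∧ 0 < q ∧
        ∃ p : Fin n → ℤ, (fun i => (p i : ℝ) / q) ∈ closedBall z s ∧
          x ∈ closedBall (fun i => (p i : ℝ) / q) (ρ q)} with hS
  let δ : ℕ → ℝ := fun k => 1 / (η * ((L : ℝ) ^ k) ^ (n + 1))
  let r : ℕ → ℝ := fun k => min (ρ ((L ^ k) ^ n)) (δ k)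
  have hδ0 : ∀ k, 0 < δ k := fun k => by positivity
  have hr0 : ∀ k, 0 < r k := fun k => lt_min (hρ0 _) (hδ0 k)
  have hrδ : ∀ k, r k ≤ δ k := fun k => min_le_right _ _
  have hδL : ∀ k, δ (k + 1) ^ n ≤ θ / 2 * δ k ^ n := by
    intro k
    have h1 : δ (k + 1) = δ k * (1 / (L : ℝ) ^ (n + 1)) := by
      simp only [δ]
      rw [pow_succ (L : ℝ) k, mul_pow]
      field_simp
    rw [h1, mul_pow, mul_comm]
    refine mul_le_mul_of_nonneg_right ?_ (by have := hδ0 k; positivity)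
    rw [div_pow, one_pow, ← pow_mul]
    have h2 : (L : ℝ) ≤ (L : ℝ) ^ ((n + 1) * n) :=
      le_self_pow₀ (by exact_mod_cast (show 1 ≤ L by omega)) (by positivity)
    calc 1 / (L : ℝ) ^ ((n + 1) * n) ≤ 1 / L := by gcongr
      _ ≤ 1 / (2 / θ) := by gcongr
      _ = θ / 2 := by rw [one_div_div]
  have hLtop : Tendsto (fun k : ℕ => L ^ k) atTop atTop := tendsto_pow_atTop_atTop_of_one_lt hL2
  have hηtop : Tendsto (fun k : ℕ => η * ((L ^ k : ℕ) : ℝ) ^ n) atTop atTop :=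
    ((tendsto_pow_atTop hn.ne').comp
      (tendsto_natCast_atTop_atTop.comp hLtop)).const_mul_atTop hη0
  obtain ⟨k₀, hk₀⟩ := eventually_atTop.1
    ((hLtop.eventually (eventually_exists_separated_rationals hn z hs hη0 hη1)).and
      (hηtop.eventually_ge_atTop (N : ℝ)))
  have claim : ∀ m : ℕ, ∃ B : Finset ((Fin n → ℝ) × ℝ),
      (∀ b ∈ B, 0 ≤ b.2 ∧ closedBall b.1 b.2 ⊆ S) ∧
      ((B : Set ((Fin n → ℝ) × ℝ)).PairwiseDisjoint fun b => closedBall b.1 b.2) ∧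
      B.card * δ (k₀ + m) ^ n ≤ θ * s ^ n ∧
      c₁ / 2 * s ^ n * ∑ j ∈ Finset.range m, (r (k₀ + j) / δ (k₀ + j)) ^ n ≤
        ∑ b ∈ B, b.2 ^ n := by
    intro m
    induction m with
    | zero => exact ⟨∅, by simp, by simp, by simp; positivity, by simp⟩
    | succ m ih =>
      obtain ⟨B, hB, hBd, hBc, hBs⟩ := ih
      obtain ⟨⟨u, hu, hud, huc⟩, hN⟩ := hk₀ (k₀ + m) (by omega)
      set k := k₀ + m with hk
      push_cast at hu hud huc hN
      let x : (Fin n → ℤ) × ℕ → Fin n → ℝ := fun pq i => (pq.1 i : ℝ) / pq.2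
      change (∀ pq ∈ u, η * ((L : ℝ) ^ k) ^ n < pq.2 ∧ pq.2 ≤ (L ^ k) ^ n ∧
        closedBall (x pq) (δ k) ⊆ closedBall z s) at hu
      change (u : Set ((Fin n → ℤ) × ℕ)).PairwiseDisjoint (fun pq => closedBall (x pq) (δ k)) at hud
      change s ^ n / (4 * 10 ^ n) ≤ u.card * δ k ^ n at huc
      have huc' : c₁ * s ^ n ≤ u.card * δ k ^ n := by
        refine le_trans (le_of_eq ?_) huc
        rw [hc₁]; ring
      have hδn : 0 < δ k ^ n := by have := hδ0 k; positivity
      have hucard : u.card * δ k ^ n ≤ s ^ n := by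
        have := sum_pow_le_of_subset_closedBall hs.le (fun _ _ => (hδ0 k).le) hud
          (fun i hi => (hu i hi).2.2)
        rwa [Finset.sum_const, nsmul_eq_mul] at this
      have hBvol : ∑ b ∈ B, b.2 ^ n ≤ c * s ^ n := by
        have h1 := (ofReal_sum_pow_le_volume (fun b hb => (hB b hb).1) hBd
          (fun b hb => (hB b hb).2)).trans hlt.le
        rw [ENNReal.ofReal_le_ofReal_iff (by positivity)] at h1
        simp only [mul_pow, ← Finset.mul_sum] at h1
        refine le_of_mul_le_mul_left ?_ (show (0 : ℝ) < 2 ^ n by positivity)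
        linarith
      classical
      let hits : (Fin n → ℝ) × ℝ → Finset ((Fin n → ℤ) × ℕ) := fun b =>
        u.filter fun pq => ¬ Disjoint (closedBall (x pq) (r k)) (closedBall b.1 b.2)
      have hhits : ∀ b ∈ B, (hits b).card * δ k ^ n ≤ 2 ^ n * b.2 ^ n + 4 ^ n * δ k ^ n := by
        intro b hb
        have hb0 := (hB b hb).1
        have hδk := hδ0 k
        have h1 := sum_pow_le_of_subset_closedBall (u := hits b) (z := b.1) (R := b.2 + 2 * δ k)
          (x := x) (r := fun _ => δ k) (by positivity) (fun _ _ => (hδ0 k).le)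
          (hud.subset fun i hi => (Finset.mem_filter.1 hi).1) (by
            intro i hi
            obtain ⟨y, hy1, hy2⟩ := Set.not_disjoint_iff.1 (Finset.mem_filter.1 hi).2
            refine closedBall_subset_closedBall' ?_
            rw [mem_closedBall] at hy1 hy2
            have := dist_triangle_left (x i) b.1 y
            have := hrδ k
            linarith)
        rw [Finset.sum_const, nsmul_eq_mul] at h1
        refine h1.trans ((add_pow_le hb0 (by positivity) n).trans ?_)
        have h2 : (2 : ℝ) ^ (n - 1) ≤ 2 ^ n := pow_le_pow_right₀ (by norm_num) (by omega)
        calc _ ≤ 2 ^ n * (b.2 ^ n + (2 * δ k) ^ n) := by gcongr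
          _ = _ := by rw [mul_pow, show (4 : ℝ) = 2 * 2 by norm_num, mul_pow]; ring
      let new := u.filter fun pq => ∀ b ∈ B, Disjoint (closedBall (x pq) (r k)) (closedBall b.1 b.2)
      have hsub : u ⊆ new ∪ B.biUnion hits := by
        intro i hi
        by_cases h : ∀ b ∈ B, Disjoint (closedBall (x i) (r k)) (closedBall b.1 b.2)
        · exact Finset.mem_union_left _ (Finset.mem_filter.2 ⟨hi, h⟩)
        · push Not at h
          obtain ⟨b, hb, hbi⟩ := h
          exact Finset.mem_union_right _
            (Finset.mem_biUnion.2 ⟨b, hb, Finset.mem_filter.2 ⟨hi, hbi⟩⟩)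
      have hcard : (u.card : ℝ) ≤ new.card + ∑ b ∈ B, ((hits b).card : ℝ) := by
        exact_mod_cast (Finset.card_le_card hsub).trans ((Finset.card_union_le _ _).trans
          (Nat.add_le_add_left Finset.card_biUnion_le _))
      have hnew : c₁ / 2 * s ^ n ≤ new.card * δ k ^ n := by
        have h1 := mul_le_mul_of_nonneg_right hcard hδn.le
        rw [add_mul, Finset.sum_mul] at h1
        have h2 := Finset.sum_le_sum hhits
        rw [Finset.sum_add_distrib, Finset.sum_const, nsmul_eq_mul, ← Finset.mul_sum] at h2
        have h3 : (2 : ℝ) ^ n * ∑ b ∈ B, b.2 ^ n ≤ c₁ / 4 * s ^ n := by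
          calc _ ≤ (2 : ℝ) ^ n * (c * s ^ n) := by gcongr
            _ = _ := by rw [hc]; field_simp
        have h4 : (B.card : ℝ) * (4 ^ n * δ k ^ n) ≤ c₁ / 4 * s ^ n := by
          calc _ = (4 : ℝ) ^ n * (B.card * δ k ^ n) := by ring
            _ ≤ (4 : ℝ) ^ n * (θ * s ^ n) := by gcongr
            _ = _ := by rw [hθ]; field_simp
        linarith
      have hnewu : ∀ i ∈ new, i ∈ u := fun i hi => (Finset.mem_filter.1 hi).1
      have hinj : Set.InjOn (fun i => (x i, r k)) (new : Set ((Fin n → ℤ) × ℕ)) := by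
        intro i hi j hj hij
        refine hud.elim (hnewu i hi) (hnewu j hj) (Set.not_disjoint_iff.2 ⟨x i, ?_, ?_⟩)
        · exact mem_closedBall_self (hδ0 k).le
        · rw [(Prod.mk.inj hij).1]; exact mem_closedBall_self (hδ0 k).le
      have hdisjBn : Disjoint B (new.image fun i => (x i, r k)) := by
        rw [Finset.disjoint_left]
        intro b hb hb'
        obtain ⟨i, hi, rfl⟩ := Finset.mem_image.1 hb'
        exact Set.disjoint_left.1 ((Finset.mem_filter.1 hi).2 _ hb)
          (mem_closedBall_self (hr0 k).le) (mem_closedBall_self (hr0 k).le)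
      refine ⟨B ∪ new.image fun i => (x i, r k), ?_, ?_, ?_, ?_⟩
      · intro b hb
        rcases Finset.mem_union.1 hb with hb | hb
        · exact hB b hb
        obtain ⟨⟨p, q⟩, hi, rfl⟩ := Finset.mem_image.1 hb
        refine ⟨(hr0 k).le, fun y hy => ?_⟩
        obtain ⟨h1, h2, h3⟩ := hu _ (hnewu _ hi)
        have hq0 : 0 < q := by
          have : (0 : ℝ) < q := lt_of_le_of_lt (by positivity) h1
          exact_mod_cast this
        refine ⟨h3 (closedBall_subset_closedBall (hrδ k) hy), q, ?_, hq0, p,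
          h3 (mem_closedBall_self (hδ0 k).le), ?_⟩
        · exact_mod_cast (hN.trans_lt h1).le
        · exact closedBall_subset_closedBall ((min_le_left _ _).trans (hρ _ _ hq0 h2)) hy
      · rw [Finset.coe_union, Set.pairwiseDisjoint_union]
        refine ⟨hBd, ?_, ?_⟩
        · rintro b hb b' hb' hbb'
          simp only [Finset.coe_image, Set.mem_image, Finset.mem_coe] at hb hb'
          obtain ⟨i, hi, rfl⟩ := hb
          obtain ⟨j, hj, rfl⟩ := hb'
          refine (hud (hnewu i hi) (hnewu j hj) fun h => hbb' (by rw [h])).mono ?_ ?_ <;>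
            exact closedBall_subset_closedBall (hrδ k)
        · intro b hb b' hb' _
          simp only [Finset.coe_image, Set.mem_image, Finset.mem_coe] at hb hb'
          obtain ⟨i, hi, rfl⟩ := hb'
          exact ((Finset.mem_filter.1 hi).2 b hb).symm
      · rw [← add_assoc, ← hk, Finset.card_union_of_disjoint hdisjBn, Finset.card_image_of_injOn hinj]
        have h1 : (new.card : ℝ) * δ k ^ n ≤ s ^ n := by
          refine le_trans ?_ hucard
          gcongr
          exact Finset.filter_subset _ _
        push_cast
        calc ((B.card : ℝ) + new.card) * δ (k + 1) ^ n
            ≤ ((B.card : ℝ) + new.card) * (θ / 2 * δ k ^ n) := by gcongr; exact hδL k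
          _ = θ / 2 * (B.card * δ k ^ n + new.card * δ k ^ n) := by ring
          _ ≤ θ / 2 * (θ * s ^ n + s ^ n) := by gcongr
          _ ≤ θ / 2 * (1 * s ^ n + s ^ n) := by gcongr
          _ = _ := by ring
      · rw [Finset.sum_union hdisjBn, Finset.sum_image hinj]
        simp only [Finset.sum_const, nsmul_eq_mul]
        rw [Finset.sum_range_succ, mul_add]
        refine add_le_add hBs ?_
        have hrn : 0 ≤ r k ^ n := by have := hr0 k; positivity
        rw [← hk, div_pow, ← mul_div_assoc, div_le_iff₀ hδn]
        calc _ ≤ new.card * δ k ^ n * r k ^ n := by gcongr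
          _ = _ := by ring
  refine hdiv (summable_of_summable_min hn hL2 hη0 hρ0 hρ ?_)
  change Summable fun k => (r k / δ k) ^ n
  rw [← summable_nat_add_iff k₀]
  refine summable_of_sum_range_le (c := c / (c₁ / 2)) (fun k => ?_) fun m => ?_
  · have := hr0 (k + k₀); have := hδ0 (k + k₀); positivity
  obtain ⟨B, hB, hBd, -, hBs⟩ := claim m
  have h1 := (ofReal_sum_pow_le_volume (fun b hb => (hB b hb).1) hBd
    (fun b hb => (hB b hb).2)).trans hlt.le
  rw [ENNReal.ofReal_le_ofReal_iff (by positivity)] at h1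
  simp only [mul_pow, ← Finset.mul_sum] at h1
  have h2 : ∑ b ∈ B, b.2 ^ n ≤ c * s ^ n := by
    refine le_of_mul_le_mul_left ?_ (show (0 : ℝ) < 2 ^ n by positivity)
    linarith
  rw [le_div_iff₀ (by positivity)]
  refine le_of_mul_le_mul_right ?_ (show 0 < s ^ n by positivity)
  simp only [add_comm _ k₀]
  linarith

/-- Khintchine's theorem (divergence half). -/
lemma ae_exists_rational_near {n : ℕ} (hn : 0 < n) {ρ : ℕ → ℝ} (hρ0 : ∀ q, 0 < ρ q)
    (hρ : ∀ a b, 0 < a → a ≤ b → ρ b ≤ ρ a)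
    (hdiv : ¬ Summable fun q : ℕ => (q : ℝ) ^ n * ρ q ^ n) :
    ∀ᵐ x ∂(volume : Measure (Fin n → ℝ)), x ∈ Set.univ.pi (fun _ => Ioo (0 : ℝ) 1) →
      ∀ N : ℕ, ∃ q : ℕ, N ≤ q ∧ 0 < q ∧ ∃ p : Fin n → ℤ, 1 ≤ ‖p‖ ∧ ‖p‖ ≤ q ∧
        x ∈ closedBall (fun i => (p i : ℝ) / q) (ρ q) := by
  obtain ⟨c, hc0, hc⟩ := exists_le_volume_near_rationals hn hρ0 hρ hdiv
  set U : Set (Fin n → ℝ) := Set.univ.pi (fun _ => Ioo (0 : ℝ) 1) with hU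
  have hUo : IsOpen U := isOpen_set_pi Set.finite_univ fun _ _ => isOpen_Ioo
  simp only [forall_comm (α := _ ∈ U)]
  rw [ae_all_iff]
  intro N
  set G : Set (Fin n → ℝ) := {x | ∃ q : ℕ, N ≤ q ∧ 0 < q ∧ ∃ p : Fin n → ℤ, 1 ≤ ‖p‖ ∧ ‖p‖ ≤ q ∧
        x ∈ closedBall (fun i => (p i : ℝ) / q) (ρ q)} with hG
  have hGm : MeasurableSet G := by
    have : G = ⋃ q : ℕ, ⋃ _ : N ≤ q ∧ 0 < q, ⋃ p : Fin n → ℤ, ⋃ _ : 1 ≤ ‖p‖ ∧ ‖p‖ ≤ q,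
        closedBall (fun i => (p i : ℝ) / q) (ρ q) := by
      ext x; simp only [hG, Set.mem_iUnion, Set.mem_ofPred_eq, exists_prop, and_assoc]
    rw [this]
    exact MeasurableSet.iUnion fun q => MeasurableSet.iUnion fun _ => MeasurableSet.iUnion fun p =>
      MeasurableSet.iUnion fun _ => isClosed_closedBall.measurableSet
  have hAm : MeasurableSet (U \ G) := hUo.measurableSet.diff hGm
  by_contra hcon
  have hpos : volume (U \ G) ≠ 0 := by
    intro h
    refine hcon ?_
    filter_upwards [measure_eq_zero_iff_ae_notMem.1 h] with x hx hxU
    by_contra hxG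
    exact hx ⟨hxU, hxG⟩
  have : NeBot (ae ((volume : Measure (Fin n → ℝ)).restrict (U \ G))) :=
    ae_neBot.2 (by rwa [Ne, Measure.restrict_eq_zero])
  obtain ⟨x, hx, hxA⟩ := ((Besicovitch.ae_tendsto_measure_inter_div
    (volume : Measure (Fin n → ℝ)) (U \ G)).and (ae_restrict_mem hAm)).exists
  obtain ⟨ε, hε, hεU⟩ := Metric.isOpen_iff.1 hUo x hxA.1
  have h1 : ENNReal.ofReal (1 - c / 2) < 1 := by
    rw [← ENNReal.ofReal_one, ENNReal.ofReal_lt_ofReal_iff one_pos]; linarith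
  obtain ⟨r, hr, hr0, hrε⟩ := ((hx.eventually (lt_mem_nhds h1)).and
    (Ioo_mem_nhdsGT hε)).exists
  have hrU : closedBall x r ⊆ U := (closedBall_subset_ball hrε).trans hεU
  have hvol : volume (closedBall x r) = ENNReal.ofReal ((2 * r) ^ n) := by
    rw [Real.volume_pi_closedBall _ hr0.le, Fintype.card_fin]
  have hr2 : 0 < (2 * r) ^ n := by positivity
  have h2 : ENNReal.ofReal ((1 - c / 2) * (2 * r) ^ n) ≤
      volume ((U \ G) ∩ closedBall x r) := by
    rw [ENNReal.lt_div_iff_mul_lt (by left; rw [hvol]; simpa using hr2)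
      (by left; rw [hvol]; exact ENNReal.ofReal_ne_top), hvol] at hr
    rw [ENNReal.ofReal_mul' hr2.le]
    exact hr.le
  have h3 : ENNReal.ofReal (c * (2 * r) ^ n) ≤ volume (closedBall x r ∩ G) := by
    refine (hc x r hr0 N).trans (measure_mono ?_)
    rintro w ⟨hw, q, hNq, hq, p, hp, hwp⟩
    refine ⟨hw, q, hNq, hq, p, ?_, ?_, hwp⟩
    · have h4 := (hrU hp) ⟨0, hn⟩ trivial
      have hq' : (0 : ℝ) < q := by exact_mod_cast hq
      have h5 : 0 < p ⟨0, hn⟩ := by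
        have := (div_pos_iff_of_pos_right hq').1 h4.1
        exact_mod_cast this
      refine le_trans ?_ (norm_le_pi_norm p ⟨0, hn⟩)
      rw [Int.norm_eq_abs]
      have : (1 : ℝ) ≤ p ⟨0, hn⟩ := by exact_mod_cast h5
      exact this.trans (le_abs_self _)
    · have hq' : (0 : ℝ) < q := by exact_mod_cast hq
      rw [pi_norm_le_iff_of_nonneg hq'.le]
      intro i
      have h4 := (hrU hp) i trivial
      have h5 := (div_pos_iff_of_pos_right hq').1 h4.1
      have h6 := (div_lt_one hq').1 h4.2
      rw [Int.norm_eq_abs, abs_of_pos h5]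
      exact h6.le
  have h4 : volume ((U \ G) ∩ closedBall x r) + volume (closedBall x r ∩ G) ≤
      volume (closedBall x r) := by
    rw [← measure_inter_add_sdiff (closedBall x r) hGm, add_comm]
    gcongr
    exact fun w hw => ⟨hw.2, hw.1.2⟩
  have h5 : ENNReal.ofReal ((1 - c / 2) * (2 * r) ^ n + c * (2 * r) ^ n) ≤
      ENNReal.ofReal ((2 * r) ^ n) :=
    ENNReal.ofReal_add_le.trans ((add_le_add h2 h3).trans (h4.trans hvol.le))
  rw [ENNReal.ofReal_le_ofReal_iff hr2.le] at h5
  nlinarith [mul_pos hc0 hr2]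

/-- Khintchine's theorem for perturbed rational points. -/
lemma ae_exists_perturbed_near {n : ℕ} (hn : 0 < n) {ρ : ℕ → ℝ} (hρ0 : ∀ q, 0 < ρ q)
    (hρ : ∀ a b, 0 < a → a ≤ b → ρ b ≤ ρ a) (hρlim : Tendsto ρ atTop (nhds 0))
    (hdiv : ¬ Summable fun q : ℕ => (q : ℝ) ^ n * ρ q ^ n)
    {y : (Fin n → ℤ) → ℕ → Fin n → ℝ} {C : ℝ}
    (hy : ∀ᶠ q : ℕ in atTop, ∀ p : Fin n → ℤ, 1 ≤ ‖p‖ → ‖p‖ ≤ q →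
      dist (fun i => (p i : ℝ) / q) (y p q) ≤ C * ρ q) :
    ∀ᵐ x ∂(volume : Measure (Fin n → ℝ)), x ∈ Set.univ.pi (fun _ => Ioo (0 : ℝ) 1) →
      ∀ N : ℕ, ∃ q : ℕ, N ≤ q ∧ ∃ p : Fin n → ℤ, x ∈ ball (y p q) (ρ q) := by
  let S : ℕ → Set (Fin n → ℝ) := fun q => {w | ∃ p : Fin n → ℤ, 1 ≤ ‖p‖ ∧ ‖p‖ ≤ q ∧ w = y p q}
  have hM : 0 < 2 * (|C| + 1) := by positivity
  have hae := blimsup_cthickening_mul_ae_eq (volume : Measure (Fin n → ℝ)) (fun _ => True) S hM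
    (fun q => ρ q / 2) (by simpa using hρlim.div_const 2)
  filter_upwards [ae_exists_rational_near hn hρ0 hρ hdiv, hae.mem_iff] with x hx hxiff hxU N
  simp only [blimsup_true, mem_limsup_iff_frequently_mem] at hxiff
  have h1 : ∃ᶠ q in atTop, x ∈ cthickening (2 * (|C| + 1) * (ρ q / 2)) (S q) := by
    rw [frequently_atTop]
    intro M
    obtain ⟨M', hM'⟩ := eventually_atTop.1 hy
    obtain ⟨q, hq, hq0, p, hp1, hp2, hxp⟩ := hx hxU (max M M')
    refine ⟨q, (le_max_left _ _).trans hq, mem_cthickening_of_dist_le x (y p q) _ _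
      ⟨p, hp1, hp2, rfl⟩ ?_⟩
    have h2 := hM' q ((le_max_right _ _).trans hq) p hp1 hp2
    rw [mem_closedBall] at hxp
    have h3 := dist_triangle x (fun i => (p i : ℝ) / q) (y p q)
    have h4 := mul_le_mul_of_nonneg_right (le_abs_self C) (hρ0 q).le
    linarith
  obtain ⟨q, hq, hxq⟩ := frequently_atTop.1 (hxiff.1 h1) N
  have h5 := cthickening_subset_thickening' (hρ0 q) (half_lt_self (hρ0 q)) _ hxq
  obtain ⟨w, ⟨p, -, -, rfl⟩, hw⟩ := mem_thickening_iff.1 h5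
  exact ⟨q, hq, p, hw⟩

/-- Covers by small balls bound the Hausdorff measure from above. -/
lemma hausdorffWith_le_of_covers {n : ℕ} (hn : 0 < n) {f : ℝ → ℝ} (hmono : MonotoneOn f (Ioi 0))
    {A : Set (Fin n → ℝ)} {H : ENNReal}
    (h : ∀ δ : ℝ, 0 < δ → ∃ (ι : Type) (_ : Countable ι) (x : ι → Fin n → ℝ) (ρ : ι → ℝ),
      (∀ j, 0 < ρ j ∧ ρ j ≤ δ) ∧ A ⊆ ⋃ j, closedBall (x j) (ρ j) ∧
      ∑' j, ENNReal.ofReal (f (2 * ρ j)) ≤ H) :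
    hausdorffWith f A ≤ H := by
  have : Nonempty (Fin n) := ⟨⟨0, hn⟩⟩
  rw [hausdorffWith, ← OuterMeasure.coe_mkMetric, OuterMeasure.mkMetric,
    OuterMeasure.mkMetric'.eq_iSup_nat, OuterMeasure.iSup_apply]
  refine iSup_le fun k => ?_
  obtain ⟨ι, _, x, ρ, hρ, hA, hH⟩ := h (1 / (2 * (k + 1))) (by positivity)
  refine (measure_mono hA).trans ((measure_iUnion_le _).trans ((ENNReal.tsum_le_tsum ?_).trans hH))
  intro j
  obtain ⟨hρ0, hρδ⟩ := hρ j
  have hdiam : ediam (closedBall (x j) (ρ j)) ≤ ENNReal.ofReal (2 * ρ j) := by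
    rw [← closedEBall_ofReal hρ0.le]
    refine ediam_closedEBall_le.trans ?_
    rw [ENNReal.ofReal_mul two_pos.le]; simp
  have hle : (ediam (closedBall (x j) (ρ j))).toReal ≤ 2 * ρ j :=
    ENNReal.toReal_le_of_le_ofReal (by positivity) hdiam
  have hpos : 0 < (ediam (closedBall (x j) (ρ j))).toReal := by
    refine lt_of_lt_of_le hρ0 ?_
    have h1 : x j + (fun _ => ρ j) ∈ closedBall (x j) (ρ j) := by
      rw [mem_closedBall, dist_eq_norm, add_sub_cancel_left, pi_norm_const, Real.norm_eq_abs,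
        abs_of_pos hρ0]
    have h2 := dist_le_diam_of_mem isBounded_closedBall h1 (mem_closedBall_self hρ0.le)
    rw [dist_eq_norm, add_sub_cancel_left, pi_norm_const, Real.norm_eq_abs,
        abs_of_pos hρ0] at h2
    exact h2
  refine (OuterMeasure.mkMetric'.pre_le (hdiam.trans ?_)).trans ?_
  · rw [ENNReal.le_inv_iff_le_inv, ← ENNReal.ofReal_inv_of_pos (by positivity),
      ← ENNReal.ofReal_natCast]
    refine ENNReal.ofReal_le_ofReal ?_
    rw [inv_eq_one_div, le_div_iff₀' (by positivity)]
    rw [le_div_iff₀ (by positivity)] at hρδ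
    nlinarith
  · exact ENNReal.ofReal_le_ofReal (hmono hpos (mem_Ioi.2 (by positivity)) hle)

lemma hausdorffWith_le_mul_volume {n : ℕ} (hn : 0 < n) {f : ℝ → ℝ} (hmono : MonotoneOn f (Ioi 0))
    {K : ℝ} (hK : 0 < K) (hf : ∀ᶠ r in nhdsWithin 0 (Ioi 0), f r ≤ K * r ^ n)
    (A : Set (Fin n → ℝ)) :
    hausdorffWith f A ≤ ENNReal.ofReal K * volume A := by
  refine ENNReal.le_of_forall_pos_le_add fun ε hε _ => ?_
  have hK' : ENNReal.ofReal K ≠ 0 := by simpa using hK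
  refine hausdorffWith_le_of_covers hn hmono fun δ hδ => ?_
  obtain ⟨δ₀, hδ₀, hf⟩ := mem_nhdsGT_iff_exists_Ioo_subset.1 hf
  obtain ⟨t, r, ht, -, hr, hcov, hsum⟩ := Besicovitch.exists_closedBall_covering_tsum_measure_le
    (volume : Measure (Fin n → ℝ)) (ε := ε / ENNReal.ofReal K)
    (ENNReal.div_ne_zero.2 ⟨by simpa using hε.ne', ENNReal.ofReal_ne_top⟩)
    (fun _ => Ioo 0 (min δ (δ₀ / 2))) A (fun x _ η hη => by
      rw [Ioo_inter_Ioo, nonempty_Ioo]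
      simpa using ⟨⟨hδ, hδ₀⟩, hη⟩)
  have : Countable t := ht.to_subtype
  let e : t → ℕ := (exists_injective_nat t).choose
  have he : Function.Injective e := (exists_injective_nat t).choose_spec
  let E := Equiv.ofInjective e he
  refine ⟨Set.range e, inferInstance, fun j => E.symm j, fun j => r (E.symm j), fun j => ?_, ?_, ?_⟩
  · have := hr _ (E.symm j).2
    exact ⟨this.1, this.2.le.trans (min_le_left _ _)⟩
  · intro a ha
    obtain ⟨i, hi, hai⟩ := mem_iUnion₂.1 (hcov ha)
    refine mem_iUnion.2 ⟨E ⟨i, hi⟩, ?_⟩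
    simpa using hai
  · rw [E.symm.tsum_eq (fun i : t => ENNReal.ofReal (f (2 * r i)))]
    calc ∑' i : t, ENNReal.ofReal (f (2 * r i))
        ≤ ∑' i : t, ENNReal.ofReal K * volume (closedBall (i : Fin n → ℝ) (r i)) := by
          refine ENNReal.tsum_le_tsum fun i => ?_
          have := hr _ i.2
          rw [Real.volume_pi_closedBall _ this.1.le, Fintype.card_fin, ← ENNReal.ofReal_mul hK.le]
          refine ENNReal.ofReal_le_ofReal (hf ⟨mul_pos two_pos this.1, ?_⟩)
          have := this.2.trans_le (min_le_right _ _)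
          linarith
      _ ≤ ENNReal.ofReal K * (volume A + ε / ENNReal.ofReal K) := by
          rw [ENNReal.tsum_mul_left]; gcongr
      _ = _ := by rw [mul_add, ENNReal.mul_div_cancel hK' ENNReal.ofReal_ne_top]

/-- A set of finite Hausdorff measure has fine covers of bounded total cost. -/
lemma exists_covers_of_hausdorffWith_ne_top {n : ℕ} {f : ℝ → ℝ}
    (hf0 : Tendsto f (nhdsWithin 0 (Ioi 0)) (nhds 0))
    {A : Set (Fin n → ℝ)} (hA : hausdorffWith f A ≠ ⊤) :
    ∃ H : ENNReal, H ≠ ⊤ ∧ ∀ δ : ℝ, 0 < δ → ∃ (V : ℕ → Set (Fin n → ℝ)) (d : ℕ → ℝ),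
      (∀ l, 0 < d l ∧ d l ≤ δ) ∧ (∀ l, ∀ a ∈ V l, ∀ b ∈ V l, dist a b ≤ d l) ∧ A ⊆ ⋃ l, V l ∧
      ∑' l, ENNReal.ofReal (f (d l)) ≤ H := by
  refine ⟨hausdorffWith f A + 1 + 1, by simpa using hA, fun δ hδ => ?_⟩
  have h1 : (⨅ (t : ℕ → Set (Fin n → ℝ)) (_ : A ⊆ iUnion t)
      (_ : ∀ l, ediam (t l) ≤ ENNReal.ofReal δ),
      ∑' l, ⨆ _ : (t l).Nonempty, ENNReal.ofReal (f (ediam (t l)).toReal)) <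
        hausdorffWith f A + 1 := by
    refine lt_of_le_of_lt ?_ (ENNReal.lt_add_right hA one_ne_zero)
    rw [hausdorffWith, Measure.mkMetric_apply]
    exact le_iSup₂_of_le (ENNReal.ofReal δ) (by simpa using hδ) le_rfl
  simp only [iInf_lt_iff] at h1
  obtain ⟨V, hV, hd, hsum⟩ := h1
  have hsmall : ∀ l : ℕ, ∃ s, 0 < s ∧ s ≤ δ ∧ f s ≤ (1 / 2) ^ (l + 1) := by
    intro l
    obtain ⟨s, hs, hs'⟩ := ((hf0.eventually (gt_mem_nhds
      (show (0 : ℝ) < (1 / 2) ^ (l + 1) by positivity))).and (Ioo_mem_nhdsGT hδ)).exists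
    exact ⟨s, hs'.1, hs'.2.le, hs.le⟩
  choose s hs0 hsδ hfs using hsmall
  have hne : ∀ l, ediam (V l) ≠ ⊤ := fun l => ne_top_of_le_ne_top ENNReal.ofReal_ne_top (hd l)
  refine ⟨V, fun l => if ediam (V l) = 0 then s l else (ediam (V l)).toReal, fun l => ?_,
    fun l a ha b hb => ?_, hV, ?_⟩
  · dsimp only
    split_ifs with h
    · exact ⟨hs0 l, hsδ l⟩
    · exact ⟨ENNReal.toReal_pos h (hne l), ENNReal.toReal_le_of_le_ofReal hδ.le (hd l)⟩
  · have h2 : dist a b ≤ (ediam (V l)).toReal := dist_le_diam_of_mem' (hne l) ha hb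
    dsimp only
    split_ifs with h
    · rw [h] at h2; exact h2.trans (hs0 l).le
    · exact h2
  · calc _ ≤ ∑' l : ℕ, ((⨆ _ : (V l).Nonempty, ENNReal.ofReal (f (ediam (V l)).toReal)) +
          ENNReal.ofReal ((1 / 2) ^ (l + 1))) := by
          refine ENNReal.tsum_le_tsum fun l => ?_
          dsimp only
          split_ifs with h
          · exact le_add_left (ENNReal.ofReal_le_ofReal (hfs l))
          · refine le_add_right (le_iSup_of_le ?_ le_rfl)
            by_contra h3
            rw [Set.not_nonempty_iff_eq_empty] at h3
            exact h (by rw [h3, ediam_empty])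
      _ ≤ _ := by
          rw [ENNReal.tsum_add]
          gcongr
          have : HasSum (fun l : ℕ => ((1 / 2 : ℝ)) ^ (l + 1)) 1 := by
            convert hasSum_geometric_two' (1 : ℝ) using 2 with l
            rw [pow_succ, one_div_pow]; ring
          rw [← ENNReal.ofReal_tsum_of_nonneg (fun l => by positivity) this.summable, this.tsum_eq,
            ENNReal.ofReal_one]

/-- A disjoint layer of small balls filling a proportion of an open set. -/
lemma exists_disjoint_layer {n : ℕ} {ι : Type*} [Countable ι] {y : ι → Fin n → ℝ} {r s : ι → ℝ}
    (hs : ∀ i, 0 < s i) {U : Set (Fin n → ℝ)}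
    (hfull : ∀ᵐ x, x ∈ U → ∀ ε > 0, ∃ i, s i ≤ ε ∧ r i ≤ ε * s i ∧ x ∈ closedBall (y i) (s i))
    {G : Set (Fin n → ℝ)} (hG : IsOpen G) (hGU : G ⊆ U) {V : ℝ}
    (hV : ENNReal.ofReal V ≤ volume G) {ε : ℝ} (hε : 0 < ε) :
    ∃ u : Finset ι, (∀ i ∈ u, s i ≤ ε ∧ r i ≤ ε * s i ∧ closedBall (y i) (s i) ⊆ G) ∧
      (u : Set ι).PairwiseDisjoint (fun i => closedBall (y i) (s i)) ∧
      V / 2 ≤ ∑ i ∈ u, (10 * s i) ^ n := by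
  obtain ⟨u, hut, hdisj, hsum⟩ := exists_finset_disjoint_closedBall hV
    {i | s i ≤ ε ∧ r i ≤ ε * s i ∧ closedBall (y i) (s i) ⊆ G} y s ε
    (fun i _ => (hs i).le) (fun i hi => hi.1) (by
      filter_upwards [hfull] with a ha haG
      obtain ⟨η, hη, hηG⟩ := Metric.isOpen_iff.1 hG a haG
      obtain ⟨i, h1, h2, h3⟩ := ha (hGU haG) (min ε (η / 3)) (by positivity)
      refine ⟨i, ⟨h1.trans (min_le_left _ _), h2.trans ?_, ?_⟩, h3⟩
      · exact mul_le_mul_of_nonneg_right (min_le_left _ _) (hs i).le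
      · refine (closedBall_subset_ball' ?_).trans hηG
        have h4 := h1.trans (min_le_right _ _)
        rw [mem_closedBall, dist_comm] at h3
        linarith)
  exact ⟨u, fun i hi => hut hi, hdisj, hsum⟩

open Classical in
/-- The iterated layers of the mass transference construction inside a ball. -/
lemma exists_layers {n : ℕ} (hn : 0 < n) {ι : Type*} [Countable ι] [Nonempty ι]
    {y : ι → Fin n → ℝ} {r s : ι → ℝ} (hr : ∀ i, 0 < r i) (hs : ∀ i, 0 < s i)
    {U : Set (Fin n → ℝ)}
    (hfull : ∀ᵐ x, x ∈ U → ∀ ε > 0, ∃ i, s i ≤ ε ∧ r i ≤ ε * s i ∧ x ∈ closedBall (y i) (s i))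
    {z : Fin n → ℝ} {R : ℝ} (hR : 0 < R) (hzU : ball z R ⊆ U) (M : ℕ) :
    ∀ ε > 0, ∃ T : Finset ι, (∀ i ∈ T, r i ≤ ε ∧ closedBall (y i) (r i) ⊆ ball z R) ∧
      M * (R ^ n / (4 * 5 ^ n)) ≤ ∑ i ∈ T, s i ^ n ∧
      ∑ i ∈ T, (2 * r i) ^ n ≤ ε ∧
      ∀ (V : Set (Fin n → ℝ)) (d : ℝ), 0 < d → (∀ a ∈ V, ∀ b ∈ V, dist a b ≤ d) →
        ∃ i₀, ∑ i ∈ T with (V ∩ closedBall (y i) (r i)).Nonempty ∧ i ≠ i₀, s i ^ n ≤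
          M * (4 * d) ^ n := by
  induction M with
  | zero =>
    intro ε hε
    exact ⟨∅, by simp, by simp, by simpa using hε.le, fun _ _ _ _ => ⟨Classical.arbitrary ι, by simp⟩⟩
  | succ M ih =>
    intro ε hε
    obtain ⟨T, hT1, hT2, hT3, hT4⟩ := ih (min (ε / 2) ((2 * R) ^ n / 2)) (by positivity)
    set G : Set (Fin n → ℝ) := ball z R \ ⋃ i ∈ T, closedBall (y i) (r i) with hG
    have hGo : IsOpen G := isOpen_ball.sdiff
      (T.finite_toSet.isClosed_biUnion fun i _ => isClosed_closedBall)
    have hGv : ENNReal.ofReal ((2 * R) ^ n / 2) ≤ volume G := by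
      have h1 : volume (⋃ i ∈ T, closedBall (y i) (r i)) ≤ ENNReal.ofReal ((2 * R) ^ n / 2) := by
        refine (measure_biUnion_finset_le _ _).trans ?_
        refine le_trans ?_ (ENNReal.ofReal_le_ofReal (hT3.trans (min_le_right _ _)))
        rw [ENNReal.ofReal_sum_of_nonneg fun i _ => by have := hr i; positivity]
        refine Finset.sum_le_sum fun i _ => ?_
        rw [Real.volume_pi_closedBall _ (hr i).le, Fintype.card_fin]
      refine le_trans ?_ (le_measure_sdiff)
      rw [Real.volume_pi_ball _ hR, Fintype.card_fin]
      refine le_trans ?_ (tsub_le_tsub_left h1 _)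
      rw [← ENNReal.ofReal_sub _ (by positivity)]
      exact ENNReal.ofReal_le_ofReal (by linarith)
    set ε₂ : ℝ := min (min ε (1 / 2)) (ε / (4 * R ^ n)) with hε₂
    have hε₂0 : 0 < ε₂ := by positivity
    have hε₂1 : ε₂ ≤ ε := (min_le_left _ _).trans (min_le_left _ _)
    have hε₂2 : ε₂ ≤ 1 / 2 := (min_le_left _ _).trans (min_le_right _ _)
    have hε₂3 : ε₂ * (4 * R ^ n) ≤ ε := (le_div_iff₀ (by positivity)).1 (min_le_right _ _)
    obtain ⟨u, hu1, hu2, hu3⟩ := exists_disjoint_layer hs hfull hGo (sdiff_subset.trans hzU)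
      hGv hε₂0
    have hrs : ∀ i ∈ u, r i ≤ s i / 2 := fun i hi => by
      have := (hu1 i hi).2.1
      nlinarith [hs i]
    have hsub : ∀ i ∈ u, closedBall (y i) (r i) ⊆ closedBall (y i) (s i) := fun i hi =>
      closedBall_subset_closedBall (by have := hrs i hi; have := hs i; linarith)
    have hsR : ∑ i ∈ u, s i ^ n ≤ R ^ n :=
      sum_pow_le_of_subset_closedBall hR.le (fun i _ => (hs i).le) hu2
        (fun i hi => ((hu1 i hi).2.2.trans sdiff_subset).trans ball_subset_closedBall)
    have hTu : Disjoint T u := by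
      rw [Finset.disjoint_left]
      intro i hi hi'
      exact ((hu1 i hi').2.2 (mem_closedBall_self (hs i).le)).2
        (mem_iUnion₂.2 ⟨i, hi, mem_closedBall_self (hr i).le⟩)
    refine ⟨T ∪ u, ?_, ?_, ?_, ?_⟩
    · intro i hi
      rcases Finset.mem_union.1 hi with hi | hi
      · exact ⟨(hT1 i hi).1.trans ((min_le_left _ _).trans (by linarith)), (hT1 i hi).2⟩
      · refine ⟨?_, (hsub i hi).trans ((hu1 i hi).2.2.trans sdiff_subset)⟩
        have h1 := hrs i hi
        have h2 := (hu1 i hi).1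
        have := hs i
        linarith
    · rw [Finset.sum_union hTu]
      have h1 : ∑ i ∈ u, (10 * s i) ^ n = 10 ^ n * ∑ i ∈ u, s i ^ n := by
        rw [Finset.mul_sum]; exact Finset.sum_congr rfl fun i _ => mul_pow _ _ _
      rw [h1, mul_pow, show (10 : ℝ) ^ n = 2 ^ n * 5 ^ n by rw [← mul_pow]; norm_num] at hu3
      have h2 : R ^ n / (4 * 5 ^ n) ≤ ∑ i ∈ u, s i ^ n := by
        rw [div_le_iff₀ (by positivity)]
        have : (0 : ℝ) < 2 ^ n := by positivity
        refine le_of_mul_le_mul_left ?_ this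
        linarith
      push_cast
      linarith
    · rw [Finset.sum_union hTu]
      have h1 : ∑ i ∈ u, (2 * r i) ^ n ≤ 2 * ε₂ * ∑ i ∈ u, s i ^ n := by
        rw [Finset.mul_sum]
        refine Finset.sum_le_sum fun i hi => ?_
        have h2 : 2 * r i ≤ 2 * ε₂ * s i := by linarith [(hu1 i hi).2.1]
        refine (pow_le_pow_left₀ (by linarith [hr i]) h2 n).trans ?_
        rw [mul_pow]
        refine mul_le_mul_of_nonneg_right ?_ (by have := hs i; positivity)
        exact pow_le_of_le_one (by positivity) (by linarith) hn.ne'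
      have h2 : 2 * ε₂ * ∑ i ∈ u, s i ^ n ≤ 2 * ε₂ * R ^ n :=
        mul_le_mul_of_nonneg_left hsR (by positivity)
      have h3 := hT3.trans (min_le_left _ _)
      linarith
    · intro V d hd hV
      by_cases hA : ∃ j, (∀ i ∈ T ∪ u, (V ∩ closedBall (y i) (r i)).Nonempty → i = j)
      · obtain ⟨j, hj⟩ := hA
        refine ⟨j, ?_⟩
        rw [Finset.filter_false_of_mem, Finset.sum_empty]
        · positivity
        · rintro i hi ⟨h1, h2⟩
          exact h2 (hj i hi h1)
      · push Not at hA
        obtain ⟨i₀, hi₀⟩ := hT4 V d hd hV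
        refine ⟨i₀, ?_⟩
        rw [Finset.filter_union, Finset.sum_union (hTu.mono (Finset.filter_subset _ _)
          (Finset.filter_subset _ _))]
        obtain ⟨i₁, -, ⟨v, hv, -⟩, -⟩ := hA i₀
        have hsmall : ∀ j ∈ u, (V ∩ closedBall (y j) (r j)).Nonempty → s j ≤ 2 * d := by
          rintro j hj ⟨a, haV, haj⟩
          obtain ⟨i, hi, ⟨b, hbV, hbi⟩, hij⟩ := hA j
          have hbj : b ∉ closedBall (y j) (s j) := by
            intro hb
            rcases Finset.mem_union.1 hi with hi | hi
            · exact ((hu1 j hj).2.2 hb).2 (mem_iUnion₂.2 ⟨i, hi, hbi⟩)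
            · exact Set.disjoint_left.1 (hu2 hi hj hij) (hsub i hi hbi) hb
          rw [mem_closedBall, not_le] at hbj
          rw [mem_closedBall] at haj
          have := dist_triangle b a (y j)
          have := hV b hbV a haV
          have := hrs j hj
          linarith
        have h2 : ∑ i ∈ u with (V ∩ closedBall (y i) (r i)).Nonempty ∧ i ≠ i₀, s i ^ n ≤
            (4 * d) ^ n := by
          refine sum_pow_le_of_subset_closedBall (z := v) (by positivity)
            (fun i _ => (hs i).le) (hu2.subset fun i hi => (Finset.mem_filter.1 hi).1) ?_
          intro j hj
          obtain ⟨hj, hjV, -⟩ := Finset.mem_filter.1 hj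
          have h3 := hsmall j hj hjV
          obtain ⟨a, haV, haj⟩ := hjV
          rw [mem_closedBall'] at haj
          refine closedBall_subset_closedBall' ?_
          have := dist_triangle (y j) a v
          have := hV a haV v hv
          have := hrs j hj
          linarith
        push_cast
        linarith

/-- The total cost `∑ g l` of those members of the family `V` that meet `B`. -/
noncomputable def coverCost {E : Type*} (V : ℕ → Set E) (g : ℕ → ℝ) (B : Set E) : ENNReal :=
  ∑' l, {l | (V l ∩ B).Nonempty}.indicator (fun l => ENNReal.ofReal (g l)) l

lemma ofReal_le_coverCost {E : Type*} {V : ℕ → Set E} {g : ℕ → ℝ} {B : Set E} {l : ℕ}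
    (hl : (V l ∩ B).Nonempty) : ENNReal.ofReal (g l) ≤ coverCost V g B := by
  refine le_trans ?_ (ENNReal.le_tsum l)
  rw [Set.indicator_of_mem (show l ∈ {l | (V l ∩ B).Nonempty} from hl)]

lemma coverCost_le_mul {E : Type*} {V : ℕ → Set E} {g h : ℕ → ℝ} {B : Set E} {K : ℝ} (hK : 0 ≤ K)
    (hgh : ∀ l, (V l ∩ B).Nonempty → h l ≤ K * g l) :
    coverCost V h B ≤ ENNReal.ofReal K * coverCost V g B := by
  rw [coverCost, coverCost, ← ENNReal.tsum_mul_left]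
  refine ENNReal.tsum_le_tsum fun l => ?_
  by_cases hl : (V l ∩ B).Nonempty
  · rw [Set.indicator_of_mem (show l ∈ {l | (V l ∩ B).Nonempty} from hl),
      Set.indicator_of_mem (show l ∈ {l | (V l ∩ B).Nonempty} from hl), ← ENNReal.ofReal_mul hK]
    exact ENNReal.ofReal_le_ofReal (hgh l hl)
  · rw [Set.indicator_of_notMem (show l ∉ {l | (V l ∩ B).Nonempty} from hl)]
    exact zero_le

lemma coverCost_le_tsum {E : Type*} {V : ℕ → Set E} {g : ℕ → ℝ} {B : Set E} :
    coverCost V g B ≤ ∑' l, ENNReal.ofReal (g l) :=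
  ENNReal.tsum_le_tsum fun _ => Set.indicator_le_self _ _ _

open Classical in
/-- A ball that is cheaply covered contains a ball of the limsup family that is cheaply covered. -/
lemma exists_cheap_subball {n : ℕ} (hn : 0 < n) {ι : Type*} [Countable ι] [Nonempty ι]
    {y : ι → Fin n → ℝ} {r s : ι → ℝ} (hr : ∀ i, 0 < r i) (hs : ∀ i, 0 < s i)
    {U : Set (Fin n → ℝ)}
    (hfull : ∀ᵐ x, x ∈ U → ∀ ε > 0, ∃ i, s i ≤ ε ∧ r i ≤ ε * s i ∧ x ∈ closedBall (y i) (s i))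
    {z : Fin n → ℝ} {R : ℝ} (hR : 0 < R) (hzU : ball z R ⊆ U)
    {V : ℕ → Set (Fin n → ℝ)} {d g : ℕ → ℝ} (hd : ∀ l, 0 < d l)
    (hV : ∀ l, ∀ a ∈ V l, ∀ b ∈ V l, dist a b ≤ d l)
    (hcost : coverCost V (fun l => d l ^ n) (closedBall z R) ≤
      ENNReal.ofReal (1 / (8 * 20 ^ n) * R ^ n))
    (hfin : coverCost V g (closedBall z R) ≠ ⊤) {ε : ℝ} (hε : 0 < ε) :
    ∃ i, r i ≤ ε ∧ closedBall (y i) (r i) ⊆ ball z R ∧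
      coverCost V g (closedBall (y i) (r i)) ≤ ENNReal.ofReal (1 / (8 * 20 ^ n) * s i ^ n) := by
  set κ : ℝ := 1 / (8 * 20 ^ n) with hκ
  have hκ0 : 0 < κ := by positivity
  set c : ℝ := R ^ n / (4 * 5 ^ n) with hc
  have hc0 : 0 < c := by positivity
  have hκc : 4 ^ n * (κ * R ^ n) = c / 2 := by
    rw [hκ, hc, show (20 : ℝ) ^ n = 4 ^ n * 5 ^ n by rw [← mul_pow]; norm_num]
    field_simp; norm_num
  set P := (coverCost V g (closedBall z R)).toReal with hP
  obtain ⟨M, hM⟩ := exists_nat_gt (P / (κ * c / 2))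
  rw [div_lt_iff₀ (by positivity)] at hM
  obtain ⟨T, hT1, hT2, -, hT4⟩ := exists_layers hn hr hs hfull hR hzU M ε hε
  choose i₀ hi₀ using fun l => hT4 (V l) (d l) (hd l) (hV l)
  by_contra! hcon
  replace hcon : ∀ i ∈ T, ENNReal.ofReal (κ * s i ^ n) < coverCost V g (closedBall (y i) (r i)) :=
    fun i hi => hcon i (hT1 i hi).1 (hT1 i hi).2
  let F : ι → ℕ → ENNReal := fun i l => if (V l ∩ closedBall (y i) (r i)).Nonempty then
    if i = i₀ l then ENNReal.ofReal (g l) else ENNReal.ofReal (κ * s i ^ n) else 0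
  have h1 : ∀ i ∈ T, ENNReal.ofReal (κ * s i ^ n) ≤ ∑' l, F i l := by
    intro i hi
    by_cases h : ∃ l, (V l ∩ closedBall (y i) (r i)).Nonempty ∧ i ≠ i₀ l
    · obtain ⟨l, hl, hil⟩ := h
      refine le_trans ?_ (ENNReal.le_tsum l)
      simp only [F, if_pos hl, if_neg hil, le_refl]
    · push Not at h
      refine (hcon i hi).le.trans (ENNReal.tsum_le_tsum fun l => ?_)
      by_cases hl : (V l ∩ closedBall (y i) (r i)).Nonempty
      · simp only [F, if_pos hl, if_pos (h l hl)]
        exact Set.indicator_le_self _ _ _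
      · rw [Set.indicator_of_notMem (by exact hl)]
        exact zero_le
  have h2 : ∀ l, ∑ i ∈ T, F i l ≤ {l | (V l ∩ closedBall z R).Nonempty}.indicator
      (fun l => ENNReal.ofReal (g l)) l + ENNReal.ofReal (κ * M * 4 ^ n) *
      {l | (V l ∩ closedBall z R).Nonempty}.indicator (fun l => ENNReal.ofReal (d l ^ n)) l := by
    intro l
    by_cases hl : (V l ∩ closedBall z R).Nonempty
    · rw [Set.indicator_of_mem (by exact hl), Set.indicator_of_mem (by exact hl),
        ← ENNReal.ofReal_mul (by positivity)]
      calc ∑ i ∈ T, F i l ≤ ∑ i ∈ T, ((if i = i₀ l then ENNReal.ofReal (g l) else 0) +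
            if (V l ∩ closedBall (y i) (r i)).Nonempty ∧ i ≠ i₀ l then
              ENNReal.ofReal (κ * s i ^ n) else 0) := by
            refine Finset.sum_le_sum fun i _ => ?_
            simp only [F]
            by_cases h1 : (V l ∩ closedBall (y i) (r i)).Nonempty
            · by_cases h2 : i = i₀ l
              · rw [if_pos h1, if_pos h2, if_pos h2]
                exact le_self_add
              · rw [if_pos h1, if_neg h2, if_neg h2, if_pos ⟨h1, h2⟩, zero_add]
            · rw [if_neg h1]
              exact zero_le
        _ ≤ _ := by
            rw [Finset.sum_add_distrib]
            refine add_le_add ?_ ?_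
            · rw [Finset.sum_ite_eq']
              split_ifs <;> simp
            · rw [← Finset.sum_filter, ← ENNReal.ofReal_sum_of_nonneg fun i _ => by
                have := hs i; positivity, ← Finset.mul_sum]
              refine ENNReal.ofReal_le_ofReal ?_
              have := mul_le_mul_of_nonneg_left (hi₀ l) hκ0.le
              rw [mul_pow] at this
              linarith
    · rw [Finset.sum_eq_zero]
      · exact zero_le
      · intro i hi
        refine if_neg fun h => hl (h.mono (inter_subset_inter_right _ ?_))
        exact (hT1 i hi).2.trans ball_subset_closedBall
  have h3 : ENNReal.ofReal (κ * (M * c)) ≤ ENNReal.ofReal (P + κ * M * 4 ^ n * (κ * R ^ n)) := by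
    calc ENNReal.ofReal (κ * (M * c)) ≤ ∑ i ∈ T, ENNReal.ofReal (κ * s i ^ n) := by
          rw [← ENNReal.ofReal_sum_of_nonneg fun i _ => by have := hs i; positivity,
            ← Finset.mul_sum]
          exact ENNReal.ofReal_le_ofReal (mul_le_mul_of_nonneg_left hT2 hκ0.le)
      _ ≤ ∑ i ∈ T, ∑' l, F i l := Finset.sum_le_sum h1
      _ = ∑' l, ∑ i ∈ T, F i l := (Summable.tsum_finsetSum fun _ _ => ENNReal.summable).symm
      _ ≤ _ := ENNReal.tsum_le_tsum h2
      _ = coverCost V g (closedBall z R) + ENNReal.ofReal (κ * M * 4 ^ n) *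
          coverCost V (fun l => d l ^ n) (closedBall z R) := by
          rw [ENNReal.tsum_add, ENNReal.tsum_mul_left]; rfl
      _ ≤ ENNReal.ofReal P + ENNReal.ofReal (κ * M * 4 ^ n) * ENNReal.ofReal (κ * R ^ n) := by
          rw [hP, ENNReal.ofReal_toReal hfin]; gcongr
      _ = _ := by
          rw [← ENNReal.ofReal_mul (by positivity), ENNReal.ofReal_add ENNReal.toReal_nonneg
            (by positivity)]
  rw [ENNReal.ofReal_le_ofReal_iff (add_nonneg ENNReal.toReal_nonneg (by positivity))] at h3
  have h4 : κ * M * 4 ^ n * (κ * R ^ n) = κ * M * (c / 2) := by rw [← hκc]; ring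
  rw [h4] at h3
  linarith

/-- The mass transference principle: a limsup set of balls whose `f`-enlargements have a limsup set
of full Lebesgue measure has infinite Hausdorff `f`-measure. -/
lemma hausdorffWith_eq_top {n : ℕ} (hn : 0 < n) {f : ℝ → ℝ} (hmono : MonotoneOn f (Ioi 0))
    (hf_pos : ∀ r > (0 : ℝ), 0 < f r) (hf0 : Tendsto f (nhdsWithin 0 (Ioi 0)) (nhds 0))
    (hanti : ∀ a b, 0 < a → a ≤ b → f b * a ^ n ≤ f a * b ^ n)
    (hlarge : ∀ K : ℝ, ∀ᶠ r in nhdsWithin 0 (Ioi 0), K * r ^ n ≤ f r)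
    {ι : Type*} [Countable ι] [Nonempty ι]
    {y : ι → Fin n → ℝ} {r s : ι → ℝ} (hr : ∀ i, 0 < r i) (hs : ∀ i, 0 < s i)
    (hrs : ∀ i, s i ^ n = f (r i)) {z : Fin n → ℝ} {R : ℝ} (hR : 0 < R)
    (hfull : ∀ᵐ x, x ∈ ball z R → ∀ ε > 0, ∃ i, s i ≤ ε ∧ r i ≤ ε * s i ∧
      x ∈ closedBall (y i) (s i))
    {A : Set (Fin n → ℝ)} (hA : ∀ x ∈ ball z R, {i | x ∈ ball (y i) (r i)}.Infinite → x ∈ A) :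
    hausdorffWith f A = ⊤ := by
  by_contra hfin
  obtain ⟨H, hH, hcov⟩ := exists_covers_of_hausdorffWith_ne_top hf0 hfin
  set κ : ℝ := 1 / (8 * 20 ^ n) with hκ
  have hκ0 : 0 < κ := by positivity
  have hκ1 : κ < 1 := by
    rw [hκ, div_lt_one (by positivity)]
    have : (1 : ℝ) ≤ 20 ^ n := one_le_pow₀ (by norm_num)
    linarith
  set K : ℝ := (H.toReal + 1) / (κ * R ^ n) with hK
  have hH0 : 0 ≤ H.toReal := ENNReal.toReal_nonneg
  have hK0 : 0 < K := by positivity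
  obtain ⟨δ, hδ, hδK⟩ := mem_nhdsGT_iff_exists_Ioo_subset.1 (hlarge K)
  rw [mem_Ioi] at hδ
  obtain ⟨V, d, hd, hV, hAV, hsum⟩ := hcov (δ / 2) (by positivity)
  have hd0 : ∀ l, 0 < d l := fun l => (hd l).1
  let Good : ι → Prop := fun i => closedBall (y i) (r i) ⊆ ball z R ∧
    coverCost V (fun l => f (d l)) (closedBall (y i) (r i)) ≤ ENNReal.ofReal (κ * s i ^ n)
  have hgood : ∀ i, Good i → ∀ l, (V l ∩ closedBall (y i) (r i)).Nonempty → d l < r i := by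
    intro i hi l hl
    have h1 := (ofReal_le_coverCost (g := fun l => f (d l)) hl).trans hi.2
    have hf := hf_pos _ (hr i)
    rw [hrs, ENNReal.ofReal_le_ofReal_iff (by positivity)] at h1
    by_contra! h2
    have h3 := hmono (hr i) (hd0 l) h2
    nlinarith
  have hstep : ∀ i : {i // Good i}, ∃ j : {i // Good i}, r j ≤ r i / 2 ∧
      closedBall (y j) (r j) ⊆ ball (y i) (r i) := by
    rintro ⟨i, hi⟩
    have hri := hr i
    have hfi := hf_pos _ hri
    have h1 : coverCost V (fun l => d l ^ n) (closedBall (y i) (r i)) ≤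
        ENNReal.ofReal (κ * r i ^ n) := by
      refine (coverCost_le_mul (K := r i ^ n / f (r i)) (g := fun l => f (d l)) (by positivity)
        fun l hl => ?_).trans ?_
      · rw [div_mul_eq_mul_div, le_div_iff₀ hfi]
        linarith [hanti (d l) (r i) (hd0 l) (hgood i hi l hl).le]
      · refine (mul_le_mul_right hi.2 _).trans ?_
        rw [← ENNReal.ofReal_mul (by positivity), hrs]
        refine ENNReal.ofReal_le_ofReal (le_of_eq ?_)
        field_simp
    have hiU : ball (y i) (r i) ⊆ ball z R := ball_subset_closedBall.trans hi.1
    obtain ⟨j, hj1, hj2, hj3⟩ := exists_cheap_subball hn hr hs hfull hri hiU hd0 hV h1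
      (ne_top_of_le_ne_top ENNReal.ofReal_ne_top hi.2) (half_pos hri)
    exact ⟨⟨j, hj2.trans hiU, hj3⟩, hj1, hj2⟩
  obtain ⟨j₀, -, hj₀1, hj₀2⟩ := exists_cheap_subball hn hr hs hfull hR Subset.rfl hd0 hV
    (g := fun l => f (d l)) (by
      refine (coverCost_le_mul (K := 1 / K) (g := fun l => f (d l)) (by positivity)
        fun l _ => ?_).trans ?_
      · rw [div_mul_eq_mul_div, one_mul, le_div_iff₀ hK0, mul_comm]
        exact hδK ⟨hd0 l, by linarith [(hd l).2]⟩
      · refine (mul_le_mul_right (coverCost_le_tsum.trans hsum) _).trans ?_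
        rw [← ENNReal.ofReal_toReal hH, ← ENNReal.ofReal_mul (by positivity)]
        refine ENNReal.ofReal_le_ofReal ?_
        rw [← hκ, hK, one_div_div, div_mul_eq_mul_div, div_le_iff₀ (by positivity)]
        exact mul_le_mul_of_nonneg_left (by linarith) (by positivity))
    (ne_top_of_le_ne_top hH (coverCost_le_tsum.trans hsum)) one_pos
  choose next hnext1 hnext2 using hstep
  obtain ⟨q, hq⟩ : ∃ q : ℕ → {i // Good i}, ∀ m, q (m + 1) = next (q m) :=
    ⟨fun m => Nat.rec ⟨j₀, hj₀1, hj₀2⟩ (fun _ i => next i) m, fun _ => rfl⟩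
  have hq1 : ∀ m : ℕ, r (q (m + 1)) ≤ r (q m) / 2 := fun m => hq m ▸ hnext1 (q m)
  have hq2 : ∀ m : ℕ, closedBall (y (q (m + 1))) (r (q (m + 1))) ⊆ ball (y (q m)) (r (q m)) :=
    fun m => hq m ▸ hnext2 (q m)
  obtain ⟨x, hx⟩ := IsCompact.nonempty_iInter_of_sequence_nonempty_isCompact_isClosed
    (fun m => closedBall (y (q m)) (r (q m))) (fun m => (hq2 m).trans ball_subset_closedBall)
    (fun m => ⟨_, mem_closedBall_self (hr _).le⟩) (isCompact_closedBall _ _)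
    (fun m => isClosed_closedBall)
  rw [mem_iInter] at hx
  have hanti' : StrictAnti fun m => r (q m) := strictAnti_nat_of_succ_lt fun m => by
    have := hq1 m; have := hr (q m); linarith
  have hxA : x ∈ A := by
    refine hA x ((q 0).2.1 (hx 0)) ?_
    exact Set.infinite_of_injective_forall_mem (f := fun m => (q m : ι))
      (fun a b hab => hanti'.injective (congrArg r hab)) fun m => hq2 m (hx (m + 1))
  obtain ⟨l, hl⟩ := mem_iUnion.1 (hAV hxA)
  have hrm : ∀ m : ℕ, r (q m) ≤ (1 / 2) ^ m * r (q 0) := by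
    intro m
    induction m with
    | zero => simp
    | succ m ih => rw [pow_succ]; linarith [hq1 m]
  have hlim : Tendsto (fun m : ℕ => (1 / 2 : ℝ) ^ m * r (q 0)) atTop (nhds 0) := by
    simpa using (tendsto_pow_atTop_nhds_zero_of_lt_one (r := (1 / 2 : ℝ)) (by norm_num)
      (by norm_num)).mul_const (r (q 0))
  obtain ⟨m, hm⟩ := (hlim.eventually (gt_mem_nhds (hd0 l))).exists
  have := hgood (q m) (q m).2 l ⟨x, hl, hx m⟩
  linarith [hrm m]

lemma mem_ball_perturbed_iff {n q : ℕ} (hq : 0 < q) (x g : Fin n → ℝ) (p : Fin n → ℤ) (t : ℝ) :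
    x ∈ ball (fun i => ((p i : ℝ) - g i) / q) (t / q) ↔
      ‖(q : ℝ) • x - (fun i => (p i : ℝ)) + g‖ < t := by
  have hq' : (0 : ℝ) < q := by exact_mod_cast hq
  have h : (q : ℝ) • x - (fun i => (p i : ℝ)) + g =
      (q : ℝ) • (x - fun i => ((p i : ℝ) - g i) / q) := by
    ext i
    simp only [Pi.add_apply, Pi.sub_apply, Pi.smul_apply, smul_eq_mul]
    field_simp
    ring
  rw [h, norm_smul, Real.norm_of_nonneg hq'.le, mem_ball, dist_eq_norm, lt_div_iff₀' hq']

lemma dist_rational_perturbed {n q : ℕ} (g : Fin n → ℝ) (p : Fin n → ℤ) :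
    dist (fun i => (p i : ℝ) / q) (fun i => ((p i : ℝ) - g i) / q) = ‖g‖ / q := by
  have h : ((fun i => (p i : ℝ) / q) - fun i => ((p i : ℝ) - g i) / q) = (q : ℝ)⁻¹ • g := by
    ext i
    simp only [Pi.sub_apply, Pi.smul_apply, smul_eq_mul]
    ring
  rw [dist_eq_norm, h, norm_smul, norm_inv, RCLike.norm_natCast, div_eq_inv_mul]

lemma ball_half_half (n : ℕ) : ball (fun _ : Fin n => (1 / 2 : ℝ)) (1 / 2) =
    Set.univ.pi fun _ => Ioo (0 : ℝ) 1 := by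
  rw [ball_pi _ (by norm_num)]
  congr! 2 with i
  rw [Real.ball_eq_Ioo]; norm_num

lemma mem_Wgamma_of_infinite {n : ℕ} {ψ : ℕ → ℝ} {γ : (Fin n → ℤ) × ℕ → Fin n → ℝ}
    {x : Fin n → ℝ} (hx : x ∈ Set.univ.pi fun _ : Fin n => Ioo (0 : ℝ) 1)
    (h : ∀ N : ℕ, ∃ q : ℕ, N ≤ q ∧ 0 < q ∧ ∃ p : Fin n → ℤ,
      x ∈ ball (fun i => ((p i : ℝ) - γ (p, q) i) / q) (ψ q / q)) : x ∈ Wgamma n ψ γ := by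
  refine ⟨fun i hi => Ioo_subset_Icc_self (hx i hi), ?_⟩
  refine Set.Infinite.of_image Prod.snd (Set.infinite_of_forall_exists_gt fun N => ?_)
  obtain ⟨q, hq, hq0, p, hp⟩ := h (N + 1)
  exact ⟨q, ⟨(p, q), ⟨hq0, (mem_ball_perturbed_iff hq0 _ _ _ _).1 hp⟩, rfl⟩, hq⟩

lemma tendsto_div_nat_nhdsGT {ψ : ℕ → ℝ} (hψpos : ∀ q, 0 < ψ q) (hψ0 : Tendsto ψ atTop (nhds 0)) :
    Tendsto (fun q : ℕ => ψ q / q) atTop (nhdsWithin 0 (Ioi 0)) := by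
  refine tendsto_nhdsWithin_iff.2 ⟨squeeze_zero (fun q => by have := hψpos q; positivity)
    (fun q => ?_) hψ0, ?_⟩
  · rcases Nat.eq_zero_or_pos q with rfl | hq
    · simpa using (hψpos 0).le
    · exact div_le_self (hψpos q).le (by exact_mod_cast hq)
  · filter_upwards [eventually_gt_atTop 0] with q hq
    have := hψpos q
    rw [mem_Ioi]; positivity

/-- The convergence half, from the natural cover of the limsup set. -/
lemma hausdorffWith_Wgamma_eq_zero {n : ℕ} (hn : 0 < n) {ψ : ℕ → ℝ} (hψpos : ∀ q, 0 < ψ q)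
    (hψanti : Antitone ψ) (hψ0 : Tendsto ψ atTop (nhds 0))
    {γ : (Fin n → ℤ) × ℕ → Fin n → ℝ} (hγ : ∀ pq i, γ pq i ∈ Set.Icc (-(1 / 2) : ℝ) (1 / 2))
    {f : ℝ → ℝ} (hmono : MonotoneOn f (Ioi 0)) (hf_pos : ∀ r > (0 : ℝ), 0 < f r)
    {D : ℝ} (hD : ∀ᶠ r in nhdsWithin 0 (Ioi 0), f (2 * r) ≤ D * f r)
    (hsum : Summable fun q : ℕ => (q : ℝ) ^ n * f (ψ q / q)) :
    hausdorffWith f (Wgamma n ψ γ) = 0 := by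
  classical
  obtain ⟨A, hA⟩ := exists_nat_gt (ψ 0 + 1)
  let P : ℕ → Finset (Fin n → ℤ) := fun q =>
    Fintype.piFinset fun _ => Finset.Icc (-(q + A : ℤ)) (q + A)
  have hPcard : ∀ q : ℕ, 0 < q → ((P q).card : ℝ) ≤ ((2 * A + 3) * q) ^ n := by
    intro q hq
    have hq' : (1 : ℝ) ≤ q := by exact_mod_cast hq
    have h1 : ((q + A : ℤ) + 1 - -(q + A : ℤ)).toNat = 2 * (q + A) + 1 := by omega
    simp only [P, Fintype.card_piFinset, Int.card_Icc, Finset.prod_const, Finset.card_univ,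
      Fintype.card_fin, h1]
    push_cast
    have hA0 : (0 : ℝ) ≤ A := by positivity
    gcongr
    nlinarith
  have hmemP : ∀ x ∈ unitCube n, ∀ (p : Fin n → ℤ) (q : ℕ),
      ‖(q : ℝ) • x - (fun i => (p i : ℝ)) + γ (p, q)‖ < ψ q → p ∈ P q := by
    intro x hx p q h
    rw [Fintype.mem_piFinset]
    intro i
    have h1 := (norm_le_pi_norm _ i).trans_lt h
    simp only [Pi.add_apply, Pi.sub_apply, Pi.smul_apply, smul_eq_mul, Real.norm_eq_abs,
      abs_lt] at h1
    have h2 := hx i trivial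
    have h3 := hγ (p, q) i
    have h4 := hψanti (Nat.zero_le q)
    have h5 : (0 : ℝ) ≤ q := by positivity
    have h6 : 0 ≤ q * x i := mul_nonneg h5 h2.1
    have h7 : q * x i ≤ q := mul_le_of_le_one_right h5 h2.2
    rw [Finset.mem_Icc]
    constructor
    · have : (-(q + A : ℤ) : ℝ) ≤ p i := by push_cast; linarith [h3.1, h3.2]
      exact_mod_cast this
    · have : (p i : ℝ) ≤ (q + A : ℤ) := by push_cast; linarith [h3.1, h3.2]
      exact_mod_cast this
  have hcov : ∀ x ∈ Wgamma n ψ γ, ∀ N : ℕ, ∃ q : ℕ, N ≤ q ∧ 0 < q ∧ ∃ p ∈ P q,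
      x ∈ closedBall (fun i => ((p i : ℝ) - γ (p, q) i) / q) (ψ q / q) := by
    rintro x ⟨hx, hinf⟩ N
    by_contra! hcon
    refine hinf ((((Finset.range N).biUnion P) ×ˢ Finset.range N).finite_toSet.subset ?_)
    rintro ⟨p, q⟩ ⟨hq, hpq⟩
    have hp := hmemP x hx p q hpq
    have hqN : q < N := by
      by_contra! h
      exact hcon q h hq p hp (ball_subset_closedBall ((mem_ball_perturbed_iff hq _ _ _ _).2 hpq))
    simp only [Finset.coe_product, Set.mem_prod, Finset.mem_coe, Finset.mem_biUnion,
      Finset.mem_range]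
    exact ⟨⟨q, hqN, hp⟩, hqN⟩
  rw [← nonpos_iff_eq_zero]
  refine ENNReal.le_of_forall_pos_le_add fun ε hε _ => ?_
  rw [zero_add]
  refine hausdorffWith_le_of_covers hn hmono fun δ hδ => ?_
  have hρ := tendsto_div_nat_nhdsGT hψpos hψ0
  set K : ℝ := (2 * A + 3) ^ n * |D| with hK
  have htail : Tendsto (fun N => K * ∑' q, ((q + N : ℕ) : ℝ) ^ n * f (ψ (q + N) / (q + N : ℕ)))
      atTop (nhds 0) := by
    simpa using (tendsto_sum_nat_add fun q : ℕ => (q : ℝ) ^ n * f (ψ q / q)).const_mul K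
  obtain ⟨N₁, hN₁⟩ := eventually_atTop.1 ((hρ.eventually (Ioo_mem_nhdsGT hδ)).and
    (hρ.eventually hD))
  obtain ⟨N, hNε, hN⟩ := ((htail.eventually (gt_mem_nhds (show (0 : ℝ) < ε from hε))).and
    (eventually_ge_atTop (N₁ + 1))).exists
  refine ⟨Σ q : ℕ, P (q + N), inferInstance,
    fun j i => ((j.2.1 i : ℝ) - γ (j.2.1, j.1 + N) i) / (j.1 + N : ℕ),
    fun j => ψ (j.1 + N) / (j.1 + N : ℕ), fun j => ?_, fun x hx => ?_, ?_⟩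
  · have := (hN₁ (j.1 + N) (by omega)).1
    exact ⟨this.1, this.2.le⟩
  · obtain ⟨q, hq, -, p, hp, hxp⟩ := hcov x hx N
    obtain ⟨q, rfl⟩ := Nat.exists_eq_add_of_le' hq
    exact mem_iUnion.2 ⟨⟨q, ⟨p, hp⟩⟩, hxp⟩
  · have hnn : ∀ q : ℕ, 0 ≤ ((q + N : ℕ) : ℝ) ^ n * f (ψ (q + N) / (q + N : ℕ)) := fun q => by
      have := hf_pos _ (hN₁ (q + N) (by omega)).1.1
      positivity
    calc ∑' j : Σ q : ℕ, P (q + N), ENNReal.ofReal (f (2 * (ψ (j.1 + N) / (j.1 + N : ℕ))))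
        = ∑' q : ℕ, ∑' _ : P (q + N), ENNReal.ofReal (f (2 * (ψ (q + N) / (q + N : ℕ)))) :=
          ENNReal.tsum_sigma' _
      _ ≤ ∑' q : ℕ, ENNReal.ofReal (K * (((q + N : ℕ) : ℝ) ^ n *
            f (ψ (q + N) / (q + N : ℕ)))) := by
          refine ENNReal.tsum_le_tsum fun q => ?_
          have h1 := (hN₁ (q + N) (by omega)).2
          have h2 := hf_pos _ (hN₁ (q + N) (by omega)).1.1
          have h3 := hPcard (q + N) (by omega)
          have h4 : f (2 * (ψ (q + N) / (q + N : ℕ))) ≤ |D| * f (ψ (q + N) / (q + N : ℕ)) :=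
            h1.trans (mul_le_mul_of_nonneg_right (le_abs_self D) h2.le)
          rw [tsum_fintype, Finset.sum_const, Finset.card_univ, Fintype.card_coe, nsmul_eq_mul,
            ← ENNReal.ofReal_natCast, ← ENNReal.ofReal_mul (by positivity)]
          refine ENNReal.ofReal_le_ofReal ?_
          calc _ ≤ ((2 * A + 3) * ((q + N : ℕ) : ℝ)) ^ n *
                (|D| * f (ψ (q + N) / (q + N : ℕ))) :=
              mul_le_mul h3 h4 (hf_pos _ (mul_pos two_pos (hN₁ (q + N) (by omega)).1.1)).le
                (by positivity)
            _ = _ := by rw [hK, mul_pow]; ring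
      _ = ENNReal.ofReal (K * ∑' q, ((q + N : ℕ) : ℝ) ^ n * f (ψ (q + N) / (q + N : ℕ))) := by
          rw [← tsum_mul_left, ENNReal.ofReal_tsum_of_nonneg
            (fun q => mul_nonneg (by positivity) (hnn q))
            (((summable_nat_add_iff N).2 hsum).mul_left K)]
      _ ≤ ε := by
          rw [← ENNReal.ofReal_coe_nnreal]
          exact ENNReal.ofReal_le_ofReal hNε.le

lemma unitCube_ae_eq (n : ℕ) :
    (Set.univ.pi fun _ : Fin n => Ioo (0 : ℝ) 1) =ᵐ[volume] unitCube n := by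
  have h := Measure.univ_pi_Ioo_ae_eq_Icc (μ := fun _ : Fin n => (volume : Measure ℝ))
    (f := fun _ => 0) (g := fun _ => 1)
  rwa [← Set.pi_univ_Icc] at h

lemma tendsto_two_mul_nhdsGT :
    Tendsto (fun r : ℝ => 2 * r) (nhdsWithin 0 (Ioi 0)) (nhdsWithin 0 (Ioi 0)) := by
  refine tendsto_nhdsWithin_iff.2 ⟨?_, ?_⟩
  · have : Tendsto (fun r : ℝ => 2 * r) (nhds 0) (nhds (2 * 0)) :=
      (continuous_const.mul continuous_id).tendsto 0
    rw [mul_zero] at this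
    exact this.mono_left nhdsWithin_le_nhds
  · filter_upwards [self_mem_nhdsWithin] with r hr
    exact mul_pos two_pos (mem_Ioi.1 hr)

/-- The divergence half when `f` is comparable to `r ↦ r ^ n`. -/
lemma hausdorffWith_Wgamma_eq_of_comparable {n : ℕ} (hn : 0 < n) {ψ : ℕ → ℝ}
    (hψpos : ∀ q, 0 < ψ q) (hψanti : Antitone ψ) (hψ0 : Tendsto ψ atTop (nhds 0))
    {γ : (Fin n → ℤ) × ℕ → Fin n → ℝ}
    {f : ℝ → ℝ} (hmono : MonotoneOn f (Ioi 0)) (hf_pos : ∀ r > (0 : ℝ), 0 < f r)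
    {K : ℝ} (hK : 0 < K) (hfK : ∀ᶠ r in nhdsWithin 0 (Ioi 0), f r ≤ K * r ^ n) {C : ℝ}
    (hkick : ∀ᶠ q : ℕ in atTop, ∀ p : Fin n → ℤ, 1 ≤ ‖p‖ → ‖p‖ ≤ (q : ℝ) →
      ‖γ (p, q)‖ ≤ C * ((q : ℝ) * f (ψ q / q) ^ ((1 : ℝ) / n)))
    (hdiv : ¬ Summable (fun q : ℕ => (q : ℝ) ^ n * f (ψ q / q))) :
    hausdorffWith f (Wgamma n ψ γ) = hausdorffWith f (unitCube n) := by
  have hρ := tendsto_div_nat_nhdsGT hψpos hψ0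
  have hfρ := hρ.eventually hfK
  let ρ : ℕ → ℝ := fun q => ψ q / max (q : ℝ) 1
  have hρq : ∀ q : ℕ, 0 < q → ρ q = ψ q / q := fun q hq => by
    simp only [ρ]
    rw [max_eq_left (by exact_mod_cast hq)]
  have hev : ∀ᶠ q : ℕ in atTop, 0 < q ∧ ρ q = ψ q / q := by
    filter_upwards [eventually_gt_atTop 0] with q hq using ⟨hq, hρq q hq⟩
  have hρ0 : ∀ q, 0 < ρ q := fun q => div_pos (hψpos q) (by positivity)
  have hae := ae_exists_perturbed_near hn (ρ := ρ) hρ0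
    (fun a b _ hab => div_le_div₀ (hψpos a).le (hψanti hab) (by positivity)
      (max_le_max (by exact_mod_cast hab) le_rfl))
    ((hρ.mono_right nhdsWithin_le_nhds).congr' (hev.mono fun q hq => hq.2.symm))
    (fun hsum => hdiv (by
      refine Summable.of_norm_bounded_eventually_nat (hsum.mul_left K) ?_
      filter_upwards [hev, hfρ] with q hq hfq
      have hf := hf_pos _ (hq.2 ▸ hρ0 q)
      rw [Real.norm_of_nonneg (by positivity), hq.2]
      have h1 : (0 : ℝ) ≤ (q : ℝ) ^ n := by positivity
      nlinarith))
    (y := fun p q i => ((p i : ℝ) - γ (p, q) i) / q) (C := |C| * K ^ ((1 : ℝ) / n)) (by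
      filter_upwards [hev, hfρ, hkick] with q hq hfq hkq p hp1 hp2
      have hq' : (0 : ℝ) < q := by exact_mod_cast hq.1
      have hρq0 : 0 < ψ q / q := hq.2 ▸ hρ0 q
      have hf := hf_pos _ hρq0
      rw [dist_rational_perturbed, div_le_iff₀ hq', hq.2]
      refine (hkq p hp1 hp2).trans ?_
      have h1 : f (ψ q / q) ^ ((1 : ℝ) / n) ≤ K ^ ((1 : ℝ) / n) * (ψ q / q) := by
        calc f (ψ q / q) ^ ((1 : ℝ) / n) ≤ (K * (ψ q / q) ^ n) ^ ((1 : ℝ) / n) :=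
              Real.rpow_le_rpow hf.le hfq (by positivity)
          _ = _ := by
              rw [Real.mul_rpow hK.le (by positivity), one_div,
                Real.pow_rpow_inv_natCast hρq0.le hn.ne']
      have h2 : 0 ≤ f (ψ q / q) ^ ((1 : ℝ) / n) := by positivity
      calc C * (q * f (ψ q / q) ^ ((1 : ℝ) / n)) ≤ |C| * (q * f (ψ q / q) ^ ((1 : ℝ) / n)) :=
            mul_le_mul_of_nonneg_right (le_abs_self C) (by positivity)
        _ ≤ |C| * (q * (K ^ ((1 : ℝ) / n) * (ψ q / q))) := by gcongr
        _ = _ := by ring)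
  have hvol : volume (unitCube n \ Wgamma n ψ γ) = 0 := by
    rw [measure_eq_zero_iff_ae_notMem]
    filter_upwards [hae, (unitCube_ae_eq n).mem_iff] with x hx hxU hxW
    have hxI := hxU.2 hxW.1
    refine hxW.2 (mem_Wgamma_of_infinite hxI fun N => ?_)
    obtain ⟨q, hq, p, hp⟩ := hx hxI (N + 1)
    rw [hρq q (by omega)] at hp
    exact ⟨q, by omega, by omega, p, hp⟩
  have hzero : hausdorffWith f (unitCube n \ Wgamma n ψ γ) = 0 := by
    have h := hausdorffWith_le_mul_volume hn hmono hK hfK (unitCube n \ Wgamma n ψ γ)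
    rwa [hvol, mul_zero, nonpos_iff_eq_zero] at h
  refine le_antisymm (measure_mono fun x hx => hx.1) ?_
  calc hausdorffWith f (unitCube n)
      ≤ hausdorffWith f (Wgamma n ψ γ) + hausdorffWith f (unitCube n \ Wgamma n ψ γ) := by
        refine (measure_mono fun x hx => ?_).trans (measure_union_le _ _)
        by_cases h : x ∈ Wgamma n ψ γ
        · exact Or.inl h
        · exact Or.inr ⟨hx, h⟩
    _ = _ := by rw [hzero, add_zero]

/-- The divergence half when `f` is much larger than `r ↦ r ^ n`. -/
lemma hausdorffWith_Wgamma_eq_top {n : ℕ} (hn : 0 < n) {ψ : ℕ → ℝ}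
    (hψpos : ∀ q, 0 < ψ q) (hψanti : Antitone ψ) (hψ0 : Tendsto ψ atTop (nhds 0))
    {γ : (Fin n → ℤ) × ℕ → Fin n → ℝ}
    {f : ℝ → ℝ} (hmono : MonotoneOn f (Ioi 0)) (hf_pos : ∀ r > (0 : ℝ), 0 < f r)
    (hf0 : Tendsto f (nhdsWithin 0 (Ioi 0)) (nhds 0))
    (hanti : ∀ a b, 0 < a → a ≤ b → f b * a ^ n ≤ f a * b ^ n)
    (hlarge : ∀ K : ℝ, ∀ᶠ r in nhdsWithin 0 (Ioi 0), K * r ^ n ≤ f r) {C : ℝ}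
    (hkick : ∀ᶠ q : ℕ in atTop, ∀ p : Fin n → ℤ, 1 ≤ ‖p‖ → ‖p‖ ≤ (q : ℝ) →
      ‖γ (p, q)‖ ≤ C * ((q : ℝ) * f (ψ q / q) ^ ((1 : ℝ) / n)))
    (hdiv : ¬ Summable (fun q : ℕ => (q : ℝ) ^ n * f (ψ q / q))) :
    hausdorffWith f (Wgamma n ψ γ) = ⊤ := by
  have hρ := tendsto_div_nat_nhdsGT hψpos hψ0
  have hdivpos : ∀ q : ℕ, 0 < ψ q / max (q : ℝ) 1 := fun q => div_pos (hψpos q) (by positivity)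
  let σ : ℕ → ℝ := fun q => f (ψ q / max (q : ℝ) 1) ^ ((1 : ℝ) / n)
  have hσq : ∀ q : ℕ, 0 < q → σ q = f (ψ q / q) ^ ((1 : ℝ) / n) := fun q hq => by
    simp only [σ]
    rw [max_eq_left (by exact_mod_cast hq)]
  have hσn : ∀ q : ℕ, σ q ^ n = f (ψ q / max (q : ℝ) 1) := fun q => by
    simp only [σ]
    rw [one_div, Real.rpow_inv_natCast_pow (hf_pos _ (hdivpos q)).le hn.ne']
  have hσ0 : ∀ q, 0 < σ q := fun q => Real.rpow_pos_of_pos (hf_pos _ (hdivpos q)) _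
  have hσlim : Tendsto σ atTop (nhds 0) := by
    have h1 : Tendsto (fun q : ℕ => f (ψ q / q) ^ ((1 : ℝ) / n)) atTop (nhds 0) := by
      have := (hf0.comp hρ).rpow_const (p := (1 : ℝ) / n) (Or.inr (by positivity))
      rwa [Real.zero_rpow (by positivity)] at this
    refine h1.congr' ?_
    filter_upwards [eventually_gt_atTop 0] with q hq using (hσq q hq).symm
  have hae := ae_exists_perturbed_near hn (ρ := σ) hσ0
    (fun a b _ hab => Real.rpow_le_rpow (hf_pos _ (hdivpos b)).le
      (hmono (hdivpos b) (hdivpos a) (div_le_div₀ (hψpos a).le (hψanti hab) (by positivity)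
        (max_le_max (by exact_mod_cast hab) le_rfl))) (by positivity)) hσlim
    (fun hsum => hdiv (hsum.congr fun q => by
      rcases Nat.eq_zero_or_pos q with rfl | hq
      · simp [hn.ne']
      · rw [hσn, max_eq_left (by exact_mod_cast hq)]))
    (y := fun p q i => ((p i : ℝ) - γ (p, q) i) / q) (C := C) (by
      filter_upwards [eventually_gt_atTop 0, hkick] with q hq hkq p hp1 hp2
      have hq' : (0 : ℝ) < q := by exact_mod_cast hq
      rw [dist_rational_perturbed, div_le_iff₀ hq', hσq q hq]
      exact (hkq p hp1 hp2).trans (le_of_eq (by ring)))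
  have : Nonempty {pq : (Fin n → ℤ) × ℕ // 0 < pq.2} := ⟨⟨(0, 1), one_pos⟩⟩
  have hpos : ∀ i : {pq : (Fin n → ℤ) × ℕ // 0 < pq.2}, 0 < ψ i.1.2 / (i.1.2 : ℝ) := fun i =>
    div_pos (hψpos _) (by exact_mod_cast i.2)
  refine hausdorffWith_eq_top hn hmono hf_pos hf0 hanti hlarge
    (ι := {pq : (Fin n → ℤ) × ℕ // 0 < pq.2})
    (y := fun i k => ((i.1.1 k : ℝ) - γ (i.1.1, i.1.2) k) / i.1.2) (r := fun i => ψ i.1.2 / i.1.2)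
    (s := fun i => σ i.1.2) hpos (fun i => hσ0 _) (fun i => ?_)
    (z := fun _ => 1 / 2) (R := 1 / 2) (by norm_num) ?_ ?_
  · rw [hσn, max_eq_left (by exact_mod_cast i.2)]
  · rw [ball_half_half]
    filter_upwards [hae] with x hx hxU ε hε
    have h1 : ∀ᶠ q : ℕ in atTop, 0 < q ∧ σ q ≤ ε ∧ ψ q / q ≤ ε * σ q := by
      filter_upwards [eventually_gt_atTop 0, hσlim.eventually (gt_mem_nhds hε),
        hρ.eventually (hlarge (1 / ε ^ n))] with q hq h1 h2
      refine ⟨hq, h1.le, ?_⟩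
      have h3 := hσ0 q
      refine le_of_pow_le_pow_left₀ hn.ne' (by positivity) ?_
      rw [mul_pow, hσn, max_eq_left (by exact_mod_cast hq)]
      rwa [div_mul_eq_mul_div, one_mul, div_le_iff₀ (by positivity), mul_comm] at h2
    obtain ⟨N, hN⟩ := eventually_atTop.1 h1
    obtain ⟨q, hq, p, hp⟩ := hx hxU N
    obtain ⟨hq0, h2, h3⟩ := hN q hq
    exact ⟨⟨(p, q), hq0⟩, h2, h3, ball_subset_closedBall hp⟩
  · intro x hx hinf
    rw [ball_half_half] at hx
    refine ⟨fun i hi => Ioo_subset_Icc_self (hx i hi), ?_⟩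
    refine (hinf.image (Subtype.val_injective.injOn)).mono ?_
    rintro _ ⟨⟨⟨p, q⟩, hq⟩, hpq, rfl⟩
    exact ⟨hq, (mem_ball_perturbed_iff hq _ _ _ _).1 hpq⟩

/-- Both halves when `f` is bounded above and below by multiples of `r ↦ r ^ n`. -/
lemma hausdorffWith_Wgamma_of_comparable {n : ℕ} (hn : 0 < n) {ψ : ℕ → ℝ}
    (hψpos : ∀ q, 0 < ψ q) (hψanti : Antitone ψ) (hψ0 : Tendsto ψ atTop (nhds 0))
    {γ : (Fin n → ℤ) × ℕ → Fin n → ℝ} (hγ : ∀ pq i, γ pq i ∈ Set.Icc (-(1 / 2) : ℝ) (1 / 2))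
    {f : ℝ → ℝ} (hmono : MonotoneOn f (Ioi 0)) (hf_pos : ∀ r > (0 : ℝ), 0 < f r)
    {k K : ℝ} (hk : 0 < k) (hK : 0 < K) (hfk : ∀ᶠ r in nhdsWithin 0 (Ioi 0), k * r ^ n ≤ f r)
    (hfK : ∀ᶠ r in nhdsWithin 0 (Ioi 0), f r ≤ K * r ^ n) {C : ℝ}
    (hkick : ∀ᶠ q : ℕ in atTop, ∀ p : Fin n → ℤ, 1 ≤ ‖p‖ → ‖p‖ ≤ (q : ℝ) →
      ‖γ (p, q)‖ ≤ C * ((q : ℝ) * f (ψ q / q) ^ ((1 : ℝ) / n))) :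
    (Summable (fun q : ℕ => (q : ℝ) ^ n * f (ψ q / q)) →
        hausdorffWith f (Wgamma n ψ γ) = 0) ∧
    (¬ Summable (fun q : ℕ => (q : ℝ) ^ n * f (ψ q / q)) →
        hausdorffWith f (Wgamma n ψ γ) = hausdorffWith f (unitCube n)) := by
  refine ⟨hausdorffWith_Wgamma_eq_zero hn hψpos hψanti hψ0 hγ hmono hf_pos
    (D := K * 2 ^ n / k) ?_,
    hausdorffWith_Wgamma_eq_of_comparable hn hψpos hψanti hψ0 hmono hf_pos hK hfK hkick⟩
  filter_upwards [hfk, tendsto_two_mul_nhdsGT.eventually hfK] with r h1 h2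
  rw [div_mul_eq_mul_div, le_div_iff₀ hk]
  rw [mul_pow] at h2
  have : 0 ≤ K * 2 ^ n := by positivity
  nlinarith [mul_le_mul_of_nonneg_left h1 this, mul_le_mul_of_nonneg_right h2 hk.le]

theorem stmt3 (n : ℕ) (hn : 0 < n) (ψ : ℕ → ℝ) (hψpos : ∀ q, 0 < ψ q)
    (hψanti : Antitone ψ) (hψ0 : Tendsto ψ atTop (nhds 0))
    (γ : (Fin n → ℤ) × ℕ → Fin n → ℝ)
    (hγbox : ∀ pq i, γ pq i ∈ Set.Icc (-(1 / 2) : ℝ) (1 / 2))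
    (hγ0 : Tendsto (fun q : ℕ => ⨆ p : Fin n → ℤ, ‖γ (p, q)‖) atTop (nhds 0))
    (f : ℝ → ℝ) (hf_cont : ContinuousOn f (Set.Ioi 0))
    (hf_mono : MonotoneOn f (Set.Ioi 0)) (hf_pos : ∀ r > (0 : ℝ), 0 < f r)
    (hf0 : Tendsto f (nhdsWithin 0 (Set.Ioi 0)) (nhds 0))
    (hreg : MonotoneOn (fun r => r ^ (-(n : ℝ)) * f r) (Set.Ioi 0) ∨
      AntitoneOn (fun r => r ^ (-(n : ℝ)) * f r) (Set.Ioi 0))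
    (hkick : ∃ C : ℝ, ∀ᶠ q : ℕ in atTop, ∀ p : Fin n → ℤ,
      1 ≤ ‖p‖ → ‖p‖ ≤ (q : ℝ) →
        ‖γ (p, q)‖ ≤ C * ((q : ℝ) * f (ψ q / q) ^ ((1 : ℝ) / n))) :
    (Summable (fun q : ℕ => (q : ℝ) ^ n * f (ψ q / q)) →
        hausdorffWith f (Wgamma n ψ γ) = 0) ∧
    (¬ Summable (fun q : ℕ => (q : ℝ) ^ n * f (ψ q / q)) →
        hausdorffWith f (Wgamma n ψ γ) = hausdorffWith f (unitCube n)) := by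
  obtain ⟨C, hkick⟩ := hkick
  have hg : ∀ r : ℝ, 0 < r → r ^ (-(n : ℝ)) * f r = f r / r ^ n := fun r hr => by
    rw [Real.rpow_neg hr.le, Real.rpow_natCast, inv_mul_eq_div]
  have hsub : hausdorffWith f (Wgamma n ψ γ) ≤ hausdorffWith f (unitCube n) :=
    measure_mono fun x hx => hx.1
  have hIoc : ∀ {r₀ : ℝ}, 0 < r₀ → ∀ᶠ r in nhdsWithin 0 (Ioi 0), 0 < r ∧ r ≤ r₀ :=
    fun h => Ioc_mem_nhdsGT h
  have hf1 := hf_pos 1 one_pos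
  rcases hreg with hreg | hreg
  · have hle : ∀ a b, 0 < a → a ≤ b → f a / a ^ n ≤ f b / b ^ n := fun a b ha hab => by
      have := hreg (mem_Ioi.2 ha) (mem_Ioi.2 (ha.trans_le hab)) hab
      simpa only [hg a ha, hg b (ha.trans_le hab)] using this
    by_cases hsmall : ∀ K > 0, ∃ r > 0, f r / r ^ n < K
    · have hzero : hausdorffWith f (unitCube n) = 0 := by
        have hvol : volume (unitCube n) = 1 := by
          simp [unitCube, Real.volume_Icc_pi]
        refine le_antisymm (ENNReal.le_of_forall_pos_le_add fun K hK _ => ?_) zero_le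
        obtain ⟨r₀, hr₀, h⟩ := hsmall K (by exact_mod_cast hK)
        have := hausdorffWith_le_mul_volume hn hf_mono (NNReal.coe_pos.2 hK) (f := f) (by
          filter_upwards [hIoc hr₀] with r hr
          have hr0 := hr.1
          exact (div_le_iff₀ (by positivity)).1 ((hle r r₀ hr.1 hr.2).trans h.le)) (unitCube n)
        simpa [hvol] using this
      have hW : hausdorffWith f (Wgamma n ψ γ) = 0 := by
        rwa [hzero, nonpos_iff_eq_zero] at hsub
      exact ⟨fun _ => hW, fun _ => hW.trans hzero.symm⟩
    · push Not at hsmall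
      obtain ⟨k, hk, hsmall⟩ := hsmall
      refine hausdorffWith_Wgamma_of_comparable hn hψpos hψanti hψ0 hγbox hf_mono hf_pos
        hk hf1 ?_ ?_ hkick
      · filter_upwards [hIoc one_pos] with r hr
        have hr0 := hr.1
        exact (le_div_iff₀ (by positivity)).1 (hsmall r hr.1)
      · filter_upwards [hIoc one_pos] with r hr
        have hr0 := hr.1
        have := hle r 1 hr.1 hr.2
        rwa [one_pow, div_one, div_le_iff₀ (by positivity)] at this
  · have hle : ∀ a b, 0 < a → a ≤ b → f b / b ^ n ≤ f a / a ^ n := fun a b ha hab => by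
      have := hreg (mem_Ioi.2 ha) (mem_Ioi.2 (ha.trans_le hab)) hab
      simpa only [hg a ha, hg b (ha.trans_le hab)] using this
    by_cases hlarge : ∀ K > 0, ∃ r > 0, K < f r / r ^ n
    · have hanti : ∀ a b, 0 < a → a ≤ b → f b * a ^ n ≤ f a * b ^ n := fun a b ha hab => by
        have hb := ha.trans_le hab
        exact (div_le_div_iff₀ (by positivity) (by positivity)).1 (hle a b ha hab)
      refine ⟨hausdorffWith_Wgamma_eq_zero hn hψpos hψanti hψ0 hγbox hf_mono hf_pos
        (D := 2 ^ n) ?_, fun hdiv => ?_⟩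
      · filter_upwards [self_mem_nhdsWithin] with r hr
        have hr0 : 0 < r := hr
        have := hanti r (2 * r) hr0 (by linarith)
        rw [mul_pow, ← mul_assoc] at this
        rw [mul_comm (2 ^ n)]
        exact le_of_mul_le_mul_right this (pow_pos hr0 n)
      · have htop := hausdorffWith_Wgamma_eq_top hn hψpos hψanti hψ0 hf_mono hf_pos hf0 hanti
          (fun K => by
            obtain ⟨r₀, hr₀, h⟩ := hlarge (max K 1) (by positivity)
            filter_upwards [hIoc hr₀] with r hr
            have hr0 := hr.1
            exact (le_div_iff₀ (by positivity)).1
              ((le_max_left K 1).trans (h.le.trans (hle r r₀ hr.1 hr.2)))) hkick hdiv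
        rw [htop] at hsub ⊢
        exact (top_le_iff.1 hsub).symm
    · push Not at hlarge
      obtain ⟨K, hK, hlarge⟩ := hlarge
      refine hausdorffWith_Wgamma_of_comparable hn hψpos hψanti hψ0 hγbox hf_mono hf_pos
        hf1 hK ?_ ?_ hkick
      · filter_upwards [hIoc one_pos] with r hr
        have hr0 := hr.1
        have := hle r 1 hr.1 hr.2
        rwa [one_pow, div_one, le_div_iff₀ (by positivity)] at this
      · filter_upwards [hIoc one_pos] with r hr
        have hr0 := hr.1
        exact (div_le_iff₀ (by positivity)).1 (hlarge r hr.1)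
end

section
/- Let ψ(q) = q^{-τ_ψ} for some τ_ψ ≥ 1/n and let γ: ℤ^n × ℕ → [-1/2,1/2]^n. Suppose limsup_{q→∞} ( max_{1 ≤ ‖p‖ ≤ q} ‖γ(p,q)‖ ) / q^{-1/n} < ∞. Then dim_H W_n^γ(ψ) = (n+1)/(1+τ_ψ). -/
open MeasureTheory Filter Set

/-- The perturbed rational point `(p - γ(p,q)) / q`. -/
noncomputable def perturbedRat {n : ℕ} (γ : (Fin n → ℤ) × ℕ → Fin n → ℝ)
    (pq : (Fin n → ℤ) × ℕ) : Fin n → ℝ :=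
  (pq.2 : ℝ)⁻¹ • ((fun i => (pq.1 i : ℝ)) - γ pq)

lemma norm_eq_mul_dist_perturbedRat {n : ℕ} (γ : (Fin n → ℤ) × ℕ → Fin n → ℝ)
    (pq : (Fin n → ℤ) × ℕ) (hq : 0 < pq.2) (x : Fin n → ℝ) :
    ‖(pq.2 : ℝ) • x - (fun i => (pq.1 i : ℝ)) + γ pq‖ =
      pq.2 * dist x (perturbedRat γ pq) := by
  have hq' : (0 : ℝ) < pq.2 := by exact_mod_cast hq
  rw [dist_eq_norm, ← Real.norm_of_nonneg hq'.le, ← norm_smul, Real.norm_of_nonneg hq'.le]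
  congr 1
  rw [perturbedRat, smul_sub, smul_smul, mul_inv_cancel₀ hq'.ne', one_smul]
  abel

lemma dist_perturbedRat_le {n : ℕ} {τ : ℝ} {γ : (Fin n → ℤ) × ℕ → Fin n → ℝ}
    {pq : (Fin n → ℤ) × ℕ} (hq : 0 < pq.2) {x : Fin n → ℝ}
    (hx : ‖(pq.2 : ℝ) • x - (fun i => (pq.1 i : ℝ)) + γ pq‖ < (pq.2 : ℝ) ^ (-τ)) :
    dist x (perturbedRat γ pq) ≤ (pq.2 : ℝ) ^ (-(1 + τ)) := by
  have hq' : (0 : ℝ) < pq.2 := by exact_mod_cast hq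
  rw [norm_eq_mul_dist_perturbedRat γ pq hq] at hx
  rw [show -(1 + τ) = -τ - 1 by ring, Real.rpow_sub_one hq'.ne', le_div_iff₀ hq']
  linarith

/-- Only numerators of size `O(q)` matter for points of the unit cube. -/
lemma abs_numerator_lt {n : ℕ} {τ : ℝ} (hτ : 0 ≤ τ) {γ : (Fin n → ℤ) × ℕ → Fin n → ℝ}
    (hγbox : ∀ pq i, γ pq i ∈ Set.Icc (-(1 / 2) : ℝ) (1 / 2))
    {pq : (Fin n → ℤ) × ℕ} (hq : 0 < pq.2) {x : Fin n → ℝ} (hx1 : x ∈ unitCube n)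
    (hx : ‖(pq.2 : ℝ) • x - (fun i => (pq.1 i : ℝ)) + γ pq‖ < (pq.2 : ℝ) ^ (-τ)) (i : Fin n) :
    -((pq.2 : ℤ) + 2) < pq.1 i ∧ pq.1 i < (pq.2 : ℤ) + 2 := by
  have hq' : (1 : ℝ) ≤ pq.2 := by exact_mod_cast hq
  have h1 : (pq.2 : ℝ) ^ (-τ) ≤ 1 := Real.rpow_le_one_of_one_le_of_nonpos hq' (by linarith)
  have h2 := (norm_le_pi_norm _ i).trans (hx.le.trans h1)
  simp only [Pi.add_apply, Pi.sub_apply, Pi.smul_apply, smul_eq_mul, Real.norm_eq_abs,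
    abs_le] at h2
  have h3 := hx1 i (Set.mem_univ i)
  have h4 := hγbox pq i
  rw [Set.mem_Icc] at h3 h4
  have h5 : (pq.2 : ℝ) * x i ≤ pq.2 := mul_le_of_le_one_right (by linarith) h3.2
  have h6 : 0 ≤ (pq.2 : ℝ) * x i := mul_nonneg (by linarith) h3.1
  constructor
  · have : -((pq.2 : ℝ) + 2) < pq.1 i := by linarith [h2.2, h4.1]
    exact_mod_cast this
  · have : (pq.1 i : ℝ) < pq.2 + 2 := by linarith [h2.1, h4.2]
    exact_mod_cast this

/-- A point of `W_n^γ(ψ)` is approximated with arbitrarily large denominators. -/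
lemma exists_large_denominator {n : ℕ} {τ : ℝ} (hτ : 0 ≤ τ) {γ : (Fin n → ℤ) × ℕ → Fin n → ℝ}
    (hγbox : ∀ pq i, γ pq i ∈ Set.Icc (-(1 / 2) : ℝ) (1 / 2)) {x : Fin n → ℝ}
    (hx : x ∈ Wgamma n (fun q => (q : ℝ) ^ (-τ)) γ) (N : ℕ) :
    ∃ pq : (Fin n → ℤ) × ℕ, N < pq.2 ∧
      ‖(pq.2 : ℝ) • x - (fun i => (pq.1 i : ℝ)) + γ pq‖ < (pq.2 : ℝ) ^ (-τ) := by
  by_contra! hcon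
  refine hx.2 (((Set.finite_Icc (fun _ : Fin n => -((N : ℤ) + 2)) (fun _ => (N : ℤ) + 2)).prod
    (Set.finite_Iic N)).subset ?_)
  rintro pq ⟨hq, hpq⟩
  have hqN : pq.2 ≤ N := by
    by_contra! h
    exact absurd hpq (not_lt.2 (hcon pq h))
  have h := abs_numerator_lt hτ hγbox hq hx.1 hpq
  refine ⟨⟨fun i => ?_, fun i => ?_⟩, hqN⟩
  · have := (h i).1
    simp only
    omega
  · have := (h i).2
    simp only
    omega

lemma ediam_closedBall_rpow_le {X : Type*} [PseudoMetricSpace X] (x : X) {r d : ℝ}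
    (hr : 0 ≤ r) (hd : 0 ≤ d) :
    Metric.ediam (Metric.closedBall x r) ^ d ≤ ENNReal.ofReal ((2 * r) ^ d) := by
  rw [← ENNReal.ofReal_rpow_of_nonneg (by positivity) hd]
  refine ENNReal.rpow_le_rpow ?_ hd
  rw [← Metric.closedEBall_ofReal hr]
  refine Metric.ediam_closedEBall_le.trans ?_
  rw [ENNReal.ofReal_mul zero_le_two, ENNReal.ofReal_ofNat]

theorem dimH_Wgamma_le {n : ℕ} {τ : ℝ} (hτ : 0 ≤ τ) {γ : (Fin n → ℤ) × ℕ → Fin n → ℝ}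
    (hγbox : ∀ pq i, γ pq i ∈ Set.Icc (-(1 / 2) : ℝ) (1 / 2)) :
    dimH (Wgamma n (fun q => (q : ℝ) ^ (-τ)) γ) ≤
      ENNReal.ofReal (((n : ℝ) + 1) / (1 + τ)) := by
  refine le_of_forall_gt_imp_ge_of_dense fun a ha => ?_
  obtain ⟨d, hd, hda⟩ := ENNReal.lt_iff_exists_nnreal_btwn.1 ha
  refine le_trans ?_ hda.le
  have hτ1 : 0 < 1 + τ := by linarith
  have hd' : ((n : ℝ) + 1) / (1 + τ) < d := by
    rw [← ENNReal.ofReal_coe_nnreal, ENNReal.ofReal_lt_ofReal_iff_of_nonneg (by positivity)] at hd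
    exact hd
  rw [div_lt_iff₀ hτ1] at hd'
  have hd0 : (0 : ℝ) ≤ d := d.2
  apply dimH_le_of_hausdorffMeasure_ne_top
  set g : ℕ → ℝ := fun q => 7 ^ n * 2 ^ (d : ℝ) * (q : ℝ) ^ ((n : ℝ) - (1 + τ) * d) with hg
  have hgsum : Summable g := by
    refine Summable.mul_left _ (Real.summable_nat_rpow.2 ?_)
    linarith
  let f : ℕ → ENNReal := fun q => ENNReal.ofReal (g q)
  have hf : ∑' q, f q ≠ ⊤ := hgsum.tsum_ofReal_ne_top
  have hlim : Tendsto (fun N : ℕ => ∑' k, f (k + (N + 1))) atTop (nhds 0) :=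
    (ENNReal.tendsto_sum_nat_add f hf).comp (tendsto_add_atTop_nat 1)
  let ι : ℕ → Type := fun N => Σ k : ℕ, (Fin n → Fin (2 * (k + (N + 1)) + 5))
  let P : (N : ℕ) → ι N → (Fin n → ℤ) × ℕ := fun N i =>
    (fun m => ((i.2 m : ℕ) : ℤ) - (((i.1 + (N + 1) : ℕ) : ℤ) + 2), i.1 + (N + 1))
  let t : (N : ℕ) → ι N → Set (Fin n → ℝ) := fun N i =>
    Metric.closedBall (perturbedRat γ (P N i)) (((i.1 + (N + 1) : ℕ) : ℝ) ^ (-(1 + τ)))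
  have hle : μH[(d : ℝ)] (Wgamma n (fun q => (q : ℝ) ^ (-τ)) γ) ≤
      liminf (fun N => ∑' i, Metric.ediam (t N i) ^ (d : ℝ)) atTop := by
    refine Measure.hausdorffMeasure_le_liminf_tsum (ι := ι) d _
      (fun N => ENNReal.ofReal (2 * ((N : ℝ) + 1) ^ (-(1 + τ)))) ?_ t ?_ ?_
    · rw [← ENNReal.ofReal_zero, ← mul_zero (2 : ℝ)]
      refine ENNReal.tendsto_ofReal (Tendsto.const_mul _ ?_)
      exact (tendsto_rpow_neg_atTop hτ1).comp
        (tendsto_atTop_add_const_right _ _ tendsto_natCast_atTop_atTop)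
    · refine Eventually.of_forall fun N i => ?_
      have h := ediam_closedBall_rpow_le (perturbedRat γ (P N i)) (d := 1)
        (r := ((i.1 + (N + 1) : ℕ) : ℝ) ^ (-(1 + τ))) (by positivity) zero_le_one
      rw [ENNReal.rpow_one, Real.rpow_one] at h
      refine h.trans (ENNReal.ofReal_le_ofReal ?_)
      gcongr ?_ * ?_
      refine Real.rpow_le_rpow_of_nonpos (by positivity) ?_ (by linarith)
      push_cast
      linarith [(Nat.cast_nonneg i.1 : (0 : ℝ) ≤ i.1)]
    · refine Eventually.of_forall fun N x hx => ?_
      obtain ⟨⟨p, q⟩, hqN, hpq⟩ := exists_large_denominator hτ hγbox hx N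
      simp only at hqN hpq
      have hq0 : 0 < q := by omega
      have hp := abs_numerator_lt (pq := (p, q)) hτ hγbox hq0 hx.1 hpq
      simp only at hp
      obtain ⟨k, rfl⟩ : ∃ k, q = k + (N + 1) := ⟨q - (N + 1), by omega⟩
      have hp' : ∀ m, (p m + (((k + (N + 1) : ℕ) : ℤ) + 2)).toNat < 2 * (k + (N + 1)) + 5 := by
        intro m
        have := hp m
        omega
      let i : ι N := ⟨k, fun m => ⟨_, hp' m⟩⟩
      have hPi : P N i = (p, k + (N + 1)) := by
        refine Prod.ext (funext fun m => ?_) rfl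
        have := hp m
        simp only [P, i]
        omega
      refine Set.mem_iUnion.2 ⟨i, ?_⟩
      have := dist_perturbedRat_le (pq := (p, k + (N + 1))) hq0 hpq
      simp only [t, hPi, Metric.mem_closedBall]
      exact this
  refine ne_top_of_le_ne_top ENNReal.zero_ne_top (hle.trans ?_)
  rw [← hlim.liminf_eq]
  refine liminf_le_liminf (Eventually.of_forall fun N => ?_)
  refine (ENNReal.tsum_sigma' fun i : ι N => Metric.ediam (t N i) ^ (d : ℝ)).trans_le ?_
  refine ENNReal.tsum_le_tsum fun k => ?_
  set q : ℕ := k + (N + 1) with hq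
  have hq1 : (1 : ℝ) ≤ q := by
    have : 1 ≤ q := by omega
    exact_mod_cast this
  have hq0 : (0 : ℝ) < q := by linarith
  calc ∑' j : Fin n → Fin (2 * (k + (N + 1)) + 5), Metric.ediam (t N ⟨k, j⟩) ^ (d : ℝ)
      ≤ ∑' j : Fin n → Fin (2 * (k + (N + 1)) + 5),
          ENNReal.ofReal ((2 * (q : ℝ) ^ (-(1 + τ))) ^ (d : ℝ)) :=
        ENNReal.tsum_le_tsum fun j => ediam_closedBall_rpow_le _ (by positivity) hd0
    _ = ENNReal.ofReal (((2 * q + 5 : ℕ) : ℝ) ^ n * (2 * (q : ℝ) ^ (-(1 + τ))) ^ (d : ℝ)) := by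
        rw [tsum_fintype, Finset.sum_const, Finset.card_univ, Fintype.card_fun, Fintype.card_fin,
          Fintype.card_fin, nsmul_eq_mul, ENNReal.ofReal_mul (by positivity)]
        congr 1
        rw [ENNReal.ofReal_pow (by positivity), ENNReal.ofReal_natCast]
        exact Nat.cast_pow _ _
    _ ≤ f q := by
        refine ENNReal.ofReal_le_ofReal ?_
        rw [Real.mul_rpow zero_le_two (by positivity), ← Real.rpow_mul hq0.le, hg]
        simp only
        rw [show (n : ℝ) - (1 + τ) * d = n + -(1 + τ) * d by ring, Real.rpow_add hq0,
          Real.rpow_natCast]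
        have h7 : ((2 * q + 5 : ℕ) : ℝ) ^ n ≤ 7 ^ n * (q : ℝ) ^ n := by
          rw [← mul_pow]
          refine pow_le_pow_left₀ (by positivity) ?_ n
          push_cast
          linarith
        calc _ ≤ (7 ^ n * (q : ℝ) ^ n) * (2 ^ (d : ℝ) * (q : ℝ) ^ (-(1 + τ) * (d : ℝ))) := by
              gcongr
          _ = _ := by ring

/-- A volume bound for the number of separated points in a ball. -/
lemma card_mul_pow_le_of_separated {n : ℕ} {T : Finset (Fin n → ℝ)} {s R : ℝ} {x : Fin n → ℝ}
    (hs : 0 < s) (hR : 0 ≤ R) (hsep : ∀ a ∈ T, ∀ b ∈ T, a ≠ b → s < dist a b)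
    (hT : ∀ a ∈ T, dist a x ≤ R) : (T.card : ℝ) * s ^ n ≤ (2 * R + s) ^ n := by
  have hdisj : (T : Set (Fin n → ℝ)).PairwiseDisjoint fun a => Metric.ball a (s / 2) := by
    intro a ha b hb hab
    exact Metric.ball_disjoint_ball (by linarith [hsep a ha b hb hab])
  have hsub : ⋃ a ∈ T, Metric.ball a (s / 2) ⊆ Metric.closedBall x (R + s / 2) := by
    refine Set.iUnion₂_subset fun a ha y hy => ?_
    rw [Metric.mem_ball] at hy
    rw [Metric.mem_closedBall]
    linarith [dist_triangle y a x, hT a ha]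
  have h := measure_mono (μ := volume) hsub
  rw [measure_biUnion_finset hdisj fun a _ => measurableSet_ball,
    Real.volume_pi_closedBall _ (by positivity)] at h
  simp only [Real.volume_pi_ball _ (half_pos hs), Finset.sum_const, Fintype.card_fin,
    nsmul_eq_mul] at h
  rw [← ENNReal.ofReal_natCast, ← ENNReal.ofReal_mul (by positivity),
    ENNReal.ofReal_le_ofReal_iff (by positivity)] at h
  convert h using 2 <;> ring

/-- The balls of radius `ρ` around `F` are disjoint, and no ball of radius `r ≥ ρ` meets more than
a proportion `A * r ^ t` of them, with an additional saving `η` at the scale `r = ρ`. -/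
structure WellDistributed {n : ℕ} (t A η : ℝ) (F : Finset (Fin n → ℝ)) (ρ : ℝ) : Prop where
  pos : 0 < ρ
  nonempty : F.Nonempty
  separated : ∀ a ∈ F, ∀ b ∈ F, a ≠ b → 2 * ρ < dist a b
  card_le : ∀ x r, ρ ≤ r →
    ((F.filter fun ξ => dist ξ x ≤ ρ + r).card : ℝ) ≤ A * F.card * r ^ t
  card_le_self : ∀ x, ((F.filter fun ξ => dist ξ x ≤ ρ + ρ).card : ℝ) ≤ η * A * F.card * ρ ^ t

lemma WellDistributed.biUnion {n : ℕ} {t A η c ρ₀ ρ₁ s : ℝ} {F : Finset (Fin n → ℝ)}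
    (hF : WellDistributed t A η F ρ₀) (ht0 : 0 < t) (htn : t < n) (hA : 0 < A) (hη0 : 0 < η)
    (hη1 : η ≤ 1) (hηc : η * 10 ^ n ≤ c) (hρ₁ : 0 < ρ₁) (hρ₁s : 2 * ρ₁ ≤ s)
    (hρ₁ρ₀ : 2 * ρ₁ ≤ ρ₀) (hbig : 5 ^ n * ρ₀ ^ t ≤ c * (ρ₀ / 2 / s) ^ n * ρ₁ ^ t)
    {S : (Fin n → ℝ) → Finset (Fin n → ℝ)} {N : ℕ}
    (hSball : ∀ ξ ∈ F, ∀ a ∈ S ξ, dist a ξ ≤ ρ₀ / 2)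
    (hSsep : ∀ ξ ∈ F, ∀ a ∈ S ξ, ∀ b ∈ S ξ, a ≠ b → s < dist a b)
    (hScard : ∀ ξ ∈ F, (S ξ).card = N) (hN : c * (ρ₀ / 2 / s) ^ n ≤ N) :
    WellDistributed t A η (F.biUnion S) ρ₁ := by
  have hρ₀ := hF.pos
  have hs : 0 < s := by linarith
  have hc : 0 < c := lt_of_lt_of_le (by positivity) hηc
  have hN0 : (0 : ℝ) < N := lt_of_lt_of_le (by positivity) hN
  have hdisj : (F : Set (Fin n → ℝ)).PairwiseDisjoint S := by
    intro ξ hξ ζ hζ hne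
    refine Finset.disjoint_left.2 fun a ha ha' => ?_
    have h1 := hSball ξ hξ a ha
    have h2 := hSball ζ hζ a ha'
    have h3 := hF.separated ξ hξ ζ hζ hne
    have h4 := dist_triangle_left ξ ζ a
    linarith
  have hcard : ((F.biUnion S).card : ℝ) = F.card * N := by
    rw [Finset.card_biUnion hdisj, Finset.sum_congr rfl hScard, Finset.sum_const, smul_eq_mul,
      Nat.cast_mul]
  have hFcard : (0 : ℝ) < F.card := by exact_mod_cast hF.nonempty.card_pos
  have hcount : ∀ (x : Fin n → ℝ) (r r' B : ℝ), r ≤ r' →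
      (∀ ξ ∈ F, (((S ξ).filter fun a => dist a x ≤ ρ₁ + r).card : ℝ) ≤ B) →
      (((F.biUnion S).filter fun a => dist a x ≤ ρ₁ + r).card : ℝ) ≤
        (F.filter fun ξ => dist ξ x ≤ ρ₀ + r').card * B := by
    intro x r r' B hr hB
    have hsub : ((F.biUnion S).filter fun a => dist a x ≤ ρ₁ + r) ⊆
        (F.filter fun ξ => dist ξ x ≤ ρ₀ + r').biUnion
          fun ξ => (S ξ).filter fun a => dist a x ≤ ρ₁ + r := by
      intro a ha
      obtain ⟨ha, hax⟩ := Finset.mem_filter.1 ha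
      obtain ⟨ξ, hξ, haξ⟩ := Finset.mem_biUnion.1 ha
      refine Finset.mem_biUnion.2 ⟨ξ, Finset.mem_filter.2 ⟨hξ, ?_⟩,
        Finset.mem_filter.2 ⟨haξ, hax⟩⟩
      linarith [dist_triangle_left ξ x a, hSball ξ hξ a haξ]
    calc (((F.biUnion S).filter fun a => dist a x ≤ ρ₁ + r).card : ℝ)
        ≤ ∑ ξ ∈ F.filter fun ξ => dist ξ x ≤ ρ₀ + r',
            (((S ξ).filter fun a => dist a x ≤ ρ₁ + r).card : ℝ) := by
          exact_mod_cast (Finset.card_le_card hsub).trans Finset.card_biUnion_le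
      _ ≤ ∑ ξ ∈ F.filter fun ξ => dist ξ x ≤ ρ₀ + r', B :=
          Finset.sum_le_sum fun ξ hξ => hB ξ (Finset.mem_filter.1 hξ).1
      _ = _ := by rw [Finset.sum_const, nsmul_eq_mul]
  have hsmall : ∀ (x : Fin n → ℝ) (r : ℝ), ρ₁ ≤ r → ∀ ξ ∈ F,
      (((S ξ).filter fun a => dist a x ≤ ρ₁ + r).card : ℝ) * s ^ n ≤ (4 * r + s) ^ n := by
    intro x r hr ξ hξ
    refine (card_mul_pow_le_of_separated hs (R := ρ₁ + r) (x := x) (by linarith) ?_ ?_).trans ?_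
    · intro a ha b hb
      exact hSsep ξ hξ a (Finset.mem_filter.1 ha).1 b (Finset.mem_filter.1 hb).1
    · intro a ha
      exact (Finset.mem_filter.1 ha).2
    · exact pow_le_pow_left₀ (by linarith) (by linarith) n
  have hfine : ∀ (x : Fin n → ℝ) (r : ℝ), ρ₁ ≤ r → r ≤ s → r ≤ ρ₀ →
      (((F.biUnion S).filter fun a => dist a x ≤ ρ₁ + r).card : ℝ) ≤
        η * A * (F.biUnion S).card * ρ₁ ^ t := by
    intro x r hr hrs hrρ
    refine (hcount x r ρ₀ (5 ^ n) hrρ fun ξ hξ => ?_).trans ?_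
    · refine le_of_mul_le_mul_right ((hsmall x r hr ξ hξ).trans ?_) (pow_pos hs n)
      rw [← mul_pow]
      exact pow_le_pow_left₀ (by linarith) (by linarith) n
    · calc _ ≤ (η * A * F.card * ρ₀ ^ t) * 5 ^ n := by
            gcongr
            exact hF.card_le_self x
        _ = η * A * F.card * (5 ^ n * ρ₀ ^ t) := by ring
        _ ≤ η * A * F.card * (N * ρ₁ ^ t) := by
            refine mul_le_mul_of_nonneg_left (hbig.trans ?_) (by positivity)
            gcongr
        _ = _ := by rw [hcard]; ring
  refine ⟨hρ₁, ?_, ?_, fun x r hr => ?_, fun x => hfine x ρ₁ le_rfl (by linarith) (by linarith)⟩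
  · rw [← Finset.card_pos]
    have : (0 : ℝ) < (F.biUnion S).card := by rw [hcard]; positivity
    exact_mod_cast this
  · intro a ha b hb hab
    obtain ⟨ξ, hξ, haξ⟩ := Finset.mem_biUnion.1 ha
    obtain ⟨ζ, hζ, hbζ⟩ := Finset.mem_biUnion.1 hb
    by_cases hne : ξ = ζ
    · subst hne
      exact hρ₁s.trans_lt (hSsep ξ hξ a haξ b hbζ hab)
    · have h1 := hSball ξ hξ a haξ
      have h2 := hSball ζ hζ b hbζ
      have h3 := hF.separated ξ hξ ζ hζ hne
      have h4 := dist_triangle4 ξ a b ζ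
      rw [dist_comm ξ a] at h4
      linarith
  · have hr0 : 0 < r := hρ₁.trans_le hr
    rcases le_total ρ₀ r with h0 | h0
    · refine (hcount x r r N le_rfl fun ξ hξ => ?_).trans ?_
      · rw [← hScard ξ hξ]
        exact_mod_cast Finset.card_filter_le _ _
      · calc _ ≤ (A * F.card * r ^ t) * N := by
              gcongr
              exact hF.card_le x r h0
          _ = _ := by rw [hcard]; ring
    rcases le_total r s with h1 | h1
    · refine (hfine x r hr h1 h0).trans ?_
      calc _ ≤ 1 * A * (F.biUnion S).card * r ^ t := by gcongr
        _ = _ := by rw [one_mul]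
    · refine (hcount x r ρ₀ ((5 * r / s) ^ n) h0 fun ξ hξ => ?_).trans ?_
      · rw [div_pow, le_div_iff₀ (pow_pos hs n)]
        exact (hsmall x r hr ξ hξ).trans (pow_le_pow_left₀ (by linarith) (by linarith) n)
      · have hpow : ρ₀ ^ t * r ^ n ≤ ρ₀ ^ n * r ^ t := by
          rw [← Real.rpow_natCast r, ← Real.rpow_natCast ρ₀,
            show (n : ℝ) = (n - t) + t by ring, Real.rpow_add hr0, Real.rpow_add hρ₀]
          have := Real.rpow_le_rpow hr0.le h0 (by linarith : (0 : ℝ) ≤ n - t)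
          calc ρ₀ ^ t * (r ^ ((n : ℝ) - t) * r ^ t) ≤
              ρ₀ ^ t * (ρ₀ ^ ((n : ℝ) - t) * r ^ t) := by gcongr
            _ = _ := by ring
        calc _ ≤ (η * A * F.card * ρ₀ ^ t) * (5 * r / s) ^ n := by
              gcongr
              exact hF.card_le_self x
          _ = A * F.card * ((η * 10 ^ n) * (ρ₀ ^ t * r ^ n) / (2 ^ n * s ^ n)) := by
              rw [show (10 : ℝ) = 5 * 2 by norm_num, mul_pow, div_pow, mul_pow]
              field_simp
          _ ≤ A * F.card * (c * (ρ₀ ^ n * r ^ t) / (2 ^ n * s ^ n)) := by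
              gcongr
          _ = A * F.card * (c * (ρ₀ / 2 / s) ^ n * r ^ t) := by
              rw [div_pow, div_pow]
              field_simp
          _ ≤ A * F.card * (N * r ^ t) := by gcongr
          _ = _ := by rw [hcard]; ring

/-- Finite form of the mass distribution principle: a decreasing intersection of unions of balls
around well-distributed finite sets has positive Hausdorff measure. -/
lemma hausdorffMeasure_iInter_ne_zero {n : ℕ} {t A η : ℝ} (ht0 : 0 < t) (hA : 0 < A)
    {F : ℕ → Finset (Fin n → ℝ)} {ρ : ℕ → ℝ} (hF : ∀ k, WellDistributed t A η (F k) (ρ k))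
    (hρ : Tendsto ρ atTop (nhds 0))
    (hanti : Antitone fun k => ⋃ ξ ∈ F k, Metric.closedBall ξ (ρ k)) :
    μH[t] (⋂ k, ⋃ ξ ∈ F k, Metric.closedBall ξ (ρ k)) ≠ 0 := by
  set E : ℕ → Set (Fin n → ℝ) := fun k => ⋃ ξ ∈ F k, Metric.closedBall ξ (ρ k)
  have hEcomp : ∀ k, IsCompact (E k) := fun k =>
    (F k).isCompact_biUnion fun ξ _ => isCompact_closedBall ξ (ρ k)
  intro hzero
  set ε : ENNReal := ENNReal.ofReal (1 / (4 * A)) with hε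
  have hε0 : 0 < ε := ENNReal.ofReal_pos.2 (by positivity)
  rw [Measure.hausdorffMeasure_apply] at hzero
  have h1 : (⨅ (U : ℕ → Set (Fin n → ℝ)) (_ : (⋂ k, E k) ⊆ ⋃ i, U i)
      (_ : ∀ i, Metric.ediam (U i) ≤ 1),
      ∑' i, ⨆ _ : (U i).Nonempty, Metric.ediam (U i) ^ t) < ε := by
    refine lt_of_le_of_lt ?_ hε0
    rw [← hzero]
    exact le_iSup₂_of_le (1 : ENNReal) zero_lt_one le_rfl
  simp only [iInf_lt_iff] at h1
  obtain ⟨U, hKU, hUdiam, hUsum⟩ := h1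
  obtain ⟨δ, hδ0, hδsum⟩ := ENNReal.exists_pos_sum_of_countable hε0.ne' ℕ
  set d : ℕ → ℝ := fun i => (Metric.ediam (U i)).toReal with hd
  have hdtop : ∀ i, Metric.ediam (U i) ≠ ⊤ := fun i =>
    ne_top_of_le_ne_top ENNReal.one_ne_top (hUdiam i)
  set r : ℕ → ℝ := fun i => (d i ^ t + δ i) ^ t⁻¹ with hr
  have hd0 : ∀ i, 0 ≤ d i := fun i => ENNReal.toReal_nonneg
  have hδ0' : ∀ i, (0 : ℝ) < δ i := fun i => hδ0 i
  have hdt0 : ∀ i, 0 ≤ d i ^ t := fun i => Real.rpow_nonneg (hd0 i) t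
  have hbase : ∀ i, 0 < d i ^ t + δ i := fun i => by linarith [hdt0 i, hδ0' i]
  have hr0 : ∀ i, 0 < r i := fun i => Real.rpow_pos_of_pos (hbase i) _
  have hrt : ∀ i, r i ^ t = d i ^ t + δ i := fun i =>
    Real.rpow_inv_rpow (hbase i).le ht0.ne'
  have hdr : ∀ i, d i < r i := fun i => by
    rw [← Real.rpow_lt_rpow_iff (hd0 i) (hr0 i).le ht0, hrt]
    linarith [hδ0' i]
  have hxex : ∀ i, ∃ x, U i ⊆ Metric.ball x (r i) := by
    intro i
    rcases (U i).eq_empty_or_nonempty with h | ⟨x, hx⟩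
    · exact ⟨0, by simp [h]⟩
    · refine ⟨x, fun y hy => ?_⟩
      refine lt_of_le_of_lt ?_ (hdr i)
      rw [dist_edist]
      exact ENNReal.toReal_mono (hdtop i) (Metric.edist_le_ediam_of_mem hy hx)
  choose x hx using hxex
  have hrsum : ∑' i, ENNReal.ofReal (r i ^ t) < ENNReal.ofReal (1 / (2 * A)) := by
    have h2 : ∀ i, ENNReal.ofReal (r i ^ t) =
        (⨆ _ : (U i).Nonempty, Metric.ediam (U i) ^ t) + (δ i : ENNReal) := by
      intro i
      rw [hrt, ENNReal.ofReal_add (hdt0 i) (hδ0' i).le, ENNReal.ofReal_coe_nnreal,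
        ← ENNReal.ofReal_rpow_of_nonneg (hd0 i) ht0.le, ENNReal.ofReal_toReal (hdtop i)]
      congr 1
      rcases (U i).eq_empty_or_nonempty with h | h
      · simp [h, ht0]
      · simp [h]
    simp only [h2]
    rw [ENNReal.tsum_add, show 1 / (2 * A) = 1 / (4 * A) + 1 / (4 * A) by field_simp; norm_num,
      ENNReal.ofReal_add (by positivity) (by positivity)]
    exact ENNReal.add_lt_add hUsum hδsum
  have hopen : IsOpen (⋃ i, Metric.ball (x i) (r i)) := isOpen_iUnion fun i => Metric.isOpen_ball
  obtain ⟨k, hk⟩ : ∃ k, E k ⊆ ⋃ i, Metric.ball (x i) (r i) := by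
    refine exists_subset_nhds_of_isCompact' (V := E) ?_ hEcomp (fun k => (hEcomp k).isClosed) ?_
    · exact directed_of_isDirected_le fun i j hij => hanti hij
    · intro y hy
      refine hopen.mem_nhds ?_
      exact (hKU.trans (Set.iUnion_mono hx)) hy
  obtain ⟨I, hI⟩ := (hEcomp k).elim_finite_subcover _ (fun i => Metric.isOpen_ball) hk
  obtain ⟨m, hmk, hm⟩ : ∃ m, k ≤ m ∧ ∀ i ∈ I, ρ m ≤ r i := by
    have h3 : ∀ᶠ m in atTop, ∀ i ∈ I, ρ m ≤ r i := by
      rw [Filter.eventually_all_finset]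
      exact fun i _ => hρ.eventually_le_const (hr0 i)
    obtain ⟨m, h4, h5⟩ := ((eventually_ge_atTop k).and h3).exists
    exact ⟨m, h4, h5⟩
  have hcardpos : (0 : ℝ) < (F m).card := by exact_mod_cast (hF m).nonempty.card_pos
  have hsub : F m ⊆ I.biUnion fun i => (F m).filter fun ξ => dist ξ (x i) ≤ ρ m + r i := by
    intro ξ hξ
    have hξE : ξ ∈ E m :=
      Set.mem_biUnion (Finset.mem_coe.2 hξ) (Metric.mem_closedBall_self (hF m).pos.le)
    obtain ⟨i, hiI, hi⟩ := Set.mem_iUnion₂.1 (hI (hanti hmk hξE))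
    refine Finset.mem_biUnion.2 ⟨i, hiI, Finset.mem_filter.2 ⟨hξ, ?_⟩⟩
    rw [Metric.mem_ball] at hi
    linarith [(hF m).pos]
  have hle : ((F m).card : ℝ) ≤ ∑ i ∈ I, A * (F m).card * r i ^ t := by
    calc ((F m).card : ℝ)
        ≤ ∑ i ∈ I, (((F m).filter fun ξ => dist ξ (x i) ≤ ρ m + r i).card : ℝ) := by
          exact_mod_cast (Finset.card_le_card hsub).trans Finset.card_biUnion_le
      _ ≤ _ := Finset.sum_le_sum fun i hi => (hF m).card_le _ _ (hm i hi)
  have hlt : ∑ i ∈ I, r i ^ t < 1 / (2 * A) := by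
    have h6 := (ENNReal.sum_le_tsum I).trans_lt hrsum
    rw [← ENNReal.ofReal_sum_of_nonneg fun i _ => (Real.rpow_pos_of_pos (hr0 i) t).le,
      ENNReal.ofReal_lt_ofReal_iff (by positivity)] at h6
    exact h6
  rw [← Finset.mul_sum] at hle
  have : A * (F m).card * ∑ i ∈ I, r i ^ t < A * (F m).card * (1 / (2 * A)) := by gcongr
  rw [show A * (F m).card * (1 / (2 * A)) = (F m).card / 2 by field_simp] at this
  linarith

/-- Ubiquity: if every ball inside `closedBall z R` contains, for all large `M`, a proportion of
the largest possible number of `s M`-separated points of `Y M`, then the set of points infinitely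
often within `ρ M` of `Y M` has dimension at least `t`, as soon as `ρ M ^ t` is large compared
with `s M ^ n`. -/
theorem le_dimH_of_ubiquitous {n : ℕ} {t c R : ℝ} {z : Fin n → ℝ} (ht0 : 0 < t) (htn : t < n)
    (hc : 0 < c) (hR : 0 < R) {s ρ : ℕ → ℝ} (hρ0 : ∀ᶠ M in atTop, 0 < ρ M)
    (hρs : ∀ᶠ M in atTop, 2 * ρ M ≤ s M) (hρ : Tendsto ρ atTop (nhds 0))
    (hbig : Tendsto (fun M => ρ M ^ t / s M ^ n) atTop atTop) {Y : ℕ → Set (Fin n → ℝ)}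
    (hY : ∀ ξ r, 0 < r → Metric.closedBall ξ r ⊆ Metric.closedBall z R → ∀ᶠ M in atTop,
      ∃ S : Finset (Fin n → ℝ), (∀ a ∈ S, a ∈ Y M) ∧ (∀ a ∈ S, dist a ξ ≤ r) ∧
        (∀ a ∈ S, ∀ b ∈ S, a ≠ b → s M < dist a b) ∧ c * (r / s M) ^ n ≤ S.card) :
    ENNReal.ofReal t ≤
      dimH {x ∈ Metric.closedBall z R | ∃ᶠ M in atTop, ∃ y ∈ Y M, dist x y ≤ ρ M} := by
  set η : ℝ := min 1 (c / 10 ^ n) with hη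
  have hη0 : 0 < η := lt_min one_pos (by positivity)
  have hη1 : η ≤ 1 := min_le_left _ _
  have hηc : η * 10 ^ n ≤ c := (le_div_iff₀ (by positivity)).1 (min_le_right _ _)
  set A : ℝ := 1 / (η * R ^ t) with hA'
  have hRt : 0 < R ^ t := Real.rpow_pos_of_pos hR t
  have hA : 0 < A := by positivity
  let E : Finset (Fin n → ℝ) → ℝ → Set (Fin n → ℝ) := fun F r => ⋃ ξ ∈ F, Metric.closedBall ξ r
  have hstep : ∀ (F : Finset (Fin n → ℝ)) (r : ℝ), WellDistributed t A η F r →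
      E F r ⊆ Metric.closedBall z R → ∀ m : ℕ, ∃ M > m, ∃ F' : Finset (Fin n → ℝ),
        WellDistributed t A η F' (ρ M) ∧ E F' (ρ M) ⊆ E F r ∧ ∀ a ∈ F', a ∈ Y M := by
    intro F r hF hFR m
    have hr := hF.pos
    have hev : ∀ᶠ M in atTop, ∀ ξ ∈ F, ∃ S : Finset (Fin n → ℝ), (∀ a ∈ S, a ∈ Y M) ∧
        (∀ a ∈ S, dist a ξ ≤ r / 2) ∧ (∀ a ∈ S, ∀ b ∈ S, a ≠ b → s M < dist a b) ∧
        c * (r / 2 / s M) ^ n ≤ S.card := by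
      rw [Filter.eventually_all_finset]
      refine fun ξ hξ => hY ξ (r / 2) (by positivity) ?_
      refine (Metric.closedBall_subset_closedBall (half_le_self hr.le)).trans (Subset.trans ?_ hFR)
      exact Set.subset_biUnion_of_mem (u := fun ξ => Metric.closedBall ξ r) (Finset.mem_coe.2 hξ)
    have hev2 : ∀ᶠ M in atTop, 5 ^ n * r ^ t / (c * (r / 2) ^ n) ≤ ρ M ^ t / s M ^ n :=
      hbig.eventually_ge_atTop _
    have hev3 : ∀ᶠ M in atTop, ρ M ≤ r / 2 := hρ.eventually_le_const (by positivity)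
    obtain ⟨M, hmM, hM1, hM2, hM3, hM4, hM5⟩ := ((eventually_gt_atTop m).and
      (hev.and (hev2.and (hev3.and (hρ0.and hρs))))).exists
    have hs : 0 < s M := by linarith
    have hM1' : ∀ ξ : Fin n → ℝ, ∃ S : Finset (Fin n → ℝ), ξ ∈ F → ((∀ a ∈ S, a ∈ Y M) ∧
        (∀ a ∈ S, dist a ξ ≤ r / 2) ∧ (∀ a ∈ S, ∀ b ∈ S, a ≠ b → s M < dist a b) ∧
        S.card = ⌈c * (r / 2 / s M) ^ n⌉₊) := by
      intro ξ
      by_cases hξ : ξ ∈ F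
      · obtain ⟨S, h1, h2, h3, h4⟩ := hM1 ξ hξ
        obtain ⟨T, hTS, hT⟩ := Finset.exists_subset_card_eq (Nat.ceil_le.2 h4)
        exact ⟨T, fun _ => ⟨fun a ha => h1 a (hTS ha), fun a ha => h2 a (hTS ha),
          fun a ha b hb => h3 a (hTS ha) b (hTS hb), hT⟩⟩
      · exact ⟨∅, fun h => absurd h hξ⟩
    choose S hS using hM1'
    have hwd : WellDistributed t A η (F.biUnion S) (ρ M) := by
      refine hF.biUnion ht0 htn hA hη0 hη1 hηc hM4 hM5 (by linarith) ?_
        (fun ξ hξ => (hS ξ hξ).2.1) (fun ξ hξ => (hS ξ hξ).2.2.1) (fun ξ hξ => (hS ξ hξ).2.2.2)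
        (Nat.le_ceil _)
      rw [div_le_div_iff₀ (by positivity) (by positivity)] at hM2
      rw [div_pow _ (s M), mul_div_assoc', div_mul_eq_mul_div, le_div_iff₀ (by positivity)]
      linarith
    refine ⟨M, hmM, F.biUnion S, hwd, ?_, fun a ha => ?_⟩
    · refine Set.iUnion₂_subset fun a ha => ?_
      obtain ⟨ξ, hξ, haξ⟩ := Finset.mem_biUnion.1 ha
      refine Set.subset_iUnion₂_of_subset ξ hξ (Metric.closedBall_subset_closedBall' ?_)
      linarith [(hS ξ hξ).2.1 a haξ]
    · obtain ⟨ξ, hξ, haξ⟩ := Finset.mem_biUnion.1 ha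
      exact (hS ξ hξ).1 a haξ
  let St : Type := {p : Finset (Fin n → ℝ) × ℝ × ℕ //
    WellDistributed t A η p.1 p.2.1 ∧ E p.1 p.2.1 ⊆ Metric.closedBall z R}
  have hnext : ∀ p : St, ∃ p' : St, p.1.2.2 < p'.1.2.2 ∧ p'.1.2.1 = ρ p'.1.2.2 ∧
      E p'.1.1 p'.1.2.1 ⊆ E p.1.1 p.1.2.1 ∧ ∀ a ∈ p'.1.1, a ∈ Y p'.1.2.2 := by
    rintro ⟨⟨F, r, m⟩, hF, hFR⟩
    obtain ⟨M, hM, F', h1, h2, h3⟩ := hstep F r hF hFR m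
    exact ⟨⟨⟨F', ρ M, M⟩, h1, h2.trans hFR⟩, hM, rfl, h2, h3⟩
  choose next hnext1 hnext2 hnext3 hnext4 using hnext
  have hinit : WellDistributed t A η {z} R := by
    have hηA : η * A * R ^ t = 1 := by rw [hA']; field_simp
    refine ⟨hR, Finset.singleton_nonempty z, ?_, fun x r hr => ?_, fun x => ?_⟩
    · intro a ha b hb hab
      rw [Finset.mem_singleton] at ha hb
      exact absurd (ha.trans hb.symm) hab
    · have h1 : ((({z} : Finset (Fin n → ℝ)).filter fun ξ => dist ξ x ≤ R + r).card : ℝ) ≤ 1 := by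
        exact_mod_cast Finset.card_filter_le _ _
      refine h1.trans ?_
      rw [Finset.card_singleton, Nat.cast_one, mul_one, ← hηA]
      calc η * A * R ^ t ≤ 1 * A * r ^ t := by gcongr
        _ = _ := by ring
    · have h1 : ((({z} : Finset (Fin n → ℝ)).filter fun ξ => dist ξ x ≤ R + R).card : ℝ) ≤ 1 := by
        exact_mod_cast Finset.card_filter_le _ _
      rw [Finset.card_singleton, Nat.cast_one, mul_one, hηA]
      exact h1
  let p₀ : St := ⟨⟨{z}, R, 0⟩, hinit, by simp [E]⟩
  let p : ℕ → St := fun k => next^[k + 1] p₀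
  have hp : ∀ k, p (k + 1) = next (p k) := fun k => Function.iterate_succ_apply' next (k + 1) p₀
  have hp' : ∀ k, ∃ q, p k = next q := fun k => ⟨_, Function.iterate_succ_apply' next k p₀⟩
  have hmono : StrictMono fun k => (p k).1.2.2 := strictMono_nat_of_lt_succ fun k => by
    rw [hp]
    exact hnext1 _
  have hrad : ∀ k, (p k).1.2.1 = ρ (p k).1.2.2 := fun k => by
    obtain ⟨q, hq⟩ := hp' k
    rw [hq]
    exact hnext2 q
  have hmem : ∀ k, ∀ a ∈ (p k).1.1, a ∈ Y (p k).1.2.2 := fun k => by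
    obtain ⟨q, hq⟩ := hp' k
    rw [hq]
    exact hnext4 q
  have hpos := hausdorffMeasure_iInter_ne_zero ht0 hA (F := fun k => (p k).1.1)
    (ρ := fun k => (p k).1.2.1) (fun k => (p k).2.1)
    (by simp only [hrad]; exact hρ.comp hmono.tendsto_atTop)
    (antitone_nat_of_succ_le fun k => by
      simp only [hp]
      exact hnext3 (p k))
  have hsub : (⋂ k, ⋃ ξ ∈ (p k).1.1, Metric.closedBall ξ (p k).1.2.1) ⊆
      {x ∈ Metric.closedBall z R | ∃ᶠ M in atTop, ∃ y ∈ Y M, dist x y ≤ ρ M} := by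
    intro x hx
    rw [Set.mem_iInter] at hx
    refine ⟨(p 0).2.2 (hx 0), Filter.frequently_atTop.2 fun m => ⟨(p m).1.2.2, hmono.id_le m, ?_⟩⟩
    obtain ⟨ξ, hξ, hxξ⟩ := Set.mem_iUnion₂.1 (hx m)
    refine ⟨ξ, hmem m ξ hξ, ?_⟩
    rw [← hrad]
    exact hxξ
  refine le_trans ?_ (dimH_mono hsub)
  refine le_dimH_of_hausdorffMeasure_ne_zero (d := t.toNNReal) ?_
  rw [Real.coe_toNNReal t ht0.le]
  exact hpos

/-- The rational point `p / q`. -/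
noncomputable def ratPoint {n : ℕ} (p : Fin n → ℤ) (q : ℕ) : Fin n → ℝ := fun i => p i / q

/-- The numerators `p` such that `p / q` lies in the closed ball of centre `ξ` and radius `r`. -/
noncomputable def numeratorsNear {n : ℕ} (ξ : Fin n → ℝ) (r : ℝ) (q : ℕ) : Finset (Fin n → ℤ) :=
  Finset.Icc (fun i => ⌈q * (ξ i - r)⌉) (fun i => ⌊q * (ξ i + r)⌋)

lemma mem_numeratorsNear {n : ℕ} {ξ : Fin n → ℝ} {r : ℝ} {q : ℕ} (hq : 0 < q) {p : Fin n → ℤ}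
    (h : dist (ratPoint p q) ξ ≤ r) : p ∈ numeratorsNear ξ r q := by
  have hq' : (0 : ℝ) < q := by exact_mod_cast hq
  have h1 : ∀ i, (q : ℝ) * (ξ i - r) ≤ p i ∧ (p i : ℝ) ≤ q * (ξ i + r) := fun i => by
    have h2 := (dist_le_pi_dist _ _ i).trans h
    rw [Real.dist_eq, abs_le, ratPoint] at h2
    constructor
    · rw [← le_div_iff₀' hq']
      linarith [h2.1]
    · rw [← div_le_iff₀' hq']
      linarith [h2.2]
  exact Finset.mem_Icc.2 ⟨fun i => Int.ceil_le.2 (h1 i).1, fun i => Int.le_floor.2 (h1 i).2⟩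

lemma card_numeratorsNear_le {n : ℕ} (ξ : Fin n → ℝ) {r : ℝ} (hr : 0 ≤ r) (q : ℕ) :
    ((numeratorsNear ξ r q).card : ℝ) ≤ (2 * q * r + 1) ^ n := by
  rw [numeratorsNear, Pi.card_Icc, Nat.cast_prod]
  refine (Finset.prod_le_prod (fun i _ => Nat.cast_nonneg _) fun i _ => ?_).trans_eq
    (show ∏ _i : Fin n, (2 * q * r + 1 : ℝ) = _ by simp)
  have hqr : (0 : ℝ) ≤ q * r := by positivity
  rw [Int.card_Icc, ← Int.cast_natCast, Int.toNat_eq_max, Int.cast_max, max_le_iff]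
  push_cast
  constructor
  · linarith [Int.floor_le ((q : ℝ) * (ξ i + r)), Int.le_ceil ((q : ℝ) * (ξ i - r))]
  · linarith

lemma volume_ballsAroundRationals_le {n : ℕ} (hn : 0 < n) (ξ : Fin n → ℝ) {r : ℝ} (hr : 0 ≤ r)
    (q M : ℕ) :
    volume (⋃ p ∈ numeratorsNear ξ r q, Metric.closedBall (ratPoint p q) (1 / (q * M))) ≤
      ENNReal.ofReal ((2 / M) ^ n * (2 * r + 1 / q) ^ n) := by
  refine (measure_biUnion_finset_le _ _).trans ?_
  simp only [Real.volume_pi_closedBall _ (show (0 : ℝ) ≤ 1 / (q * M) by positivity),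
    Finset.sum_const, nsmul_eq_mul, Fintype.card_fin]
  rw [← ENNReal.ofReal_natCast, ← ENNReal.ofReal_mul (by positivity)]
  refine ENNReal.ofReal_le_ofReal ?_
  rcases Nat.eq_zero_or_pos q with rfl | hq
  · simp only [Nat.cast_zero, zero_mul, div_zero, mul_zero, zero_pow hn.ne', add_zero]
    positivity
  · have hq' : (0 : ℝ) < q := by exact_mod_cast hq
    calc _ ≤ (2 * q * r + 1) ^ n * (2 * (1 / (q * M : ℝ))) ^ n := by
          gcongr
          exact card_numeratorsNear_le ξ hr q
      _ = _ := by
          rw [← mul_pow, ← mul_pow]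
          congr 1
          field_simp

/-- Dirichlet's theorem on simultaneous approximation. -/
lemma exists_dist_ratPoint_le {n : ℕ} {M : ℕ} (hM : 0 < M) (x : Fin n → ℝ) :
    ∃ q : ℕ, 0 < q ∧ q ≤ M ^ n ∧ ∃ p : Fin n → ℤ, dist x (ratPoint p q) ≤ 1 / (q * M) := by
  have hM' : (0 : ℝ) < M := by exact_mod_cast hM
  let f : ℕ → Fin n → Fin M := fun q i =>
    ⟨⌊Int.fract (q * x i) * M⌋₊, by
      rw [Nat.floor_lt (mul_nonneg (Int.fract_nonneg _) hM'.le)]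
      exact mul_lt_of_lt_one_left hM' (Int.fract_lt_one _)⟩
  obtain ⟨a, ha, b, hb, hab, hf⟩ : ∃ a ≤ M ^ n, ∃ b ≤ M ^ n, a < b ∧ f a = f b := by
    obtain ⟨a, ha, b, hb, hab, hf⟩ := Finset.exists_ne_map_eq_of_card_lt_of_maps_to
      (s := Finset.range (M ^ n + 1)) (t := Finset.univ) (f := f) (by simp)
      (fun _ _ => Finset.mem_coe.2 (Finset.mem_univ _))
    rw [Finset.mem_range, Nat.lt_succ_iff] at ha hb
    rcases lt_or_gt_of_ne hab with h | h
    · exact ⟨a, ha, b, hb, h, hf⟩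
    · exact ⟨b, hb, a, ha, h, hf.symm⟩
  have hq : (0 : ℝ) < (b - a : ℕ) := by exact_mod_cast Nat.sub_pos_of_lt hab
  refine ⟨b - a, Nat.sub_pos_of_lt hab, (Nat.sub_le _ _).trans hb,
    fun i => ⌊b * x i⌋ - ⌊a * x i⌋, ?_⟩
  rw [dist_pi_le_iff (by positivity)]
  intro i
  have hfi : ⌊Int.fract (a * x i) * M⌋₊ = ⌊Int.fract (b * x i) * M⌋₊ :=
    congrArg Fin.val (congrFun hf i)
  have h1 := Nat.floor_le (mul_nonneg (Int.fract_nonneg (a * x i)) hM'.le)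
  have h2 := Nat.lt_floor_add_one (Int.fract (a * x i) * M)
  have h3 := Nat.floor_le (mul_nonneg (Int.fract_nonneg (b * x i)) hM'.le)
  have h4 := Nat.lt_floor_add_one (Int.fract (b * x i) * M)
  rw [hfi] at h1 h2
  have h5 : |Int.fract (b * x i) - Int.fract (a * x i)| ≤ 1 / M := by
    rw [abs_le, le_div_iff₀ hM', ← neg_div, div_le_iff₀ hM']
    constructor <;> linarith
  have h6 : x i - ratPoint (fun i => ⌊b * x i⌋ - ⌊a * x i⌋) (b - a) i =
      (Int.fract (b * x i) - Int.fract (a * x i)) / (b - a : ℕ) := by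
    rw [ratPoint, eq_div_iff hq.ne', sub_mul, div_mul_cancel₀ _ hq.ne', Nat.cast_sub hab.le,
      Int.fract, Int.fract]
    push_cast
    ring
  rw [Real.dist_eq, h6, abs_div, abs_of_pos hq, mul_comm _ (M : ℝ), ← div_div]
  gcongr

lemma exists_separated_net {X : Type*} [PseudoMetricSpace X] [DecidableEq X] (G : Finset X)
    {s : ℝ} (hs : 0 ≤ s) :
    ∃ S ⊆ G, (∀ a ∈ S, ∀ b ∈ S, a ≠ b → s < dist a b) ∧ ∀ y ∈ G, ∃ a ∈ S, dist y a ≤ s := by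
  induction G using Finset.induction_on with
  | empty => exact ⟨∅, by simp⟩
  | insert y G hy ih =>
    obtain ⟨S, hSG, hsep, hnet⟩ := ih
    by_cases h : ∃ a ∈ S, dist y a ≤ s
    · refine ⟨S, hSG.trans (Finset.subset_insert _ _), hsep, fun w hw => ?_⟩
      rcases Finset.mem_insert.1 hw with rfl | hw
      · exact h
      · exact hnet w hw
    · push Not at h
      refine ⟨insert y S, Finset.insert_subset_insert _ hSG, fun a ha b hb hab => ?_,
        fun w hw => ?_⟩
      · rcases Finset.mem_insert.1 ha with rfl | ha' <;> rcases Finset.mem_insert.1 hb with rfl | hb'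
        · exact absurd rfl hab
        · exact h b hb'
        · rw [dist_comm]
          exact h a ha'
        · exact hsep a ha' b hb' hab
      · rcases Finset.mem_insert.1 hw with rfl | hw
        · exact ⟨w, Finset.mem_insert_self _ _, by simpa using hs⟩
        · obtain ⟨a, ha, hwa⟩ := hnet w hw
          exact ⟨a, Finset.mem_insert_of_mem ha, hwa⟩

/-- The points within `1 / (q * M)` of a rational with denominator `q < δ * M ^ n` have small
measure. -/
lemma eventually_volume_smallDenominators_le {n : ℕ} (hn : 0 < n) (ξ : Fin n → ℝ) {r δ : ℝ}
    (hr : 0 < r) (hδ : 0 < δ) :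
    ∀ᶠ M : ℕ in atTop,
      volume (⋃ q ∈ Finset.range ⌊δ * (M : ℝ) ^ n⌋₊, ⋃ p ∈ numeratorsNear ξ r q,
        Metric.closedBall (ratPoint p q) (1 / (q * M))) ≤ ENNReal.ofReal (δ * (6 * r) ^ n) := by
  have h1 : Tendsto (fun q : ℕ => (2 * r + 1 / (q : ℝ)) ^ n) atTop (nhds ((2 * r + 0) ^ n)) :=
    (tendsto_const_nhds.add tendsto_one_div_atTop_nhds_zero_nat).pow n
  have h2 := h1.cesaro.eventually_le_const
    (show (2 * r + 0) ^ n < (3 * r) ^ n from pow_lt_pow_left₀ (by linarith) (by linarith) hn.ne')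
  have h3 : Tendsto (fun M : ℕ => ⌊δ * (M : ℝ) ^ n⌋₊) atTop atTop :=
    tendsto_nat_floor_atTop.comp (Tendsto.const_mul_atTop hδ
      ((tendsto_pow_atTop hn.ne').comp tendsto_natCast_atTop_atTop))
  filter_upwards [h3.eventually h2, h3.eventually_ge_atTop 1, eventually_gt_atTop 0]
    with M hM hL hM0
  set L := ⌊δ * (M : ℝ) ^ n⌋₊ with hLdef
  have hL0 : (0 : ℝ) < L := by exact_mod_cast hL
  have hM0' : (0 : ℝ) < M := by exact_mod_cast hM0
  have hLle : (L : ℝ) ≤ δ * (M : ℝ) ^ n := Nat.floor_le (by positivity)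
  rw [inv_mul_le_iff₀ hL0] at hM
  refine (measure_biUnion_finset_le _ _).trans ?_
  refine (Finset.sum_le_sum fun q _ => volume_ballsAroundRationals_le hn ξ hr.le q M).trans ?_
  rw [← ENNReal.ofReal_sum_of_nonneg fun q _ => by positivity, ← Finset.mul_sum]
  refine ENNReal.ofReal_le_ofReal ?_
  calc _ ≤ (2 / (M : ℝ)) ^ n * (δ * (M : ℝ) ^ n * (3 * r) ^ n) := by
        gcongr
        exact hM.trans (by gcongr)
    _ = _ := by
        rw [show 6 * r = 2 * (3 * r) by ring, mul_pow 2, div_pow]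
        field_simp

lemma one_le_norm_numerator_le {n : ℕ} (hn : 0 < n) {p : Fin n → ℤ} {q : ℕ} (hq : 0 < q)
    (h : dist (ratPoint p q) (fun _ => 1 / 2) ≤ 1 / 4) : 1 ≤ ‖p‖ ∧ ‖p‖ ≤ q := by
  have hq' : (0 : ℝ) < q := by exact_mod_cast hq
  have h1 : ∀ i, 0 < p i ∧ (p i : ℝ) ≤ q := fun i => by
    have h2 := (dist_le_pi_dist _ _ i).trans h
    rw [Real.dist_eq, abs_le, ratPoint] at h2
    have h3 : (0 : ℝ) < p i / q := by linarith [h2.1]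
    have h4 : (p i : ℝ) / q ≤ 1 := by linarith [h2.2]
    rw [div_le_one hq'] at h4
    exact ⟨by exact_mod_cast (div_pos_iff_of_pos_right hq').1 h3, h4⟩
  constructor
  · refine le_trans ?_ (norm_le_pi_norm p ⟨0, hn⟩)
    rw [Int.norm_eq_abs]
    have : (1 : ℝ) ≤ p ⟨0, hn⟩ := by exact_mod_cast (h1 ⟨0, hn⟩).1
    exact this.trans (le_abs_self _)
  · rw [pi_norm_le_iff_of_nonneg hq'.le]
    intro i
    rw [Int.norm_eq_abs, abs_of_pos (by exact_mod_cast (h1 i).1)]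
    exact (h1 i).2

lemma dist_ratPoint_perturbedRat {n : ℕ} (γ : (Fin n → ℤ) × ℕ → Fin n → ℝ) (p : Fin n → ℤ)
    (q : ℕ) : dist (ratPoint p q) (perturbedRat γ (p, q)) = ‖γ (p, q)‖ / q := by
  have h : ratPoint p q - perturbedRat γ (p, q) = (q : ℝ)⁻¹ • γ (p, q) := by
    ext i
    simp only [ratPoint, perturbedRat, Pi.sub_apply, Pi.smul_apply, smul_eq_mul]
    ring
  rw [dist_eq_norm, h, norm_smul, norm_inv, Real.norm_natCast, inv_mul_eq_div]

/-- The perturbed rational points with denominator between `δ M ^ n` and `M ^ n`. -/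
def perturbedRatsUpTo {n : ℕ} (γ : (Fin n → ℤ) × ℕ → Fin n → ℝ) (δ : ℝ) (M : ℕ) :
    Set (Fin n → ℝ) :=
  {y | ∃ pq : (Fin n → ℤ) × ℕ, 0 < pq.2 ∧ δ * (M : ℝ) ^ n ≤ pq.2 ∧ pq.2 ≤ M ^ n ∧
    y = perturbedRat γ pq}

/-- Small perturbations of the rationals are as well spread out as the rationals themselves. -/
theorem perturbedRatsUpTo_ubiquitous {n : ℕ} (hn : 0 < n)
    {γ : (Fin n → ℤ) × ℕ → Fin n → ℝ} {C : ℝ} (hC : 0 ≤ C)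
    (hγ : ∀ᶠ q : ℕ in atTop, ∀ p : Fin n → ℤ,
      1 ≤ ‖p‖ → ‖p‖ ≤ (q : ℝ) → ‖γ (p, q)‖ ≤ C * (q : ℝ) ^ (-(1 : ℝ) / n)) :
    ∃ δ > 0, ∃ c > 0, ∀ (ξ : Fin n → ℝ) (r : ℝ), 0 < r →
      Metric.closedBall ξ r ⊆ Metric.closedBall (fun _ => 1 / 2) (1 / 4) → ∀ᶠ M : ℕ in atTop,
      ∃ S : Finset (Fin n → ℝ), (∀ a ∈ S, a ∈ perturbedRatsUpTo γ δ M) ∧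
        (∀ a ∈ S, dist a ξ ≤ r) ∧
        (∀ a ∈ S, ∀ b ∈ S, a ≠ b → ((M : ℝ) ^ (n + 1))⁻¹ < dist a b) ∧
        c * (r / ((M : ℝ) ^ (n + 1))⁻¹) ^ n ≤ S.card := by
  classical
  set δ₀ : ℝ := 1 / (2 * 6 ^ n) with hδ₀
  set δ : ℝ := δ₀ / 2 with hδ
  have hδ₀0 : 0 < δ₀ := by positivity
  have hδ0 : 0 < δ := by positivity
  set D : ℝ := (1 + C * δ ^ (-(1 : ℝ) / n)) / δ with hD
  have hD0 : 0 < D := by positivity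
  refine ⟨δ, hδ0, 1 / (2 * (2 * (D + 1)) ^ n), by positivity, fun ξ r hr hξr => ?_⟩
  have hpowlim : ∀ {m : ℕ}, 0 < m → Tendsto (fun M : ℕ => (M : ℝ) ^ m) atTop atTop := fun hm =>
    (tendsto_pow_atTop hm.ne').comp tendsto_natCast_atTop_atTop
  have hslim : Tendsto (fun M : ℕ => D * ((M : ℝ) ^ (n + 1))⁻¹) atTop (nhds 0) := by
    rw [← mul_zero D]
    exact (tendsto_inv_atTop_zero.comp (hpowlim n.succ_pos)).const_mul D
  obtain ⟨Q₀, hQ₀⟩ := eventually_atTop.1 hγ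
  filter_upwards [eventually_volume_smallDenominators_le hn ξ hr hδ₀0, eventually_gt_atTop 0,
    hslim.eventually_le_const (show 0 < r / 4 by positivity),
    tendsto_one_div_atTop_nhds_zero_nat.eventually_le_const (show 0 < r / 4 by positivity),
    ((hpowlim hn).const_mul_atTop hδ0).eventually_ge_atTop (Q₀ : ℝ)] with M hvol hM0 hs4 hM4 hMQ
  have hM0' : (0 : ℝ) < M := by exact_mod_cast hM0
  have hM1 : (1 : ℝ) ≤ M := by exact_mod_cast hM0
  set s : ℝ := ((M : ℝ) ^ (n + 1))⁻¹ with hs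
  have hs0 : 0 < s := by positivity
  set B : Set (Fin n → ℝ) := ⋃ q ∈ Finset.range ⌊δ₀ * (M : ℝ) ^ n⌋₊, ⋃ p ∈ numeratorsNear ξ r q,
    Metric.closedBall (ratPoint p q) (1 / (q * M)) with hB
  let G : Finset (Fin n → ℝ) := ((Finset.range (M ^ n + 1)).biUnion fun q =>
    (numeratorsNear ξ r q).image fun p => perturbedRat γ (p, q)).filter
      fun y => y ∈ perturbedRatsUpTo γ δ M ∧ dist y ξ ≤ r
  have hG : ∀ x ∈ Metric.closedBall ξ (r / 2), x ∉ B → ∃ y ∈ G, dist x y ≤ D * s := by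
    intro x hx hxB
    obtain ⟨q, hq0, hqM, p, hp⟩ := exists_dist_ratPoint_le hM0 x
    have hq0' : (0 : ℝ) < q := by exact_mod_cast hq0
    have hq1 : (1 : ℝ) ≤ q := by exact_mod_cast hq0
    have hxp4 : dist x (ratPoint p q) ≤ r / 4 := by
      refine hp.trans (le_trans ?_ hM4)
      exact one_div_le_one_div_of_le hM0' (le_mul_of_one_le_left hM0'.le hq1)
    have hpξ : dist (ratPoint p q) ξ ≤ r := by
      linarith [dist_triangle_left (ratPoint p q) ξ x, Metric.mem_closedBall.1 hx]
    have hpmem := mem_numeratorsNear hq0 hpξ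
    have hqL : ⌊δ₀ * (M : ℝ) ^ n⌋₊ ≤ q := by
      by_contra! h
      exact hxB (Set.mem_biUnion (Finset.mem_coe.2 (Finset.mem_range.2 h))
        (Set.mem_biUnion (Finset.mem_coe.2 hpmem) hp))
    have hqδ : δ * (M : ℝ) ^ n ≤ q := by
      have h1 := Nat.lt_floor_add_one (δ₀ * (M : ℝ) ^ n)
      have h2 : (⌊δ₀ * (M : ℝ) ^ n⌋₊ : ℝ) ≤ q := by exact_mod_cast hqL
      have h3 : δ * (M : ℝ) ^ n = δ₀ * (M : ℝ) ^ n / 2 := by rw [hδ]; ring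
      linarith
    have hnorm := one_le_norm_numerator_le hn hq0 (hξr hpξ)
    have hγq := hQ₀ q (by exact_mod_cast hMQ.trans hqδ) p hnorm.1 hnorm.2
    have hqpow : (q : ℝ) ^ (-(1 : ℝ) / n) ≤ δ ^ (-(1 : ℝ) / n) * (M : ℝ)⁻¹ := by
      have hn' : (n : ℝ) ≠ 0 := by exact_mod_cast hn.ne'
      have h1 := Real.rpow_le_rpow_of_nonpos (by positivity) hqδ
        (show -(1 : ℝ) / n ≤ 0 from div_nonpos_of_nonpos_of_nonneg (by norm_num) (by positivity))
      rwa [Real.mul_rpow hδ0.le (by positivity), ← Real.rpow_natCast (M : ℝ),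
        ← Real.rpow_mul hM0'.le, mul_div_cancel₀ _ hn', Real.rpow_neg_one] at h1
    have hdist1 : dist (ratPoint p q) (perturbedRat γ (p, q)) ≤
        C * δ ^ (-(1 : ℝ) / n) / δ * s := by
      rw [dist_ratPoint_perturbedRat]
      calc ‖γ (p, q)‖ / q ≤ C * (δ ^ (-(1 : ℝ) / n) * (M : ℝ)⁻¹) / (δ * (M : ℝ) ^ n) := by
            gcongr
            exact hγq.trans (by gcongr)
        _ = _ := by rw [hs, pow_succ]; field_simp
    have hdist2 : dist x (ratPoint p q) ≤ 1 / δ * s := by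
      refine hp.trans ?_
      calc 1 / ((q : ℝ) * M) ≤ 1 / (δ * (M : ℝ) ^ n * M) := by gcongr
        _ = _ := by rw [hs, pow_succ]; field_simp
    have hdist : dist x (perturbedRat γ (p, q)) ≤ D * s := by
      refine (dist_triangle _ (ratPoint p q) _).trans ((add_le_add hdist2 hdist1).trans_eq ?_)
      rw [hD]
      ring
    refine ⟨perturbedRat γ (p, q), Finset.mem_filter.2 ⟨Finset.mem_biUnion.2
      ⟨q, Finset.mem_range.2 (Nat.lt_succ_of_le hqM), Finset.mem_image_of_mem _ hpmem⟩,
      ⟨(p, q), hq0, hqδ, hqM, rfl⟩, ?_⟩, hdist⟩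
    linarith [dist_triangle_left (perturbedRat γ (p, q)) ξ x, Metric.mem_closedBall.1 hx]
  obtain ⟨S, hSG, hSsep, hSnet⟩ := exists_separated_net G hs0.le
  refine ⟨S, fun a ha => (Finset.mem_filter.1 (hSG ha)).2.1,
    fun a ha => (Finset.mem_filter.1 (hSG ha)).2.2, hSsep, ?_⟩
  have hcover : Metric.closedBall ξ (r / 2) ⊆
      B ∪ ⋃ a ∈ S, Metric.closedBall a ((D + 1) * s) := by
    intro x hx
    by_cases hxB : x ∈ B
    · exact Or.inl hxB
    · obtain ⟨y, hy, hxy⟩ := hG x hx hxB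
      obtain ⟨a, ha, hya⟩ := hSnet y hy
      refine Or.inr (Set.mem_biUnion (Finset.mem_coe.2 ha) ?_)
      rw [Metric.mem_closedBall]
      linarith [dist_triangle x y a]
  have hle := (measure_mono (μ := volume) hcover).trans ((measure_union_le _ _).trans
    (add_le_add hvol (measure_biUnion_finset_le _ _)))
  simp only [Real.volume_pi_closedBall _ (show 0 ≤ r / 2 by positivity),
    Real.volume_pi_closedBall _ (show 0 ≤ (D + 1) * s by positivity),
    Finset.sum_const, nsmul_eq_mul, Fintype.card_fin] at hle
  rw [← ENNReal.ofReal_natCast, ← ENNReal.ofReal_mul (by positivity),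
    ← ENNReal.ofReal_add (by positivity) (by positivity),
    ENNReal.ofReal_le_ofReal_iff (by positivity)] at hle
  have hhalf : δ₀ * (6 * r) ^ n = r ^ n / 2 := by
    rw [hδ₀, mul_pow]
    field_simp
  rw [hhalf, mul_div_cancel₀ _ two_ne_zero] at hle
  calc 1 / (2 * (2 * (D + 1)) ^ n) * (r / s) ^ n
      = r ^ n / 2 / (2 * ((D + 1) * s)) ^ n := by
        rw [div_pow, ← mul_assoc 2 (D + 1) s, mul_pow (2 * (D + 1)) s]
        field_simp
    _ ≤ S.card := by
        rw [div_le_iff₀ (by positivity)]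
        linarith

theorem le_dimH_Wgamma {n : ℕ} (hn : 0 < n) {τ : ℝ} (hτ : (1 : ℝ) / n ≤ τ)
    {γ : (Fin n → ℤ) × ℕ → Fin n → ℝ} {C : ℝ} (hC : 0 ≤ C)
    (hγ : ∀ᶠ q : ℕ in atTop, ∀ p : Fin n → ℤ,
      1 ≤ ‖p‖ → ‖p‖ ≤ (q : ℝ) → ‖γ (p, q)‖ ≤ C * (q : ℝ) ^ (-(1 : ℝ) / n)) :
    ENNReal.ofReal (((n : ℝ) + 1) / (1 + τ)) ≤
      dimH (Wgamma n (fun q => (q : ℝ) ^ (-τ)) γ) := by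
  have hn' : (0 : ℝ) < n := by exact_mod_cast hn
  have hτ0 : 0 < τ := lt_of_lt_of_le (by positivity) hτ
  have hnτ : (n : ℝ) + 1 ≤ n * (1 + τ) := by
    rw [div_le_iff₀ hn'] at hτ
    linarith
  obtain ⟨δ, hδ, c, hc, hub⟩ := perturbedRatsUpTo_ubiquitous hn hC hγ
  let ρ : ℕ → ℝ := fun M => (M : ℝ) ^ (-(n * (1 + τ))) / 2
  let s : ℕ → ℝ := fun M => ((M : ℝ) ^ (n + 1))⁻¹
  have hsub : {x ∈ Metric.closedBall (fun _ => 1 / 2 : Fin n → ℝ) (1 / 4) |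
      ∃ᶠ M in atTop, ∃ y ∈ perturbedRatsUpTo γ δ M, dist x y ≤ ρ M} ⊆
      Wgamma n (fun q => (q : ℝ) ^ (-τ)) γ := by
    rintro x ⟨hx, hfreq⟩
    refine ⟨fun i _ => ?_, ?_⟩
    · have h := (dist_le_pi_dist _ _ i).trans hx
      rw [Real.dist_eq, abs_le] at h
      exact ⟨by linarith [h.1], by linarith [h.2]⟩
    · refine Set.Infinite.of_image Prod.snd (Set.infinite_of_not_bddAbove ?_)
      rintro ⟨N, hN⟩
      have hlim : ∀ᶠ M : ℕ in atTop, (N : ℝ) + 1 ≤ δ * (M : ℝ) ^ n :=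
        (((tendsto_pow_atTop hn.ne').comp tendsto_natCast_atTop_atTop).const_mul_atTop
          hδ).eventually_ge_atTop _
      obtain ⟨M, ⟨y, ⟨pq, hq0, hqδ, hqM, rfl⟩, hxy⟩, hMN⟩ := (hfreq.and_eventually hlim).exists
      have hq0' : (0 : ℝ) < pq.2 := by exact_mod_cast hq0
      have hmem : pq.2 ≤ N := by
        refine hN ⟨pq, ⟨hq0, ?_⟩, rfl⟩
        rw [norm_eq_mul_dist_perturbedRat γ pq hq0]
        have hqM' : (pq.2 : ℝ) ≤ (M : ℝ) ^ n := by exact_mod_cast hqM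
        have h1 : (M : ℝ) ^ (-(n * (1 + τ))) ≤ (pq.2 : ℝ) ^ (-(1 + τ)) := by
          have h2 := Real.rpow_le_rpow_of_nonpos hq0' hqM' (show -(1 + τ) ≤ 0 by linarith)
          rwa [← Real.rpow_natCast (M : ℝ), ← Real.rpow_mul (by positivity), mul_neg] at h2
        have h3 : 0 < (pq.2 : ℝ) ^ (-(1 + τ)) := Real.rpow_pos_of_pos hq0' _
        have h4 : dist x (perturbedRat γ pq) < (pq.2 : ℝ) ^ (-(1 + τ)) := by
          refine hxy.trans_lt ?_
          simp only [ρ]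
          linarith
        calc (pq.2 : ℝ) * dist x (perturbedRat γ pq) < pq.2 * (pq.2 : ℝ) ^ (-(1 + τ)) := by
              gcongr
          _ = (pq.2 : ℝ) ^ (-τ) := by
              rw [show -τ = 1 + -(1 + τ) by ring, Real.rpow_add hq0', Real.rpow_one]
      have : (pq.2 : ℝ) ≤ N := by exact_mod_cast hmem
      linarith
  refine le_trans ?_ (dimH_mono hsub)
  refine le_of_forall_lt_imp_le_of_dense fun a ha => ?_
  obtain ⟨t, ht, hat, htlt⟩ := ENNReal.lt_iff_exists_real_btwn.1 ha
  refine hat.le.trans ?_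
  rcases ht.eq_or_lt with rfl | ht0
  · simp
  rw [ENNReal.ofReal_lt_ofReal_iff (by positivity), lt_div_iff₀ (by linarith)] at htlt
  have hρpos : ∀ᶠ M in atTop, 0 < ρ M := by
    filter_upwards [eventually_gt_atTop 0] with M hM
    have : (0 : ℝ) < M := by exact_mod_cast hM
    positivity
  refine le_dimH_of_ubiquitous (s := s) (ρ := ρ) ht0 ?_ hc (by norm_num) hρpos ?_ ?_ ?_ hub
  · nlinarith
  · filter_upwards [eventually_gt_atTop 0] with M hM
    have hM0 : (0 : ℝ) < M := by exact_mod_cast hM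
    have hM1 : (1 : ℝ) ≤ M := by exact_mod_cast hM
    simp only [ρ, s]
    rw [mul_div_cancel₀ _ two_ne_zero, ← Real.rpow_natCast, ← Real.rpow_neg hM0.le]
    refine Real.rpow_le_rpow_of_exponent_le hM1 ?_
    push_cast
    linarith
  · rw [← zero_div (2 : ℝ)]
    exact ((tendsto_rpow_neg_atTop (by positivity)).comp tendsto_natCast_atTop_atTop).div_const 2
  · have hexp : 0 < (n : ℝ) * ((n + 1) - t * (1 + τ)) := mul_pos hn' (by linarith)
    have hlim := ((tendsto_rpow_atTop hexp).comp
      tendsto_natCast_atTop_atTop).const_mul_atTop (show (0 : ℝ) < 1 / 2 ^ t by positivity)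
    refine hlim.congr' ?_
    filter_upwards [eventually_gt_atTop 0] with M hM
    have hM0 : (0 : ℝ) < M := by exact_mod_cast hM
    simp only [ρ, s, Function.comp_apply]
    rw [inv_pow, div_inv_eq_mul, Real.div_rpow (by positivity) zero_le_two, ← pow_mul,
      ← Real.rpow_natCast (M : ℝ), ← Real.rpow_mul hM0.le, one_div_mul_eq_div, div_mul_eq_mul_div,
      ← Real.rpow_add hM0]
    congr 2
    push_cast
    ring

theorem stmt4 (n : ℕ) (hn : 0 < n) (τψ : ℝ) (hτψ : (1 : ℝ) / n ≤ τψ)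
    (γ : (Fin n → ℤ) × ℕ → Fin n → ℝ)
    (hγbox : ∀ pq i, γ pq i ∈ Set.Icc (-(1 / 2) : ℝ) (1 / 2))
    (hkick : ∃ C : ℝ, ∀ᶠ q : ℕ in atTop, ∀ p : Fin n → ℤ,
      1 ≤ ‖p‖ → ‖p‖ ≤ (q : ℝ) →
        ‖γ (p, q)‖ ≤ C * (q : ℝ) ^ (-(1 : ℝ) / n)) :
    dimH (Wgamma n (fun q => (q : ℝ) ^ (-τψ)) γ) =
      ENNReal.ofReal (((n : ℝ) + 1) / (1 + τψ)) := by
  obtain ⟨C, hC⟩ := hkick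
  have hτ0 : 0 ≤ τψ := le_trans (by positivity) hτψ
  refine le_antisymm (dimH_Wgamma_le hτ0 hγbox)
    (le_dimH_Wgamma hn hτψ (le_max_right C 0) (hC.mono fun q hq p hp1 hp2 => ?_))
  refine (hq p hp1 hp2).trans ?_
  gcongr
  exact le_max_left C 0
end
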